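/- Let d ≥ 1 be an integer and q > 0 with α(d + 2q) < 1 + N, and let T be a compact interval in (0, ∞) × ℝ^N. Then there exist a constant C < ∞ and r₀ > 0 such that the following holds for all integers n ≥ 2: for every family of nonnegative reals (q_{j,k})_{1≤j≤n, 1≤k≤d} with Σ_{k=1}^d q_{j,k} = q for each j, and every compact subinterval I ⊆ T all of whose side lengths are ≤ r₀, ∫_{Iⁿ} ∏_{k=1}^d ( ∫_{ℝⁿ} ( ∏_{j=1}^n |c_j|^{q_{j,k}} ) exp( −(1/2) Q(c; z¹, …, zⁿ) ) dc ) dz¹ ⋯ dzⁿ ≤ Cⁿ (n!)^{αd + (1/2 + 2α)q} [λ_{1+N}(I)]^{n(1 − α(d+2q)/(1+N)) · d/(d+2q)}. -/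

import Mathlib

open MeasureTheory Set
open scoped ENNReal

/-- The time–space Fourier transform `𝒢_{t,x}(τ, ξ)` of the wave kernel
`g_{t,x}(s, y) = G(t − s, x − y) 1_{[0,t]}(s)`. -/
noncomputable def Gker (N : ℕ) (t : ℝ) (x : EuclideanSpace ℝ (Fin N)) (τ : ℝ)
    (ξ : EuclideanSpace ℝ (Fin N)) : ℂ :=
  (Complex.exp (-Complex.I * ((inner ℝ x ξ : ℝ) : ℂ)) / (2 * (‖ξ‖ : ℂ))) *
    ((Complex.exp (-Complex.I * (t : ℂ) * (τ : ℂ)) -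
        Complex.exp (Complex.I * (t : ℂ) * (‖ξ‖ : ℂ))) / ((τ : ℂ) + (‖ξ‖ : ℂ)) -
      (Complex.exp (-Complex.I * (t : ℂ) * (τ : ℂ)) -
        Complex.exp (-Complex.I * (t : ℂ) * (‖ξ‖ : ℂ))) / ((τ : ℂ) - (‖ξ‖ : ℂ)))

/-- The quadratic form
`Q(c; z¹, …, zⁿ) = ∫_ℝ ∫_{ℝ^N} |Σ_j c_j 𝒢_{z^j}(τ,ξ)|² |τ|^{1−2H} h_β(ξ) dξ dτ`, which (up
to a positive constant) is the variance `Var(Σ_j c_j u₁(z^j))`. -/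
noncomputable def Qvar (N : ℕ) (H : ℝ) (hfun : EuclideanSpace ℝ (Fin N) → ℝ) {n : ℕ}
    (z : Fin n → ℝ × EuclideanSpace ℝ (Fin N)) (c : Fin n → ℝ) : ℝ :=
  ∫ τ : ℝ, ∫ ξ : EuclideanSpace ℝ (Fin N),
    ‖∑ j, (c j : ℂ) * Gker N (z j).1 (z j).2 τ ξ‖ ^ 2 *
      |τ| ^ (1 - 2 * H) * hfun ξ

/-- `α = (2H + 1 − N + β)/2`. -/
noncomputable def alphaExp (N : ℕ) (H β : ℝ) : ℝ := (2 * H + 1 - N + β) / 2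

/-- phase form -/
noncomputable def yf {N : ℕ} (η : EuclideanSpace ℝ (Fin N)) (z : ℝ × EuclideanSpace ℝ (Fin N)) : ℝ :=
  z.1 * ‖η‖ + inner ℝ z.2 η

/-- exponential sum -/
noncomputable def Aw {N n : ℕ} (c : Fin n → ℝ) (z : Fin n → ℝ × EuclideanSpace ℝ (Fin N))
    (ξ : EuclideanSpace ℝ (Fin N)) : ℂ :=
  ∑ j, (c j : ℂ) * Complex.exp (-Complex.I * (yf ξ (z j) : ℂ))

/-- weight -/
noncomputable def om (N : ℕ) (H β : ℝ) (ξ : EuclideanSpace ℝ (Fin N)) : ℝ :=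
  (1 + ‖ξ‖) ^ (-(2 * H + 1)) * ‖ξ‖ ^ (-β)

lemma cs_weight {X : Type*} [MeasurableSpace X] (μ : Measure X) (f g : X → ℂ) (w : X → ℝ)
    (hf : AEMeasurable f μ) (hg : AEMeasurable g μ) (hw : AEMeasurable w μ)
    (hpos : ∀ᵐ x ∂μ, 0 < w x) :
    ‖∫ x, f x * g x ∂μ‖ₑ ^ 2 ≤ (∫⁻ x, ‖f x‖ₑ ^ 2 * ENNReal.ofReal (w x) ∂μ) *
      (∫⁻ x, ‖g x‖ₑ ^ 2 * ENNReal.ofReal ((w x)⁻¹) ∂μ) := by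
  have h1 : ‖∫ x, f x * g x ∂μ‖ₑ ≤ ∫⁻ x, ‖f x * g x‖ₑ ∂μ := enorm_integral_le_lintegral_enorm _
  set F : X → ℝ≥0∞ := fun x => ‖f x‖ₑ * (ENNReal.ofReal (w x)) ^ (1/2 : ℝ) with hF
  set G : X → ℝ≥0∞ := fun x => ‖g x‖ₑ * (ENNReal.ofReal ((w x)⁻¹)) ^ (1/2 : ℝ) with hG
  have h2 : ∫⁻ x, ‖f x * g x‖ₑ ∂μ = ∫⁻ x, (F * G) x ∂μ := by
    apply lintegral_congr_ae
    filter_upwards [hpos] with x hx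
    simp only [hF, hG, Pi.mul_apply, enorm_mul]
    have : (ENNReal.ofReal (w x)) ^ (1/2 : ℝ) * (ENNReal.ofReal ((w x)⁻¹)) ^ (1/2 : ℝ) = 1 := by
      rw [← ENNReal.mul_rpow_of_nonneg _ _ (by norm_num), ← ENNReal.ofReal_mul hx.le,
        mul_inv_cancel₀ hx.ne']
      simp
    calc ‖f x‖ₑ * ‖g x‖ₑ = ‖f x‖ₑ * ‖g x‖ₑ * 1 := by ring
      _ = _ := by rw [← this]; ring
  have h3 := ENNReal.lintegral_mul_le_Lp_mul_Lq μ (p := 2) (q := 2)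
    ⟨by norm_num, by norm_num, by norm_num⟩
    (f := F) (g := G) (by fun_prop) (by fun_prop)
  have hsq : ∀ (a b : ℝ≥0∞), (a * b ^ (1/2 : ℝ)) ^ (2:ℝ) = a ^ 2 * b := by
    intro a b
    rw [ENNReal.mul_rpow_of_nonneg _ _ (by norm_num), ← ENNReal.rpow_mul]
    norm_num
  have e1 : ∫⁻ x, F x ^ (2:ℝ) ∂μ = ∫⁻ x, ‖f x‖ₑ ^ 2 * ENNReal.ofReal (w x) ∂μ := by
    simp only [hF, hsq]
  have e2 : ∫⁻ x, G x ^ (2:ℝ) ∂μ = ∫⁻ x, ‖g x‖ₑ ^ 2 * ENNReal.ofReal ((w x)⁻¹) ∂μ := by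
    simp only [hG, hsq]
  rw [e1, e2] at h3
  calc ‖∫ x, f x * g x ∂μ‖ₑ ^ 2 ≤ (_ ^ (1/2:ℝ) * _ ^ (1/2:ℝ)) ^ 2 :=
        pow_le_pow_left' ((h1.trans h2.le).trans h3) 2
    _ = _ := by
        rw [mul_pow, ← ENNReal.rpow_natCast, ← ENNReal.rpow_natCast, ← ENNReal.rpow_mul,
          ← ENNReal.rpow_mul]
        norm_num

open FourierTransform in
lemma ft_exists (a : ℝ → ℂ) (ha : HasCompactSupport a) (ha' : ContDiff ℝ (⊤ : ℕ∞) a) :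
    ∃ g : ℝ → ℂ, Continuous g ∧ (∀ k : ℕ, ∃ C : ℝ, 0 < C ∧ ∀ τ, ‖g τ‖ * (1 + |τ|) ^ k ≤ C) ∧
      (∀ t : ℝ, ∫ τ : ℝ, Complex.exp (-Complex.I * t * τ) * g τ = a t) ∧
      (∀ τ : ℝ, g τ = (1 / (2 * Real.pi) : ℂ) * ∫ t : ℝ, Complex.exp (Complex.I * t * τ) * a t) := by
  set S : SchwartzMap ℝ ℂ := ha.toSchwartzMap ha' with hS
  set G : SchwartzMap ℝ ℂ := 𝓕⁻ S with hG
  have hFG : 𝓕 G = S := by rw [hG]; simp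
  have hpi := Real.pi_pos
  refine ⟨fun τ => (1 / (2 * Real.pi) : ℂ) * G (τ / (2 * Real.pi)), by fun_prop, ?_, ?_, ?_⟩
  · intro k
    have := SchwartzMap.one_add_le_sup_seminorm_apply (𝕜 := ℝ) (m := (k, 0)) (k := k) (n := 0) le_rfl le_rfl G
    set K := 2 ^ k * (Finset.Iic (k, 0)).sup (fun m => SchwartzMap.seminorm ℝ m.1 m.2) G
    refine ⟨(2 * Real.pi) ^ k * |K| + 1, by positivity, fun τ => ?_⟩
    have h := this (τ / (2 * Real.pi))
    simp only [norm_iteratedFDeriv_zero, Real.norm_eq_abs] at h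
    have h2 : (1 + |τ|) ^ k ≤ (2 * Real.pi) ^ k * (1 + |τ / (2 * Real.pi)|) ^ k := by
      rw [← mul_pow]
      apply pow_le_pow_left₀ (by positivity)
      rw [abs_div, abs_of_pos (show 0 < 2 * Real.pi by positivity), mul_add,
        mul_div_cancel₀ _ (by positivity)]
      linarith [Real.pi_gt_three]
    have h3 : ‖(1 / (2 * Real.pi) : ℂ)‖ ≤ 1 := by
      rw [norm_div, norm_mul]
      simp only [norm_one, Complex.norm_ofNat, Complex.norm_real, Real.norm_eq_abs, abs_of_pos hpi]
      rw [div_le_one (by positivity)]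
      linarith [Real.pi_gt_three]
    rw [norm_mul]
    calc _ ≤ 1 * ‖G (τ / (2 * Real.pi))‖ * ((2 * Real.pi) ^ k * (1 + |τ / (2 * Real.pi)|) ^ k) := by
          gcongr
      _ = (2 * Real.pi) ^ k * ((1 + |τ / (2 * Real.pi)|) ^ k * ‖G (τ / (2 * Real.pi))‖) := by ring
      _ ≤ (2 * Real.pi) ^ k * K := by gcongr
      _ ≤ (2 * Real.pi) ^ k * |K| := by gcongr; exact le_abs_self K
      _ ≤ _ := by linarith
  · intro t
    have h1 : a t = (𝓕 (G : ℝ → ℂ)) t := by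
      rw [← SchwartzMap.fourier_coe, hFG]; rfl
    rw [h1, Real.fourier_real_eq_integral_exp_smul]
    have := Measure.integral_comp_div (fun v : ℝ => Complex.exp (↑(-2 * Real.pi * v * t) * Complex.I) • G v) (2 * Real.pi)
    rw [abs_of_pos (by positivity)] at this
    have h2 : ∫ v : ℝ, Complex.exp (↑(-2 * Real.pi * v * t) * Complex.I) • G v
       = (1 / (2 * Real.pi) : ℂ) * ∫ x : ℝ, Complex.exp (↑(-2 * Real.pi * (x / (2 * Real.pi)) * t) * Complex.I) • G (x / (2 * Real.pi)) := by
      rw [this, Complex.real_smul]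
      generalize (∫ v : ℝ, Complex.exp (↑(-2 * Real.pi * v * t) * Complex.I) • G v) = J
      have : (Real.pi : ℂ) ≠ 0 := by exact_mod_cast hpi.ne'
      push_cast
      field_simp
    rw [h2, ← integral_const_mul]
    congr 1; ext x
    have : (-2 * Real.pi * (x / (2 * Real.pi)) * t) = - (t * x) := by field_simp
    rw [this, smul_eq_mul]
    push_cast
    ring_nf
  · intro τ
    have h1 : G (τ / (2 * Real.pi)) = (𝓕⁻ (S : ℝ → ℂ)) (τ / (2 * Real.pi)) := by
      rw [← SchwartzMap.fourierInv_coe]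
    simp only [h1]
    rw [Real.fourierInv_eq']
    congr 1
    congr 1; ext v
    have : (2 * Real.pi * (inner ℝ v (τ / (2 * Real.pi)))) = v * τ := by
      have e : (inner ℝ v (τ / (2 * Real.pi)) : ℝ) = (τ / (2 * Real.pi)) * v := rfl
      rw [e]
      field_simp
    rw [this, smul_eq_mul]
    have : S v = a v := rfl
    rw [this]; push_cast; ring_nf

lemma integrable_of_decay {f : ℝ → ℂ} (hf : Continuous f) {C : ℝ}
    (h : ∀ τ, ‖f τ‖ * (1 + |τ|) ^ 2 ≤ C) : Integrable f := by
  have h1 : Integrable (fun x : ℝ => C * (1 + ‖x‖) ^ (-(2:ℝ))) :=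
    (integrable_one_add_norm (by simp)).const_mul C
  refine h1.mono' hf.aestronglyMeasurable (Filter.Eventually.of_forall fun τ => ?_)
  rw [Real.rpow_neg (by positivity), ← div_eq_mul_inv, le_div_iff₀ (by positivity)]
  have := h τ
  rw [← Real.rpow_natCast] at this
  simpa using this

lemma gwave_exists (Ta Tb : ℝ) (hTa : 0 < Ta) :
    ∃ g : ℝ → ℂ, Continuous g ∧ (∀ k : ℕ, ∃ C : ℝ, 0 < C ∧ ∀ τ, ‖g τ‖ * (1 + |τ|) ^ k ≤ C) ∧
      (∀ t ∈ Icc Ta Tb, ∫ τ : ℝ, Complex.exp (-Complex.I * t * τ) * g τ = 1) ∧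
      (∫ τ, g τ = 0) ∧ (∫ τ : ℝ, (τ : ℂ) * g τ = 0) := by
  set T := max Ta Tb with hT
  have hT1 : Ta ≤ T := le_max_left _ _
  have hT2 : Tb ≤ T := le_max_right _ _
  let b : ContDiffBump ((Ta + T) / 2) := ⟨(T - Ta) / 2 + Ta / 4, (T - Ta) / 2 + Ta / 2, by linarith, by linarith⟩
  set a : ℝ → ℂ := fun x => ((b x : ℝ) : ℂ) with ha
  have hb0 : ∀ x, x < Ta / 4 → b x = 0 := by
    intro x hx
    apply b.zero_of_le_dist
    rw [Real.dist_eq]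
    have : b.rOut = (T - Ta) / 2 + Ta / 2 := rfl
    rw [this, abs_of_nonpos (by linarith)]; linarith
  have hasupp : HasCompactSupport a := b.hasCompactSupport.comp_left (g := fun x : ℝ => (x : ℂ)) (by simp)
  have hasm : ContDiff ℝ (⊤ : ℕ∞) a := Complex.ofRealCLM.contDiff.comp b.contDiff
  have ha0 : a 0 = 0 := by simp [ha, hb0 0 (by linarith)]
  have hda0 : deriv a 0 = 0 := by
    have : a =ᶠ[nhds 0] fun _ => 0 := by
      filter_upwards [Iio_mem_nhds (show (0:ℝ) < Ta / 4 by linarith)] with x hx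
      simp [ha, hb0 x hx]
    rw [this.deriv_eq]; simp
  have hdsupp : HasCompactSupport (deriv a) := hasupp.deriv
  have hdsm : ContDiff ℝ (⊤ : ℕ∞) (deriv a) := by
    have := ContDiff.iterate_deriv 1 hasm
    simpa using this
  obtain ⟨g, hgc, hgd, hgi, hgf⟩ := ft_exists a hasupp hasm
  obtain ⟨g1, hg1c, hg1d, hg1i, hg1f⟩ := ft_exists (deriv a) hdsupp hdsm
  refine ⟨g, hgc, hgd, ?_, ?_, ?_⟩
  · intro t ht
    rw [hgi]
    have : b t = 1 := by
      apply b.one_of_mem_closedBall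
      rw [Metric.mem_closedBall, Real.dist_eq, abs_le]
      have : b.rIn = (T - Ta) / 2 + Ta / 4 := rfl
      rw [this]
      constructor <;> linarith [ht.1, ht.2]
    simp [ha, this]
  · have := hgi 0
    simpa [ha0] using this
  · have h1 : ∀ τ : ℝ, g1 τ = -Complex.I * ((τ : ℂ) * g τ) := by
      intro τ
      rw [hg1f, hgf]
      have hu : ∀ x : ℝ, HasDerivAt (fun t : ℝ => Complex.exp (Complex.I * t * τ))
          (Complex.exp (Complex.I * x * τ) * (Complex.I * τ)) x := by
        intro x
        have h0 : HasDerivAt (fun t : ℝ => (Complex.I * t * τ : ℂ)) (Complex.I * τ) x := by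
          have := ((Complex.ofRealCLM.hasDerivAt (x := x)).const_mul Complex.I).mul_const (τ : ℂ)
          simpa using this
        exact h0.cexp
      have hv : ∀ x : ℝ, HasDerivAt a (deriv a x) x := fun x =>
        (hasm.differentiable (by simp)).differentiableAt.hasDerivAt
      have := integral_mul_deriv_eq_deriv_mul_of_integrable (u := fun t : ℝ => Complex.exp (Complex.I * t * τ))
        (v := a) (fun x _ => hu x) (fun x _ => hv x)
        (by
          apply Continuous.integrable_of_hasCompactSupport
          · have := hdsm.continuous; fun_prop
          · exact hdsupp.mul_left)
        (by
          apply Continuous.integrable_of_hasCompactSupport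
          · have := hasm.continuous; fun_prop
          · exact hasupp.mul_left)
        (by
          apply Continuous.integrable_of_hasCompactSupport
          · have := hasm.continuous; fun_prop
          · exact hasupp.mul_left)
      rw [this]
      have e : ∫ x : ℝ, Complex.exp (Complex.I * x * τ) * (Complex.I * τ) * a x
          = (Complex.I * τ) * ∫ x : ℝ, Complex.exp (Complex.I * x * τ) * a x := by
        rw [← integral_const_mul]; congr 1; ext x; ring
      rw [e]; ring
    have h2 := hg1i 0
    simp only [h1, hda0] at h2
    rw [← integral_neg_eq_self] at h2 ⊢
    have h3 : -Complex.I * ∫ τ : ℝ, (((-τ : ℝ) : ℂ) * g (-τ)) = 0 := by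
      rw [← integral_const_mul]
      simpa using h2
    simpa using h3

lemma Gker_phi (N : ℕ) (t : ℝ) (x ξ : EuclideanSpace ℝ (Fin N)) (τ : ℝ) (hξ : ξ ≠ 0)
    (h1 : τ ≠ ‖ξ‖) (h2 : τ ≠ -‖ξ‖) (G : ℂ) :
    Gker N t x τ ξ * (((‖ξ‖ : ℂ) ^ 2 - (τ : ℂ) ^ 2) * G) =
      Complex.exp (-Complex.I * ((inner ℝ x ξ : ℝ) : ℂ)) *
        (Complex.exp (-Complex.I * t * ‖ξ‖) * (Complex.exp (-Complex.I * t * ((τ - ‖ξ‖ : ℝ) : ℂ)) * G)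
        + (Complex.exp (Complex.I * t * ‖ξ‖) - Complex.exp (-Complex.I * t * ‖ξ‖)) / (2 * ‖ξ‖) *
          (((τ - ‖ξ‖ : ℝ) : ℂ) * G) - Complex.exp (-Complex.I * t * ‖ξ‖) * G) := by
  have hρ : (‖ξ‖ : ℂ) ≠ 0 := by simpa using hξ
  have e1 : (τ : ℂ) - ‖ξ‖ ≠ 0 := by
    rw [← Complex.ofReal_sub]; exact_mod_cast sub_ne_zero.mpr h1
  have e2 : (τ : ℂ) + ‖ξ‖ ≠ 0 := by
    rw [← Complex.ofReal_add]; norm_cast; intro h; apply h2; linarith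
  have e3 : Complex.exp (-Complex.I * t * τ) =
      Complex.exp (-Complex.I * t * ‖ξ‖) * Complex.exp (-Complex.I * t * ((τ - ‖ξ‖ : ℝ) : ℂ)) := by
    rw [← Complex.exp_add]; congr 1; push_cast; ring
  rw [Gker, ← mul_assoc (Complex.exp (-Complex.I * t * ‖ξ‖)) _ G, ← e3]
  push_cast
  generalize Complex.exp (-Complex.I * t * τ) = a
  generalize Complex.exp (-Complex.I * t * ‖ξ‖) = b
  generalize Complex.exp (Complex.I * t * ‖ξ‖) = b'
  generalize Complex.exp (-Complex.I * ((inner ℝ x ξ : ℝ) : ℂ)) = e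
  field_simp
  ring

lemma continuous_decay_mul {g : ℝ → ℂ} (hgd : ∀ k : ℕ, ∃ C : ℝ, 0 < C ∧ ∀ τ, ‖g τ‖ * (1 + |τ|) ^ k ≤ C)
    (hgc : Continuous g) : Integrable g ∧ Integrable (fun τ : ℝ => (τ : ℂ) * g τ) := by
  constructor
  · obtain ⟨C, -, h⟩ := hgd 2
    exact integrable_of_decay hgc h
  · obtain ⟨C, -, h⟩ := hgd 3
    refine integrable_of_decay (by fun_prop) (C := C) fun τ => le_trans ?_ (h τ)
    rw [norm_mul, Complex.norm_real, Real.norm_eq_abs, pow_succ (n := 2)]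
    have : |τ| ≤ 1 + |τ| := by linarith
    calc |τ| * ‖g τ‖ * (1 + |τ|) ^ 2 = ‖g τ‖ * ((1 + |τ|) ^ 2 * |τ|) := by ring
      _ ≤ _ := by gcongr

lemma wave_lower (N : ℕ) (H : ℝ) (hH1 : 1 / 2 ≤ H) (hH2 : H < 1) (Ta Tb : ℝ) (hTa : 0 < Ta) :
    ∃ C : ℝ, 0 < C ∧ ∀ (n : ℕ) (z : Fin n → ℝ × EuclideanSpace ℝ (Fin N)),
      (∀ j, (z j).1 ∈ Icc Ta Tb) → ∀ (c : Fin n → ℝ) (ξ : EuclideanSpace ℝ (Fin N)), ξ ≠ 0 →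
      ‖Aw c z ξ‖ₑ ^ 2 ≤ (∫⁻ τ : ℝ, ‖∑ j, (c j : ℂ) * Gker N (z j).1 (z j).2 τ ξ‖ₑ ^ 2 *
        ENNReal.ofReal (|τ| ^ (1 - 2 * H))) * ENNReal.ofReal (C * (1 + ‖ξ‖) ^ (2 * H + 1)) := by
  obtain ⟨g, hgc, hgd, hg1, hg0, hgm⟩ := gwave_exists Ta Tb hTa
  obtain ⟨hgi, hgmi⟩ := continuous_decay_mul hgd hgc
  obtain ⟨D, hD0, hD⟩ := hgd 4
  set K : ℝ≥0∞ := ∫⁻ u : ℝ, ENNReal.ofReal ((1 + ‖u‖) ^ (-(3:ℝ))) with hK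
  have hKfin : K ≠ ⊤ := by
    have := (integrable_one_add_norm (E := ℝ) (μ := volume) (r := 3) (by simp)).lintegral_lt_top
    exact this.ne
  refine ⟨4 * D ^ 2 * (K.toReal + 1), by positivity, ?_⟩
  intro n z hz c ξ hξ
  set ρ := ‖ξ‖ with hρ
  have hρ0 : 0 < ρ := norm_pos_iff.mpr hξ
  set φ : ℝ → ℂ := fun τ => ((ρ : ℂ) ^ 2 - (τ : ℂ) ^ 2) * g (τ - ρ) with hφ
  have hmeasG : ∀ j, Measurable (fun τ : ℝ => Gker N (z j).1 (z j).2 τ ξ) := by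
    intro j; unfold Gker; fun_prop
  have hcs := cs_weight volume (fun τ : ℝ => ∑ j, (c j : ℂ) * Gker N (z j).1 (z j).2 τ ξ) φ
    (fun τ => |τ| ^ (1 - 2 * H)) (by fun_prop) (by fun_prop) (by fun_prop) (by
      have : ∀ᵐ x : ℝ, x ≠ 0 := by simp [ae_iff]
      filter_upwards [this] with x hx
      exact Real.rpow_pos_of_pos (abs_pos.mpr hx) _)
  have hne : ∀ᵐ τ : ℝ, τ ≠ ρ ∧ τ ≠ -ρ := by
    have a1 : ∀ᵐ x : ℝ, x ≠ ρ := by simp [ae_iff]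
    have a2 : ∀ᵐ x : ℝ, x ≠ -ρ := by simp [ae_iff]
    filter_upwards [a1, a2] with x h1 h2 using ⟨h1, h2⟩
  set k : Fin n → ℝ → ℂ := fun j u => (c j : ℂ) * (Complex.exp (-Complex.I * ((inner ℝ (z j).2 ξ : ℝ) : ℂ)) *
        (Complex.exp (-Complex.I * (z j).1 * ρ) * (Complex.exp (-Complex.I * (z j).1 * (u : ℂ)) * g u)
        + (Complex.exp (Complex.I * (z j).1 * ρ) - Complex.exp (-Complex.I * (z j).1 * ρ)) / (2 * ρ) *
          ((u : ℂ) * g u) - Complex.exp (-Complex.I * (z j).1 * ρ) * g u)) with hk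
  have hexpi : ∀ t : ℝ, Integrable (fun u : ℝ => Complex.exp (-Complex.I * t * (u : ℂ)) * g u) := by
    intro t
    refine hgi.mono (by fun_prop) (Filter.Eventually.of_forall fun u => ?_)
    rw [norm_mul, Complex.norm_exp]; simp
  have hki : ∀ j, Integrable (k j) := by
    intro j
    simp only [hk]
    exact (((((hexpi _).const_mul _).add (hgmi.const_mul _)).sub (hgi.const_mul _)).const_mul _).const_mul _
  have hkint : ∀ j, ∫ u, k j u = (c j : ℂ) * Complex.exp (-Complex.I * (yf ξ (z j) : ℂ)) := by
    intro j
    simp only [hk]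
    rw [integral_const_mul, integral_const_mul, integral_sub, integral_add, integral_const_mul,
      integral_const_mul, integral_const_mul, hg0, hgm, hg1 _ (hz j)]
    · rw [mul_zero, mul_zero, add_zero, sub_zero, mul_one, ← Complex.exp_add]
      congr 2
      simp only [yf]; push_cast; ring
    · exact (hexpi _).const_mul _
    · exact (hgmi.const_mul _)
    · exact ((hexpi _).const_mul _).add (hgmi.const_mul _)
    · exact (hgi.const_mul _)
  have hIntg : ∫ τ : ℝ, (∑ j, (c j : ℂ) * Gker N (z j).1 (z j).2 τ ξ) * φ τ = Aw c z ξ := by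
    have : ∫ τ : ℝ, (∑ j, (c j : ℂ) * Gker N (z j).1 (z j).2 τ ξ) * φ τ
        = ∫ τ : ℝ, ∑ j, k j (τ - ρ) := by
      apply integral_congr_ae
      filter_upwards [hne] with τ hτ
      simp only [Finset.sum_mul, hk, hφ]
      apply Finset.sum_congr rfl
      intro j _
      rw [mul_assoc, Gker_phi N _ _ ξ τ hξ hτ.1 hτ.2]
    rw [this, integral_sub_right_eq_self (fun u => ∑ j, k j u), integral_finsetSum _ (fun j _ => hki j)]
    simp only [hkint, Aw]
  rw [hIntg] at hcs
  refine hcs.trans (mul_le_mul_right ?_ _)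
  have hφb : ∀ τ : ℝ, ‖φ τ‖ₑ ^ 2 * ENNReal.ofReal ((|τ| ^ (1 - 2 * H))⁻¹) ≤
      ENNReal.ofReal (4 * D ^ 2 * (1 + ρ) ^ (2 * H + 1)) *
        (fun u : ℝ => ENNReal.ofReal ((1 + ‖u‖) ^ (-(3:ℝ)))) (τ - ρ) := by
    intro τ
    simp only
    rw [← ofReal_norm, ← ENNReal.ofReal_pow (by positivity), ← ENNReal.ofReal_mul (by positivity),
      ← ENNReal.ofReal_mul (by positivity)]
    apply ENNReal.ofReal_le_ofReal
    set u := τ - ρ with hu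
    have hτ : τ = u + ρ := by simp [hu]
    have b1 : ‖φ τ‖ ≤ 2 * (1 + |u|) ^ 2 * (1 + ρ) * ‖g u‖ := by
      simp only [hφ]
      rw [norm_mul]
      gcongr
      rw [← Complex.ofReal_pow, ← Complex.ofReal_pow, ← Complex.ofReal_sub, Complex.norm_real,
        Real.norm_eq_abs]
      have : ρ ^ 2 - τ ^ 2 = -(u * (u + 2 * ρ)) := by rw [hτ]; ring
      rw [this, abs_neg, abs_mul]
      have : |u + 2 * ρ| ≤ |u| + 2 * ρ := by
        refine (abs_add_le _ _).trans ?_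
        rw [abs_of_pos (by positivity : 0 < 2 * ρ)]
      have h0 := abs_nonneg u
      nlinarith [mul_nonneg h0 hρ0.le, mul_nonneg h0 h0, mul_nonneg (mul_nonneg h0 h0) hρ0.le]
    have b2 : (|τ| ^ (1 - 2 * H))⁻¹ ≤ (1 + |u|) * (1 + ρ) ^ (2 * H - 1) := by
      rw [← Real.rpow_neg (abs_nonneg _), neg_sub]
      have : |τ| ≤ (1 + |u|) * (1 + ρ) := by
        rw [hτ]
        refine (abs_add_le _ _).trans ?_
        rw [abs_of_pos hρ0]
        nlinarith [abs_nonneg u, mul_nonneg (abs_nonneg u) hρ0.le]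
      calc |τ| ^ (2 * H - 1) ≤ ((1 + |u|) * (1 + ρ)) ^ (2 * H - 1) :=
            Real.rpow_le_rpow (abs_nonneg _) this (by linarith)
        _ = (1 + |u|) ^ (2 * H - 1) * (1 + ρ) ^ (2 * H - 1) :=
            Real.mul_rpow (by positivity) (by positivity)
        _ ≤ (1 + |u|) * (1 + ρ) ^ (2 * H - 1) := by
            gcongr
            calc (1 + |u|) ^ (2 * H - 1) ≤ (1 + |u|) ^ (1:ℝ) :=
                  Real.rpow_le_rpow_of_exponent_le (by linarith [abs_nonneg u]) (by linarith)
              _ = _ := by simp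
    have b3 : (1 + ρ) ^ (2 * H + 1) = (1 + ρ) ^ 2 * (1 + ρ) ^ (2 * H - 1) := by
      rw [← Real.rpow_natCast, ← Real.rpow_add (by positivity)]; congr 1; push_cast; ring
    have b4 : (1 + |u|) ^ (-(3:ℝ)) = ((1 + |u|) ^ 3)⁻¹ := by
      rw [Real.rpow_neg (by positivity)]; norm_cast
    rw [Real.norm_eq_abs, b3, b4]
    have b5 := hD u
    have hu1 : 0 < 1 + |u| := by positivity
    calc ‖φ τ‖ ^ 2 * (|τ| ^ (1 - 2 * H))⁻¹
        ≤ (2 * (1 + |u|) ^ 2 * (1 + ρ) * ‖g u‖) ^ 2 * ((1 + |u|) * (1 + ρ) ^ (2 * H - 1)) := by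
          gcongr
      _ = 4 * (‖g u‖ * (1 + |u|) ^ 4) ^ 2 * ((1 + ρ) ^ 2 * (1 + ρ) ^ (2 * H - 1)) * ((1 + |u|) ^ 3)⁻¹ := by
          field_simp; ring
      _ ≤ _ := by gcongr
  calc _ ≤ ∫⁻ τ : ℝ, ENNReal.ofReal (4 * D ^ 2 * (1 + ρ) ^ (2 * H + 1)) *
        (fun u : ℝ => ENNReal.ofReal ((1 + ‖u‖) ^ (-(3:ℝ)))) (τ - ρ) := lintegral_mono hφb
    _ = ENNReal.ofReal (4 * D ^ 2 * (1 + ρ) ^ (2 * H + 1)) * K := by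
        rw [lintegral_const_mul' _ _ ENNReal.ofReal_ne_top]
        congr 1
        exact lintegral_sub_right_eq_self (fun u : ℝ => ENNReal.ofReal ((1 + ‖u‖) ^ (-(3:ℝ)))) ρ
    _ ≤ ENNReal.ofReal (4 * D ^ 2 * (1 + ρ) ^ (2 * H + 1)) * ENNReal.ofReal (K.toReal + 1) := by
        gcongr
        rw [← ENNReal.ofReal_toReal hKfin]
        apply ENNReal.ofReal_le_ofReal
        rw [ENNReal.toReal_ofReal ENNReal.toReal_nonneg]; linarith
    _ = _ := by
        rw [← ENNReal.ofReal_mul (by positivity)]; congr 1; ring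

lemma integrable_weight {E : Type*} [NormedAddCommGroup E] [NormedSpace ℝ E] [FiniteDimensional ℝ E]
    [Nontrivial E] [MeasurableSpace E] [BorelSpace E] (μ : Measure E) [μ.IsAddHaarMeasure]
    {a b : ℝ} (ha : 0 ≤ a) (hb : 0 ≤ b)
    (hb1 : b < Module.finrank ℝ E) (hab : (Module.finrank ℝ E : ℝ) < a + b) :
    Integrable (fun ξ : E => (1 + ‖ξ‖) ^ (-a) * ‖ξ‖ ^ (-b)) μ := by
  have hm : Measurable (fun ξ : E => (1 + ‖ξ‖) ^ (-a) * ‖ξ‖ ^ (-b)) := by fun_prop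
  have h1 : IntegrableOn (fun ξ : E => (1 + ‖ξ‖) ^ (-a) * ‖ξ‖ ^ (-b)) (Metric.ball 0 1) μ := by
    refine integrableOn_ball_of_norm_le_rpow (C := 1) (α := b) (r := 1) Module.finrank_pos ?_ ?_
      hm.aestronglyMeasurable
    rotate_left
    · filter_upwards with x
      rw [Real.norm_of_nonneg (by positivity)]
      have : (1 + ‖x‖) ^ (-a) ≤ 1 := Real.rpow_le_one_of_one_le_of_nonpos (by linarith [norm_nonneg x]) (by linarith)
      gcongr
    · linarith
  have h2 : IntegrableOn (fun ξ : E => (1 + ‖ξ‖) ^ (-a) * ‖ξ‖ ^ (-b)) (Metric.ball 0 1)ᶜ μ := by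
    have h3 : Integrable (fun x : E => 2 ^ b * (1 + ‖x‖) ^ (-(a + b))) μ :=
      (integrable_one_add_norm hab).const_mul _
    refine Integrable.mono' h3.integrableOn hm.aestronglyMeasurable ?_
    refine (ae_restrict_iff' (measurableSet_ball.compl)).2 ?_
    filter_upwards with x hx
    have hx1 : 1 ≤ ‖x‖ := by simpa using hx
    rw [Real.norm_of_nonneg (by positivity), neg_add, Real.rpow_add (by positivity)]
    have : ‖x‖ ^ (-b) ≤ ((1 + ‖x‖) / 2) ^ (-b) :=
      Real.rpow_le_rpow_of_nonpos (by positivity) (by linarith) (by linarith)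
    rw [Real.div_rpow (by positivity) (by positivity), Real.rpow_neg (by positivity : (0:ℝ) ≤ 2), div_inv_eq_mul] at this
    calc _ ≤ (1 + ‖x‖) ^ (-a) * ((1 + ‖x‖) ^ (-b) * 2 ^ b) := by gcongr
      _ = _ := by ring
  rw [← integrableOn_univ, ← union_compl_self (Metric.ball (0:E) 1)]
  exact h1.union h2

lemma kk_eq (t u : ℝ) (hu : u ≠ 0) :
    (Complex.exp (-Complex.I * t * u) - 1) / u = ∫ s in (0:ℝ)..t, -Complex.I * Complex.exp (-Complex.I * u * s) := by
  have hu' : (u:ℂ) ≠ 0 := by exact_mod_cast hu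
  rw [intervalIntegral.integral_const_mul, integral_exp_mul_complex (by simp [hu'])]
  simp only [Complex.ofReal_zero, mul_zero, Complex.exp_zero]
  field_simp

lemma exp_diff (a b : ℝ) : ‖Complex.exp (-Complex.I * a) - Complex.exp (-Complex.I * b)‖ ≤ |a - b| := by
  have : Complex.exp (-Complex.I * a) - Complex.exp (-Complex.I * b) =
      Complex.exp (-Complex.I * b) * (Complex.exp (Complex.I * ((b - a : ℝ) : ℂ)) - 1) := by
    rw [mul_sub, ← Complex.exp_add]; congr 2
    · push_cast; ring
    · simp
  rw [this, norm_mul]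
  have h1 : ‖Complex.exp (-Complex.I * b)‖ = 1 := by
    rw [Complex.norm_exp]; simp
  rw [h1, one_mul]
  have := Real.norm_exp_I_mul_ofReal_sub_one_le (x := b - a)
  rwa [Real.norm_eq_abs, abs_sub_comm] at this

lemma kk_diff (t u v : ℝ) (ht : 0 ≤ t) (hu : u ≠ 0) (hv : v ≠ 0) :
    ‖(Complex.exp (-Complex.I * t * u) - 1) / u - (Complex.exp (-Complex.I * t * v) - 1) / v‖
      ≤ t ^ 2 * |u - v| := by
  rw [kk_eq t u hu, kk_eq t v hv, ← intervalIntegral.integral_sub]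
  · have := intervalIntegral.norm_integral_le_of_norm_le_const (a := 0) (b := t) (C := t * |u - v|)
      (f := fun s : ℝ => -Complex.I * Complex.exp (-Complex.I * u * s) - -Complex.I * Complex.exp (-Complex.I * v * s)) ?_
    · rw [sub_zero, abs_of_nonneg ht] at this
      linarith
    · intro s hs
      rw [uIoc_of_le ht] at hs
      rw [← mul_sub, norm_mul, norm_neg, Complex.norm_I, one_mul]
      have := exp_diff (u * s) (v * s)
      rw [← sub_mul, abs_mul, abs_of_pos hs.1] at this
      push_cast at this
      rw [← mul_assoc, ← mul_assoc] at this
      refine this.trans ?_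
      rw [mul_comm]
      gcongr
      exact hs.2
  · exact (by fun_prop : Continuous _).intervalIntegrable _ _
  · exact (by fun_prop : Continuous _).intervalIntegrable _ _

lemma kk_bd (t u : ℝ) (ht : 0 ≤ t) : ‖(Complex.exp (-Complex.I * t * u) - 1) / u‖ ≤ (2 + t) / (1 + |u|) := by
  by_cases hu : u = 0
  · subst hu; simp; positivity
  have hu' : 0 < |u| := abs_pos.2 hu
  rw [norm_div, Complex.norm_real, Real.norm_eq_abs, div_le_div_iff₀ hu' (by positivity), mul_add, mul_one]
  have h1 := exp_diff (t * u) 0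
  push_cast at h1
  rw [mul_zero, Complex.exp_zero, sub_zero, abs_mul, abs_of_nonneg ht, ← mul_assoc] at h1
  have h2 : ‖Complex.exp (-Complex.I * t * u) - 1‖ ≤ 2 := by
    refine (norm_sub_le _ _).trans ?_
    have : ‖Complex.exp (-Complex.I * t * u)‖ = 1 := by rw [Complex.norm_exp]; simp
    rw [this]; norm_num
  nlinarith

lemma Gker_form (N : ℕ) (t : ℝ) (x ξ : EuclideanSpace ℝ (Fin N)) (τ : ℝ) :
    ‖Gker N t x τ ξ‖ = (2 * ‖ξ‖)⁻¹ *
      ‖Complex.exp (Complex.I * t * ‖ξ‖) * ((Complex.exp (-Complex.I * t * ((τ + ‖ξ‖ : ℝ) : ℂ)) - 1) / ((τ + ‖ξ‖ : ℝ) : ℂ))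
        - Complex.exp (-Complex.I * t * ‖ξ‖) * ((Complex.exp (-Complex.I * t * ((τ - ‖ξ‖ : ℝ) : ℂ)) - 1) / ((τ - ‖ξ‖ : ℝ) : ℂ))‖ := by
  unfold Gker
  rw [norm_mul]
  congr 1
  · rw [norm_div]
    have : ‖Complex.exp (-Complex.I * ((inner ℝ x ξ : ℝ) : ℂ))‖ = 1 := by rw [Complex.norm_exp]; simp
    rw [this]; simp
  · congr 2
    · rw [← mul_div_assoc, mul_sub, ← Complex.exp_add]
      push_cast; congr 3
      · ring_nf
      · ring
    · rw [← mul_div_assoc, mul_sub, ← Complex.exp_add]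
      push_cast; congr 3
      · ring_nf
      · ring

lemma exp_unit (t ρ : ℝ) : ‖Complex.exp (Complex.I * t * ρ)‖ = 1 := by rw [Complex.norm_exp]; simp
lemma exp_unit' (t ρ : ℝ) : ‖Complex.exp (-Complex.I * t * ρ)‖ = 1 := by rw [Complex.norm_exp]; simp

lemma Gker_bd1 (N : ℕ) (t : ℝ) (ht : 0 ≤ t) (x ξ : EuclideanSpace ℝ (Fin N)) (τ : ℝ) :
    ‖Gker N t x τ ξ‖ ≤ (2 * ‖ξ‖)⁻¹ * ((2 + t) / (1 + |τ + ‖ξ‖|) + (2 + t) / (1 + |τ - ‖ξ‖|)) := by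
  rw [Gker_form]
  gcongr
  refine (norm_sub_le _ _).trans ?_
  rw [norm_mul, norm_mul, exp_unit, exp_unit', one_mul, one_mul]
  exact add_le_add (kk_bd _ _ ht) (kk_bd _ _ ht)

lemma Gker_bd2 (N : ℕ) (t : ℝ) (ht : 0 ≤ t) (x ξ : EuclideanSpace ℝ (Fin N)) (hξ : ξ ≠ 0) (τ : ℝ)
    (h1 : τ + ‖ξ‖ ≠ 0) (h2 : τ - ‖ξ‖ ≠ 0) :
    ‖Gker N t x τ ξ‖ ≤ (t * (2 + t) + (t ^ 2 + 2 * t + t ^ 2)) / (1 + |τ + ‖ξ‖|) := by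
  have hρ : 0 < ‖ξ‖ := norm_pos_iff.2 hξ
  rw [Gker_form]
  set ρ := ‖ξ‖
  set u := τ + ρ with hu
  set v := τ - ρ with hv
  have huv : u - v = 2 * ρ := by rw [hu, hv]; ring
  set ku := (Complex.exp (-Complex.I * t * (u : ℂ)) - 1) / (u : ℂ) with hku
  set kv := (Complex.exp (-Complex.I * t * (v : ℂ)) - 1) / (v : ℂ) with hkv
  have e1 : Complex.exp (Complex.I * t * ρ) * ku - Complex.exp (-Complex.I * t * ρ) * kv =
    (Complex.exp (Complex.I * t * ρ) - Complex.exp (-Complex.I * t * ρ)) * ku +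
      Complex.exp (-Complex.I * t * ρ) * (ku - kv) := by ring
  have e2 : ‖Complex.exp (Complex.I * t * ρ) - Complex.exp (-Complex.I * t * ρ)‖ ≤ 2 * ρ * t := by
    have := exp_diff (-(t * ρ)) (t * ρ)
    push_cast at this
    rw [show -Complex.I * -((t:ℂ) * ρ) = Complex.I * t * ρ by ring, ← mul_assoc] at this
    refine this.trans ?_
    rw [show -(t * ρ) - t * ρ = -(2 * ρ * t) by ring, abs_neg, abs_of_nonneg (by positivity)]
  have e3 := kk_bd t u ht
  have e4 := kk_diff t u v ht h1 h2
  rw [huv, abs_of_pos (by positivity)] at e4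
  have hua : 0 < |u| := abs_pos.2 h1
  have e5 : ‖ku - kv‖ * |u| ≤ 2 * ρ * (2 * t) := by
    have hu0 : (u:ℂ) ≠ 0 := by exact_mod_cast h1
    have hv0 : (v:ℂ) ≠ 0 := by exact_mod_cast h2
    have : (ku - kv) * u = (Complex.exp (-Complex.I * t * (u : ℂ)) - Complex.exp (-Complex.I * t * (v : ℂ)))
        - ((u - v : ℝ) : ℂ) * kv := by
      rw [hku, hkv]; push_cast; field_simp; ring
    rw [← Real.norm_eq_abs, ← Complex.norm_real, ← norm_mul, this]
    refine (norm_sub_le _ _).trans ?_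
    have g1 := exp_diff (t * u) (t * v)
    rw [← mul_sub, huv, abs_of_nonneg (by positivity)] at g1
    push_cast at g1
    rw [← mul_assoc, ← mul_assoc] at g1
    have g2 : ‖kv‖ ≤ t := by
      rw [hkv, kk_eq t v h2]
      have := intervalIntegral.norm_integral_le_of_norm_le_const (a := 0) (b := t) (C := 1)
        (f := fun s : ℝ => -Complex.I * Complex.exp (-Complex.I * v * s)) ?_
      · rw [sub_zero, abs_of_nonneg ht, one_mul] at this; exact this
      · intro s _
        rw [norm_mul, exp_unit']; simp
    rw [norm_mul, Complex.norm_real, huv, Real.norm_eq_abs, abs_of_pos (by positivity : 0 < 2 * ρ)]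
    nlinarith
  rw [e1]
  have e6 : ‖ku - kv‖ ≤ 2 * ρ * ((t ^ 2 + 2 * t) / (1 + |u|)) := by
    rw [← mul_div_assoc, le_div_iff₀ (by positivity)]; nlinarith
  have e7 : ‖(Complex.exp (Complex.I * t * ρ) - Complex.exp (-Complex.I * t * ρ)) * ku +
      Complex.exp (-Complex.I * t * ρ) * (ku - kv)‖ ≤ 2 * ρ * t * ((2 + t) / (1 + |u|)) +
        2 * ρ * ((t ^ 2 + 2 * t) / (1 + |u|)) := by
    refine (norm_add_le _ _).trans ?_
    rw [norm_mul, norm_mul, exp_unit', one_mul]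
    gcongr
  refine (mul_le_mul_of_nonneg_left e7 (by positivity)).trans ?_
  rw [show (2 * ρ)⁻¹ * (2 * ρ * t * ((2 + t) / (1 + |u|)) + 2 * ρ * ((t ^ 2 + 2 * t) / (1 + |u|)))
    = (t * (2 + t) + (t ^ 2 + 2 * t)) / (1 + |u|) by field_simp]
  refine div_le_div_of_nonneg_right ?_ (by positivity)
  nlinarith

lemma tau_pw (H : ℝ) (hH1 : 1 / 2 ≤ H) (hH2 : H < 1) (ρ v τ : ℝ) (hρ : 1 ≤ ρ) (hv : ρ - |τ| ≤ |v|) :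
    (1 + |v|) ^ (-(2:ℝ)) * |τ| ^ (1 - 2 * H) ≤ 16 * ρ ^ (1 - 2 * H) *
      ((1 + |v|) ^ (-(2:ℝ)) + (1 + |τ|) ^ (-(3 - 2 * H)) * |τ| ^ (-(2 * H - 1))) := by
  have hρ0 : 0 < ρ := by linarith
  rcases le_or_gt (ρ / 2) |τ| with h | h
  · have h1 : |τ| ^ (1 - 2 * H) ≤ (ρ / 2) ^ (1 - 2 * H) :=
      Real.rpow_le_rpow_of_nonpos (by positivity) h (by linarith)
    have h2 : (ρ / 2) ^ (1 - 2 * H) ≤ 2 * ρ ^ (1 - 2 * H) := by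
      rw [Real.div_rpow (by positivity) (by positivity), show (1 - 2 * H) = -(2 * H - 1) by ring,
        Real.rpow_neg (by positivity : (0:ℝ) ≤ 2), div_inv_eq_mul, mul_comm]
      gcongr
      calc (2:ℝ) ^ (2 * H - 1) ≤ 2 ^ (1:ℝ) := Real.rpow_le_rpow_of_exponent_le (by norm_num) (by linarith)
        _ = 2 := by simp
    have h3 : 0 ≤ (1 + |τ|) ^ (-(3 - 2 * H)) * |τ| ^ (-(2 * H - 1)) := by positivity
    have h4 : 0 ≤ ρ ^ (1 - 2 * H) := by positivity
    have h5 : 0 ≤ (1 + |v|) ^ (-(2:ℝ)) := by positivity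
    calc _ ≤ (1 + |v|) ^ (-(2:ℝ)) * (2 * ρ ^ (1 - 2 * H)) := by gcongr; linarith
      _ ≤ 16 * ρ ^ (1 - 2 * H) * (1 + |v|) ^ (-(2:ℝ)) := by nlinarith [mul_nonneg h4 h5]
      _ ≤ _ := by gcongr; linarith
  · have h1 : (1 + |v|) ^ (-(2:ℝ)) ≤ (ρ / 2) ^ (-(2:ℝ)) :=
      Real.rpow_le_rpow_of_nonpos (by positivity) (by linarith) (by norm_num)
    have h2 : (ρ / 2) ^ (-(2:ℝ)) = 4 * (ρ ^ (1 - 2 * H) * ρ ^ (-(3 - 2 * H))) := by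
      rw [← Real.rpow_add hρ0, Real.div_rpow (by positivity) (by positivity)]
      rw [show (1 - 2 * H + -(3 - 2 * H)) = (-2:ℝ) by ring, Real.rpow_neg (by norm_num : (0:ℝ) ≤ 2)]
      norm_num; ring
    have h3 : ρ ^ (-(3 - 2 * H)) ≤ 4 * (1 + |τ|) ^ (-(3 - 2 * H)) := by
      have : ρ ^ (-(3 - 2 * H)) ≤ ((1 + |τ|) / 2) ^ (-(3 - 2 * H)) :=
        Real.rpow_le_rpow_of_nonpos (by positivity) (by linarith) (by linarith)
      refine this.trans ?_
      rw [Real.div_rpow (by positivity) (by positivity), Real.rpow_neg (by positivity : (0:ℝ) ≤ 2),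
        div_inv_eq_mul, mul_comm]
      gcongr
      calc (2:ℝ) ^ (3 - 2 * H) ≤ 2 ^ (2:ℝ) := Real.rpow_le_rpow_of_exponent_le (by norm_num) (by linarith)
        _ = 4 := by norm_num
    have h5 : 0 ≤ (1 + |v|) ^ (-(2:ℝ)) := by positivity
    rw [show -(2 * H - 1) = 1 - 2 * H by ring]
    calc _ ≤ (4 * (ρ ^ (1 - 2 * H) * (4 * (1 + |τ|) ^ (-(3 - 2 * H))))) * |τ| ^ (1 - 2 * H) := by
          gcongr
          refine h1.trans ?_
          rw [h2]; gcongr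
      _ = 16 * ρ ^ (1 - 2 * H) * ((1 + |τ|) ^ (-(3 - 2 * H)) * |τ| ^ (1 - 2 * H)) := by ring
      _ ≤ _ := by gcongr; linarith

lemma Gker_L2 (N : ℕ) (H : ℝ) (hH1 : 1 / 2 ≤ H) (hH2 : H < 1) (t : ℝ) (ht : 0 ≤ t)
    (x : EuclideanSpace ℝ (Fin N)) :
    ∃ C : ℝ, 0 ≤ C ∧ ∀ ξ : EuclideanSpace ℝ (Fin N), ξ ≠ 0 →
      ∫⁻ τ : ℝ, ‖Gker N t x τ ξ‖ₑ ^ 2 * ENNReal.ofReal (|τ| ^ (1 - 2 * H)) ≤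
        ENNReal.ofReal (C * (1 + ‖ξ‖) ^ (-(2 * H + 1))) := by
  set w : ℝ → ℝ := fun τ => (1 + |τ|) ^ (-(3 - 2 * H)) * |τ| ^ (-(2 * H - 1)) with hw
  set w3 : ℝ → ℝ := fun τ => (1 + |τ|) ^ (-(2:ℝ)) with hw3
  have hwi : Integrable w := by
    have := integrable_weight (E := ℝ) volume (a := 3 - 2 * H) (b := 2 * H - 1) (by linarith) (by linarith)
      (by simp; linarith) (by simp; norm_num)
    exact this
  have hw3i : Integrable w3 := by
    have := integrable_one_add_norm (E := ℝ) (μ := volume) (r := 2) (by simp)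
    exact this
  have hw0 : ∀ τ, 0 ≤ w τ := fun τ => by positivity
  have hw30 : ∀ τ, 0 ≤ w3 τ := fun τ => by positivity
  set K := ∫ τ, w τ
  set K3 := ∫ τ, w3 τ
  have hK0 : 0 ≤ K := integral_nonneg hw0
  have hK30 : 0 ≤ K3 := integral_nonneg hw30
  set D := t * (2 + t) + (t ^ 2 + 2 * t + t ^ 2) with hD
  have hD0 : 0 ≤ D := by positivity
  refine ⟨32 * D ^ 2 * K + 64 * (2 + t) ^ 2 * (2 * K3 + 2 * K), by positivity, fun ξ hξ => ?_⟩
  have hρ : 0 < ‖ξ‖ := norm_pos_iff.2 hξ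
  have hconv : ∀ τ, ‖Gker N t x τ ξ‖ₑ ^ 2 * ENNReal.ofReal (|τ| ^ (1 - 2 * H)) =
      ENNReal.ofReal (‖Gker N t x τ ξ‖ ^ 2 * |τ| ^ (1 - 2 * H)) := by
    intro τ
    rw [ENNReal.ofReal_mul (by positivity), ENNReal.ofReal_pow (norm_nonneg _), ofReal_norm]
  simp_rw [hconv]
  set ρ := ‖ξ‖
  have hp0 : 0 ≤ (1 + ρ) ^ (-(2 * H + 1)) := by positivity
  rcases le_or_gt ρ 1 with h1 | h1
  · have hae : ∀ᵐ τ : ℝ, τ + ρ ≠ 0 ∧ τ - ρ ≠ 0 := by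
      have a1 : ∀ᵐ τ : ℝ, τ ≠ -ρ := by simp [ae_iff]
      have a2 : ∀ᵐ τ : ℝ, τ ≠ ρ := by simp [ae_iff]
      filter_upwards [a1, a2] with τ b1 b2
      exact ⟨fun h => b1 (by linarith), fun h => b2 (by linarith)⟩
    calc _ ≤ ∫⁻ τ, ENNReal.ofReal (4 * D ^ 2 * w τ) := by
          refine lintegral_mono_ae ?_
          filter_upwards [hae] with τ hτ
          apply ENNReal.ofReal_le_ofReal
          have b := Gker_bd2 N t ht x ξ hξ τ hτ.1 hτ.2
          rw [← hD] at b
          have b' : ‖Gker N t x τ ξ‖ ≤ 2 * D / (1 + |τ|) := by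
            refine b.trans ?_
            rw [div_le_div_iff₀ (by positivity) (by positivity)]
            have : |τ| ≤ |τ + ρ| + ρ := by
              have := abs_sub (τ + ρ) ρ
              rw [add_sub_cancel_right, abs_of_pos hρ] at this; exact this
            have h3 : 1 + |τ| ≤ 2 * (1 + |τ + ρ|) := by linarith [abs_nonneg (τ + ρ)]
            nlinarith
          have b2 : ‖Gker N t x τ ξ‖ ^ 2 ≤ 4 * D ^ 2 * (1 + |τ|) ^ (-(3 - 2 * H)) := by
            calc _ ≤ (2 * D / (1 + |τ|)) ^ 2 := by gcongr
              _ = 4 * D ^ 2 * (1 + |τ|) ^ (-(2:ℝ)) := by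
                rw [Real.rpow_neg (by positivity)]; norm_cast; rw [div_pow]; ring
              _ ≤ _ := by
                gcongr
                · linarith [abs_nonneg τ]
                · linarith
          calc _ ≤ 4 * D ^ 2 * (1 + |τ|) ^ (-(3 - 2 * H)) * |τ| ^ (1 - 2 * H) := by gcongr
            _ = _ := by rw [hw]; simp only; rw [show -(2 * H - 1) = 1 - 2 * H by ring]; ring
      _ = ENNReal.ofReal (4 * D ^ 2 * K) := by
          rw [← ofReal_integral_eq_lintegral_ofReal (hwi.const_mul _)
            (Filter.Eventually.of_forall fun τ => by have := hw0 τ; positivity), integral_const_mul]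
      _ ≤ _ := by
          apply ENNReal.ofReal_le_ofReal
          have : 1 ≤ 8 * (1 + ρ) ^ (-(2 * H + 1)) := by
            have : (2:ℝ) ^ (-(3:ℝ)) ≤ (1 + ρ) ^ (-(2 * H + 1)) := by
              calc (2:ℝ) ^ (-(3:ℝ)) ≤ 2 ^ (-(2 * H + 1)) :=
                    Real.rpow_le_rpow_of_exponent_le (by norm_num) (by linarith)
                _ ≤ _ := Real.rpow_le_rpow_of_nonpos (by positivity) (by linarith) (by linarith)
            have e : (2:ℝ) ^ (-(3:ℝ)) = 1 / 8 := by rw [Real.rpow_neg (by norm_num)]; norm_num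
            rw [e] at this; linarith
          have h5 : 0 ≤ D ^ 2 * K := by positivity
          have h6 : 0 ≤ 64 * (2 + t) ^ 2 * (2 * K3 + 2 * K) * (1 + ρ) ^ (-(2 * H + 1)) := by positivity
          nlinarith
  · set A := 8 * (2 + t) ^ 2 * ρ ^ (-(2 * H + 1)) with hA
    have hA0 : 0 ≤ A := by positivity
    have i1 : Integrable (fun τ => w3 (τ + ρ)) := hw3i.comp_add_right ρ
    have i2 : Integrable (fun τ => w3 (τ - ρ)) := hw3i.comp_sub_right ρ
    calc _ ≤ ∫⁻ τ, ENNReal.ofReal (A * (w3 (τ + ρ) + w3 (τ - ρ) + 2 * w τ)) := by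
          refine lintegral_mono fun τ => ?_
          apply ENNReal.ofReal_le_ofReal
          have b := Gker_bd1 N t ht x ξ τ
          have q1 := tau_pw H hH1 hH2 ρ (τ + ρ) τ h1.le (by
            have := abs_sub (τ + ρ) τ
            rw [add_sub_cancel_left, abs_of_pos hρ] at this; linarith)
          have q2 := tau_pw H hH1 hH2 ρ (τ - ρ) τ h1.le (by
            have := abs_sub τ (τ - ρ)
            rw [sub_sub_cancel, abs_of_pos hρ] at this; linarith)
          change w3 (τ + ρ) * _ ≤ _ * (w3 (τ + ρ) + w τ) at q1
          change w3 (τ - ρ) * _ ≤ _ * (w3 (τ - ρ) + w τ) at q2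
          have e : ∀ v : ℝ, w3 v = (1 / (1 + |v|)) ^ 2 := by
            intro v; simp only [hw3]; rw [Real.rpow_neg (by positivity)]; norm_cast; rw [div_pow]; ring
          have b2 : ‖Gker N t x τ ξ‖ ^ 2 ≤ (2 + t) ^ 2 / (2 * ρ ^ 2) * (w3 (τ + ρ) + w3 (τ - ρ)) := by
            rw [e, e]
            calc _ ≤ ((2 * ρ)⁻¹ * ((2 + t) / (1 + |τ + ρ|) + (2 + t) / (1 + |τ - ρ|))) ^ 2 := by gcongr
              _ = (2 + t) ^ 2 / (4 * ρ ^ 2) * (1 / (1 + |τ + ρ|) + 1 / (1 + |τ - ρ|)) ^ 2 := by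
                field_simp; try ring
              _ ≤ (2 + t) ^ 2 / (4 * ρ ^ 2) * (2 * ((1 / (1 + |τ + ρ|)) ^ 2 + (1 / (1 + |τ - ρ|)) ^ 2)) := by
                gcongr
                nlinarith [sq_nonneg (1 / (1 + |τ + ρ|) - 1 / (1 + |τ - ρ|))]
              _ = _ := by field_simp; try ring
          calc _ ≤ (2 + t) ^ 2 / (2 * ρ ^ 2) * (w3 (τ + ρ) + w3 (τ - ρ)) * |τ| ^ (1 - 2 * H) := by gcongr
            _ = (2 + t) ^ 2 / (2 * ρ ^ 2) * (w3 (τ + ρ) * |τ| ^ (1 - 2 * H) + w3 (τ - ρ) * |τ| ^ (1 - 2 * H)) := by ring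
            _ ≤ (2 + t) ^ 2 / (2 * ρ ^ 2) * (16 * ρ ^ (1 - 2 * H) * (w3 (τ + ρ) + w τ) +
                16 * ρ ^ (1 - 2 * H) * (w3 (τ - ρ) + w τ)) := by gcongr
            _ = _ := by
              have : ρ ^ (-(2 * H + 1)) = ρ ^ (1 - 2 * H) / ρ ^ 2 := by
                rw [eq_div_iff (by positivity), ← Real.rpow_natCast, ← Real.rpow_add hρ]; congr 1; push_cast; ring
              rw [hA, this]; field_simp; ring
      _ = ENNReal.ofReal (A * (K3 + K3 + 2 * K)) := by
          have i3 : Integrable (fun τ => A * (w3 (τ + ρ) + w3 (τ - ρ) + 2 * w τ)) :=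
            ((i1.add i2).add (hwi.const_mul 2)).const_mul A
          rw [← ofReal_integral_eq_lintegral_ofReal i3
            (Filter.Eventually.of_forall fun τ => by
              have := hw0 τ; have := hw30 (τ + ρ); have := hw30 (τ - ρ); simp only [Pi.zero_apply]; positivity)]
          congr 1
          rw [integral_const_mul]
          congr 1
          have j1 := integral_add (i1.add i2) (hwi.const_mul 2)
          have j2 := integral_add i1 i2
          simp only [Pi.add_apply] at j1
          rw [j1, j2, integral_const_mul, integral_add_right_eq_self w3, integral_sub_right_eq_self w3]
      _ ≤ _ := by
          apply ENNReal.ofReal_le_ofReal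
          have : ρ ^ (-(2 * H + 1)) ≤ 8 * (1 + ρ) ^ (-(2 * H + 1)) := by
            have : ρ ^ (-(2 * H + 1)) ≤ ((1 + ρ) / 2) ^ (-(2 * H + 1)) :=
              Real.rpow_le_rpow_of_nonpos (by positivity) (by linarith) (by linarith)
            refine this.trans ?_
            rw [Real.div_rpow (by positivity) (by positivity), Real.rpow_neg (by positivity : (0:ℝ) ≤ 2),
              div_inv_eq_mul, mul_comm]
            gcongr
            calc (2:ℝ) ^ (2 * H + 1) ≤ 2 ^ (3:ℝ) := Real.rpow_le_rpow_of_exponent_le (by norm_num) (by linarith)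
              _ = 8 := by norm_num
          calc A * (K3 + K3 + 2 * K) ≤ 8 * (2 + t) ^ 2 * (8 * (1 + ρ) ^ (-(2 * H + 1))) * (K3 + K3 + 2 * K) := by
                rw [hA]; gcongr
            _ = 64 * (2 + t) ^ 2 * (2 * K3 + 2 * K) * (1 + ρ) ^ (-(2 * H + 1)) := by ring
            _ ≤ _ := by gcongr; linarith [show 0 ≤ 32 * D ^ 2 * K by positivity]

/-- reduced quadratic form -/
noncomputable def Qt (N : ℕ) (H β : ℝ) {n : ℕ} (z : Fin n → ℝ × EuclideanSpace ℝ (Fin N))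
    (c : Fin n → ℝ) : ℝ := ∫ ξ, ‖Aw c z ξ‖ ^ 2 * om N H β ξ

lemma om_nonneg (N : ℕ) (H β : ℝ) (ξ : EuclideanSpace ℝ (Fin N)) : 0 ≤ om N H β ξ := by
  unfold om; positivity

lemma om_integrable (N : ℕ) (hN : 1 ≤ N) (H β : ℝ) (hH1 : 1 / 2 ≤ H)
    (hβ0 : 0 < β) (hβN : β < N) (hβlow : (N : ℝ) - 2 * H - 1 < β) : Integrable (om N H β) := by
  haveI : Nontrivial (EuclideanSpace ℝ (Fin N)) := by
    apply Module.nontrivial_of_finrank_pos (R := ℝ); simp; omega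
  exact integrable_weight (E := EuclideanSpace ℝ (Fin N)) volume (a := 2 * H + 1) (b := β)
    (by linarith) hβ0.le (by simpa using hβN) (by simp; linarith)

lemma Aw_continuous {N n : ℕ} (c : Fin n → ℝ) (z : Fin n → ℝ × EuclideanSpace ℝ (Fin N)) :
    Continuous (Aw c z) := by
  unfold Aw yf; fun_prop

lemma Aw_bd {N n : ℕ} (c : Fin n → ℝ) (z : Fin n → ℝ × EuclideanSpace ℝ (Fin N)) (ξ) :
    ‖Aw c z ξ‖ ≤ ∑ j, |c j| := by
  unfold Aw
  refine (norm_sum_le _ _).trans (Finset.sum_le_sum fun j _ => ?_)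
  rw [norm_mul, Complex.norm_real, Real.norm_eq_abs]
  have : ‖Complex.exp (-Complex.I * (yf ξ (z j) : ℂ))‖ = 1 := by rw [Complex.norm_exp]; simp
  rw [this, mul_one]

lemma Qt_integrable {N : ℕ} {H β : ℝ} (h : Integrable (om N H β)) {n : ℕ}
    (z : Fin n → ℝ × EuclideanSpace ℝ (Fin N)) (c : Fin n → ℝ) :
    Integrable (fun ξ => ‖Aw c z ξ‖ ^ 2 * om N H β ξ) := by
  refine Integrable.mono' (h.const_mul ((∑ j, |c j|) ^ 2)) ?_ (Filter.Eventually.of_forall fun ξ => ?_)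
  · have : Continuous (Aw c z) := Aw_continuous c z
    have h2 : AEStronglyMeasurable (fun ξ => ‖Aw c z ξ‖ ^ 2) := by fun_prop
    exact h2.mul h.aestronglyMeasurable
  · have h0 := om_nonneg N H β ξ
    rw [Real.norm_of_nonneg (by positivity)]
    have := Aw_bd c z ξ
    gcongr

lemma Gker_meas (N : ℕ) (t : ℝ) (x : EuclideanSpace ℝ (Fin N)) :
    Measurable (fun p : ℝ × EuclideanSpace ℝ (Fin N) => Gker N t x p.1 p.2) := by
  unfold Gker
  fun_prop

lemma Gker_zero (N : ℕ) (t : ℝ) (x : EuclideanSpace ℝ (Fin N)) (τ : ℝ) : Gker N t x τ 0 = 0 := by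
  simp [Gker]

lemma Q_lower
    (N : ℕ) (hN : 1 ≤ N) (H β : ℝ) (hH1 : 1 / 2 ≤ H) (hH2 : H < 1)
    (hβ0 : 0 < β) (hβN : β < N)
    (hβlow : (N : ℝ) - 2 * H - 1 < β)
    (hfun : EuclideanSpace ℝ (Fin N) → ℝ) (hmeas : Measurable hfun)
    (c₁ c₂ : ℝ) (hc₁ : 0 < c₁) (hc₁₂ : c₁ ≤ c₂)
    (hflow : ∀ ξ : EuclideanSpace ℝ (Fin N), ξ ≠ 0 → c₁ * ‖ξ‖ ^ (-β) ≤ hfun ξ)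
    (hfup : ∀ ξ : EuclideanSpace ℝ (Fin N), ξ ≠ 0 → hfun ξ ≤ c₂ * ‖ξ‖ ^ (-β))
    (Ta Tb : ℝ) (hTa : 0 < Ta) :
    ∃ κ : ℝ, 0 < κ ∧ ∀ (n : ℕ) (z : Fin n → ℝ × EuclideanSpace ℝ (Fin N)),
      (∀ j, (z j).1 ∈ Icc Ta Tb) → ∀ (c : Fin n → ℝ), κ * Qt N H β z c ≤ Qvar N H hfun z c := by
  obtain ⟨C, hC0, hC⟩ := wave_lower N H hH1 hH2 Ta Tb hTa
  have homi := om_integrable N hN H β hH1 hβ0 hβN hβlow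
  haveI : Nontrivial (EuclideanSpace ℝ (Fin N)) := by
    apply Module.nontrivial_of_finrank_pos (R := ℝ); simp; omega
  have hne : ∀ᵐ ξ : EuclideanSpace ℝ (Fin N), ξ ≠ 0 := by simp [ae_iff]
  have hh0 : ∀ ξ : EuclideanSpace ℝ (Fin N), ξ ≠ 0 → 0 ≤ hfun ξ := fun ξ hξ =>
    le_trans (by positivity) (hflow ξ hξ)
  refine ⟨c₁ / C, by positivity, fun n z hz c => ?_⟩
  have hsingle : ∀ j, Integrable (fun p : ℝ × EuclideanSpace ℝ (Fin N) =>
      ‖Gker N (z j).1 (z j).2 p.1 p.2‖ ^ 2 * |p.1| ^ (1 - 2 * H) * hfun p.2) (volume.prod volume) := by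
    intro j
    have hGm := Gker_meas N (z j).1 (z j).2
    obtain ⟨D, hD0, hD⟩ := Gker_L2 N H hH1 hH2 (z j).1 (hTa.le.trans (hz j).1) (z j).2
    have hm : Measurable (fun p : ℝ × EuclideanSpace ℝ (Fin N) =>
      ‖Gker N (z j).1 (z j).2 p.1 p.2‖ ^ 2 * |p.1| ^ (1 - 2 * H) * hfun p.2) := by fun_prop
    refine ⟨hm.aestronglyMeasurable, ?_⟩
    rw [HasFiniteIntegral, lintegral_prod_symm _ (by fun_prop)]
    have hle : ∫⁻ y : EuclideanSpace ℝ (Fin N), ∫⁻ x : ℝ, ‖‖Gker N (z j).1 (z j).2 x y‖ ^ 2 * |x| ^ (1 - 2 * H) * hfun y‖ₑ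
        ≤ ∫⁻ y : EuclideanSpace ℝ (Fin N), ENNReal.ofReal (D * c₂) * ENNReal.ofReal (om N H β y) := by
      refine lintegral_mono_ae ?_
      filter_upwards [hne] with y hy
      have e1 : ∀ x : ℝ, ‖‖Gker N (z j).1 (z j).2 x y‖ ^ 2 * |x| ^ (1 - 2 * H) * hfun y‖ₑ =
          ENNReal.ofReal (hfun y) * (‖Gker N (z j).1 (z j).2 x y‖ₑ ^ 2 * ENNReal.ofReal (|x| ^ (1 - 2 * H))) := by
        intro x
        rw [Real.enorm_of_nonneg (by have := hh0 y hy; positivity), mul_comm,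
          ENNReal.ofReal_mul (hh0 y hy), ENNReal.ofReal_mul (by positivity), ENNReal.ofReal_pow (norm_nonneg _), ofReal_norm]
      simp_rw [e1]
      rw [lintegral_const_mul' _ _ ENNReal.ofReal_ne_top]
      calc _ ≤ ENNReal.ofReal (c₂ * ‖y‖ ^ (-β)) * ENNReal.ofReal (D * (1 + ‖y‖) ^ (-(2 * H + 1))) := by
            gcongr
            · exact hfup y hy
            · exact hD y hy
        _ = _ := by
            have : 0 ≤ c₂ := hc₁.le.trans hc₁₂
            rw [← ENNReal.ofReal_mul (by positivity), ← ENNReal.ofReal_mul (by positivity)]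
            congr 1; unfold om; ring
    refine hle.trans_lt ?_
    rw [lintegral_const_mul' _ _ ENNReal.ofReal_ne_top]
    exact ENNReal.mul_lt_top ENNReal.ofReal_lt_top homi.lintegral_lt_top
  set F : ℝ → EuclideanSpace ℝ (Fin N) → ℝ := fun τ ξ => ‖∑ j, (c j : ℂ) * Gker N (z j).1 (z j).2 τ ξ‖ ^ 2 *
      |τ| ^ (1 - 2 * H) * hfun ξ with hF
  have hF0 : ∀ τ ξ, 0 ≤ F τ ξ := by
    intro τ ξ
    by_cases h : ξ = 0
    · subst h; simp [hF, Gker_zero]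
    · have := hh0 ξ h; simp only [hF]; positivity
  have hsm : Measurable (fun p : ℝ × EuclideanSpace ℝ (Fin N) => ∑ j, (c j : ℂ) * Gker N (z j).1 (z j).2 p.1 p.2) := by
    refine Finset.measurable_sum _ fun j _ => ?_
    have := Gker_meas N (z j).1 (z j).2
    fun_prop
  have hFm : Measurable (fun p : ℝ × EuclideanSpace ℝ (Fin N) => F p.1 p.2) := by
    simp only [hF]; fun_prop
  have hFi : Integrable (fun p : ℝ × EuclideanSpace ℝ (Fin N) => F p.1 p.2) (volume.prod volume) := by
    have hs : Integrable (fun p : ℝ × EuclideanSpace ℝ (Fin N) => ∑ j, (n * c j ^ 2) *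
      (‖Gker N (z j).1 (z j).2 p.1 p.2‖ ^ 2 * |p.1| ^ (1 - 2 * H) * hfun p.2)) (volume.prod volume) :=
      integrable_finset_sum _ fun j _ => (hsingle j).const_mul _
    refine hs.mono' hFm.aestronglyMeasurable (Filter.Eventually.of_forall fun p => ?_)
    rw [Real.norm_of_nonneg (hF0 _ _)]
    by_cases h : p.2 = 0
    · simp [hF, h, Gker_zero]
    have h1 := hh0 _ h
    have : ‖∑ j, (c j : ℂ) * Gker N (z j).1 (z j).2 p.1 p.2‖ ^ 2 ≤
        n * ∑ j, c j ^ 2 * ‖Gker N (z j).1 (z j).2 p.1 p.2‖ ^ 2 := by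
      calc _ ≤ (∑ j, ‖(c j : ℂ) * Gker N (z j).1 (z j).2 p.1 p.2‖) ^ 2 := by
            gcongr; exact norm_sum_le _ _
        _ ≤ _ := sq_sum_le_card_mul_sum_sq
        _ = _ := by
            simp only [Finset.card_univ, Fintype.card_fin, norm_mul, mul_pow, Complex.norm_real, Real.norm_eq_abs, sq_abs]
    calc F p.1 p.2 ≤ (n * ∑ j, c j ^ 2 * ‖Gker N (z j).1 (z j).2 p.1 p.2‖ ^ 2) * |p.1| ^ (1 - 2 * H) * hfun p.2 := by
          simp only [hF]; gcongr
      _ = _ := by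
          rw [Finset.mul_sum, Finset.sum_mul, Finset.sum_mul]
          exact Finset.sum_congr rfl fun j _ => by ring
  have hQ : Qvar N H hfun z c = ∫ p, F p.1 p.2 ∂(volume.prod volume) := by
    rw [integral_prod _ hFi]; rfl
  have hQ0 : 0 ≤ Qvar N H hfun z c := by rw [hQ]; exact integral_nonneg fun p => hF0 _ _
  have hQl : ENNReal.ofReal (Qvar N H hfun z c) = ∫⁻ ξ, ∫⁻ τ, ENNReal.ofReal (F τ ξ) := by
    rw [hQ, ofReal_integral_eq_lintegral_ofReal hFi (Filter.Eventually.of_forall fun p => hF0 _ _),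
      lintegral_prod_symm _ (by fun_prop)]
  rw [← ENNReal.ofReal_le_ofReal_iff hQ0, hQl]
  unfold Qt
  rw [← integral_const_mul, ofReal_integral_eq_lintegral_ofReal ((Qt_integrable homi z c).const_mul _)
    (Filter.Eventually.of_forall fun ξ => by have := om_nonneg N H β ξ; simp only [Pi.zero_apply]; positivity)]
  refine lintegral_mono_ae ?_
  filter_upwards [hne] with ξ hξ
  have e1 : ∀ τ : ℝ, ENNReal.ofReal (F τ ξ) =
      ENNReal.ofReal (hfun ξ) * (‖∑ j, (c j : ℂ) * Gker N (z j).1 (z j).2 τ ξ‖ₑ ^ 2 * ENNReal.ofReal (|τ| ^ (1 - 2 * H))) := by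
    intro x
    simp only [hF]
    rw [mul_comm,
      ENNReal.ofReal_mul (hh0 ξ hξ), ENNReal.ofReal_mul (by positivity), ENNReal.ofReal_pow (norm_nonneg _), ofReal_norm]
  simp_rw [e1]
  rw [lintegral_const_mul' _ _ ENNReal.ofReal_ne_top]
  have hw := hC n z hz c ξ hξ
  set I := ∫⁻ τ : ℝ, ‖∑ j, (c j : ℂ) * Gker N (z j).1 (z j).2 τ ξ‖ₑ ^ 2 * ENNReal.ofReal (|τ| ^ (1 - 2 * H))
  calc ENNReal.ofReal (c₁ / C * (‖Aw c z ξ‖ ^ 2 * om N H β ξ))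
      = ENNReal.ofReal (c₁ * ‖ξ‖ ^ (-β)) * (‖Aw c z ξ‖ₑ ^ 2 * ENNReal.ofReal (C * (1 + ‖ξ‖) ^ (2 * H + 1))⁻¹) := by
        rw [← ofReal_norm, ← ENNReal.ofReal_pow (norm_nonneg _), ← ENNReal.ofReal_mul (by positivity),
          ← ENNReal.ofReal_mul (by positivity)]
        congr 1
        unfold om
        rw [Real.rpow_neg (by positivity)]
        field_simp
    _ ≤ ENNReal.ofReal (hfun ξ) * (I * ENNReal.ofReal (C * (1 + ‖ξ‖) ^ (2 * H + 1)) *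
          ENNReal.ofReal (C * (1 + ‖ξ‖) ^ (2 * H + 1))⁻¹) := by
        gcongr
        exact hflow ξ hξ
    _ = _ := by
        rw [mul_assoc I, ← ENNReal.ofReal_mul (by positivity), mul_inv_cancel₀ (by positivity)]; simp

lemma gamma_exists : ∃ f g : ℝ → ℂ, f 0 = 1 ∧ (∀ t, 1 ≤ |t| → f t = 0) ∧ Continuous g ∧
    (∃ C : ℝ, 0 < C ∧ ∀ s, ‖g s‖ * (1 + |s|) ^ 5 ≤ C * |s|) ∧
    (∀ t : ℝ, ∫ τ : ℝ, Complex.exp (-Complex.I * t * τ) * g τ = f t) := by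
  let b : ContDiffBump (0 : ℝ) := ⟨1 / 4, 1 / 2, by norm_num, by norm_num⟩
  set χ : ℝ → ℂ := fun x => ((x * b x : ℝ) : ℂ) with hχ
  have hχs : HasCompactSupport χ := by
    have : HasCompactSupport (fun x : ℝ => x * b x) := b.hasCompactSupport.mul_left
    exact this.comp_left (g := fun x : ℝ => (x : ℂ)) (by simp)
  have hχd : ContDiff ℝ (⊤ : ℕ∞) χ :=
    Complex.ofRealCLM.contDiff.comp (contDiff_id.mul b.contDiff)
  have hfs : HasCompactSupport (deriv χ) := hχs.deriv
  have hfd : ContDiff ℝ (⊤ : ℕ∞) (deriv χ) := by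
    have := ContDiff.iterate_deriv 1 hχd
    simpa using this
  have hfi : Integrable (deriv χ) := hfd.continuous.integrable_of_hasCompactSupport hfs
  obtain ⟨g, hgc, hgd, hgi, hgf⟩ := ft_exists (deriv χ) hfs hfd
  refine ⟨deriv χ, g, ?_, ?_, hgc, ?_, hgi⟩
  · have : χ =ᶠ[nhds 0] fun x => (x : ℂ) := by
      filter_upwards [Metric.closedBall_mem_nhds (0:ℝ) (show (0:ℝ) < 1 / 4 by norm_num)] with x hx
      have : b x = 1 := b.one_of_mem_closedBall hx
      simp [hχ, this]
    rw [this.deriv_eq]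
    exact (hasDerivAt_id (0:ℝ)).ofReal_comp.deriv
  · intro t ht
    have : χ =ᶠ[nhds t] fun x => 0 := by
      have : ∀ᶠ x in nhds t, 1 / 2 < |x| := by
        apply (continuous_abs.tendsto t).eventually (lt_mem_nhds (by linarith))
      filter_upwards [this] with x hx
      have : b x = 0 := b.zero_of_le_dist (by simp [b]; linarith)
      simp [hχ, this]
    rw [this.deriv_eq]; simp
  · obtain ⟨D, hD0, hD⟩ := hgd 6
    have hz : ∫ t, deriv χ t = 0 := by
      apply integral_eq_zero_of_hasDerivAt_of_integrable (f := χ) (fun t => ?_) hfi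
        (hχd.continuous.integrable_of_hasCompactSupport hχs)
      exact ((hχd.differentiable (by simp)) t).hasDerivAt
    have hti : Integrable (fun t : ℝ => |t| * ‖deriv χ t‖) := by
      have : Continuous (fun t : ℝ => |t| * ‖deriv χ t‖) := by have := hfd.continuous; fun_prop
      exact this.integrable_of_hasCompactSupport (hfs.norm.mul_left)
    set L := (1 / (2 * Real.pi)) * ∫ t : ℝ, |t| * ‖deriv χ t‖ with hL
    have hL0 : 0 ≤ L := mul_nonneg (by positivity) (integral_nonneg fun t => by positivity)
    have hlip : ∀ s, ‖g s‖ ≤ L * |s| := by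
      intro s
      have e : g s = (1 / (2 * Real.pi)) * ∫ t : ℝ, (Complex.exp (Complex.I * t * s) - 1) * deriv χ t := by
        rw [hgf]
        congr 1
        have : ∫ t : ℝ, (Complex.exp (Complex.I * t * s) - 1) * deriv χ t =
            ∫ t : ℝ, (Complex.exp (Complex.I * t * s) * deriv χ t - deriv χ t) := by
          congr 1; ext t; ring
        rw [this, integral_sub _ hfi, hz, sub_zero]
        refine hfi.bdd_mul (c := 1) (by fun_prop) (Filter.Eventually.of_forall fun t => ?_)
        rw [exp_unit]
      rw [e, norm_mul]
      have h2 : ‖(1 / (2 * (Real.pi:ℂ)))‖ = 1 / (2 * Real.pi) := by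
        simp [abs_of_pos Real.pi_pos]
      rw [h2, hL, mul_assoc]
      gcongr
      rw [← integral_mul_const]
      refine norm_integral_le_of_norm_le (hti.mul_const _) (Filter.Eventually.of_forall fun t => ?_)
      rw [norm_mul]
      have h3 := exp_diff (-(t * s)) 0
      push_cast at h3
      rw [show -Complex.I * -((t:ℂ) * s) = Complex.I * t * s by ring, mul_zero, Complex.exp_zero, sub_zero, abs_neg, abs_mul] at h3
      calc _ ≤ |t| * |s| * ‖deriv χ t‖ := by gcongr
        _ = _ := by ring
    refine ⟨D + 32 * L, by positivity, fun s => ?_⟩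
    rcases le_or_gt |s| 1 with h | h
    · have : (1 + |s|) ^ 5 ≤ 32 := by
        calc (1 + |s|) ^ 5 ≤ (1 + 1) ^ 5 := by gcongr
          _ = 32 := by norm_num
      calc _ ≤ (L * |s|) * 32 := by gcongr; exact hlip s
        _ ≤ _ := by nlinarith [abs_nonneg s]
    · have h1 := hD s
      have h2 : ‖g s‖ * (1 + |s|) ^ 5 ≤ ‖g s‖ * (1 + |s|) ^ 6 := by
        gcongr
        · linarith [abs_nonneg s]
        · norm_num
      nlinarith [mul_nonneg hL0 (abs_nonneg s)]

lemma gamma_int (N : ℕ) (H β : ℝ) (hH1 : 1 / 2 ≤ H) (hH2 : H < 1)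
    (hβN : β < N) (hβlow : (N : ℝ) - 2 * H - 1 < β) (g : ℝ → ℂ) (C : ℝ) (hC : 0 < C)
    (hg : ∀ s, ‖g s‖ * (1 + |s|) ^ 5 ≤ C * |s|) :
    ∫⁻ s : ℝ, ‖g s‖ₑ ^ 2 * ENNReal.ofReal (|s| ^ ((N:ℝ) - 1 - β) * (1 + |s|) ^ (-(2 * H + 1)))⁻¹ ≠ ⊤ := by
  have hi := (integrable_one_add_norm (E := ℝ) (μ := volume) (r := 4) (by simp)).lintegral_lt_top
  have : ∫⁻ s : ℝ, ‖g s‖ₑ ^ 2 * ENNReal.ofReal (|s| ^ ((N:ℝ) - 1 - β) * (1 + |s|) ^ (-(2 * H + 1)))⁻¹ ≤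
      ∫⁻ s : ℝ, ENNReal.ofReal (C ^ 2) * ENNReal.ofReal ((1 + ‖s‖) ^ (-(4:ℝ))) := by
    refine lintegral_mono fun s => ?_
    rw [← ofReal_norm, ← ENNReal.ofReal_pow (norm_nonneg _), ← ENNReal.ofReal_mul (by positivity),
      ← ENNReal.ofReal_mul (by positivity)]
    apply ENNReal.ofReal_le_ofReal
    have h1 := hg s
    by_cases hs : s = 0
    · subst hs
      have : ‖g 0‖ = 0 := by
        have := norm_nonneg (g 0)
        simp at h1; simp [h1]
      rw [this]; simp; positivity
    have hs0 : 0 < |s| := abs_pos.2 hs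
    have hs1 : 1 ≤ 1 + |s| := by linarith
    have h2 : ‖g s‖ ≤ C * |s| / (1 + |s|) ^ 5 := by rw [le_div_iff₀ (by positivity)]; exact h1
    rw [mul_inv, ← Real.rpow_neg (by positivity), ← Real.rpow_neg (by positivity), Real.norm_eq_abs]
    have e1 : |s| ^ 2 * |s| ^ (-((N:ℝ) - 1 - β)) ≤ (1 + |s|) ^ (3:ℝ) := by
      rw [← Real.rpow_natCast, ← Real.rpow_add hs0]
      calc |s| ^ (((2:ℕ):ℝ) + -((N:ℝ) - 1 - β)) ≤ (1 + |s|) ^ (((2:ℕ):ℝ) + -((N:ℝ) - 1 - β)) := by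
            apply Real.rpow_le_rpow hs0.le (by linarith)
            push_cast; linarith
        _ ≤ _ := Real.rpow_le_rpow_of_exponent_le hs1 (by push_cast; linarith)
    have e2 : (1 + |s|) ^ (- -(2 * H + 1)) ≤ (1 + |s|) ^ (3:ℝ) :=
      Real.rpow_le_rpow_of_exponent_le hs1 (by linarith)
    have e3 : (1 + |s|) ^ (-(4:ℝ)) = ((1 + |s|) ^ 10)⁻¹ * ((1 + |s|) ^ (3:ℝ) * (1 + |s|) ^ (3:ℝ)) := by
      rw [Real.rpow_neg (by positivity)]
      norm_cast
      field_simp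
    calc _ ≤ (C * |s| / (1 + |s|) ^ 5) ^ 2 * (|s| ^ (-((N:ℝ) - 1 - β)) * (1 + |s|) ^ (- -(2 * H + 1))) := by
          gcongr
      _ = C ^ 2 * ((1 + |s|) ^ 10)⁻¹ * ((|s| ^ 2 * |s| ^ (-((N:ℝ) - 1 - β))) * (1 + |s|) ^ (- -(2 * H + 1))) := by
          field_simp
      _ ≤ C ^ 2 * ((1 + |s|) ^ 10)⁻¹ * ((1 + |s|) ^ (3:ℝ) * (1 + |s|) ^ (3:ℝ)) := by gcongr
      _ = _ := by rw [e3]; ring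
  refine (this.trans_lt ?_).ne
  rw [lintegral_const_mul' _ _ ENNReal.ofReal_ne_top]
  exact ENNReal.mul_lt_top ENNReal.ofReal_lt_top hi

lemma yf_smul {N : ℕ} (η : EuclideanSpace ℝ (Fin N)) (z : ℝ × EuclideanSpace ℝ (Fin N)) (r : ℝ) (hr : 0 ≤ r) :
    yf (r • η) z = r * yf η z := by
  unfold yf
  rw [norm_smul, Real.norm_of_nonneg hr, inner_smul_right]; ring

/-- scaling bound -/
lemma lnd_scale (N : ℕ) (H β : ℝ) (hH1 : 1 / 2 ≤ H) (hβ0 : 0 < β)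
    (F : EuclideanSpace ℝ (Fin N) → ℝ≥0∞) (hF : Measurable F) (δ : ℝ) (hδ : 0 < δ) (hδ1 : δ ≤ 1)
    (W : Set (EuclideanSpace ℝ (Fin N))) (hW : MeasurableSet W)
    (hWn : ∀ η ∈ W, 1 / 2 ≤ ‖η‖ ∧ ‖η‖ ≤ 2) :
    ∫⁻ s : ℝ, ∫⁻ η in W, F ((|s| / δ) • η) * ENNReal.ofReal (|s| ^ ((N:ℝ) - 1 - β) * (1 + |s|) ^ (-(2 * H + 1)))
      ≤ ENNReal.ofReal (2 ^ (2 * H + 4 + β) * δ ^ (-(2 * alphaExp N H β))) *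
        ∫⁻ ξ, F ξ * ENNReal.ofReal (om N H β ξ) := by
  set G : ℝ → EuclideanSpace ℝ (Fin N) → ℝ≥0∞ := fun s ξ =>
    F ξ * (({p : ℝ × EuclideanSpace ℝ (Fin N) | δ * ‖p.2‖ / 2 ≤ |p.1| ∧ |p.1| ≤ 2 * (δ * ‖p.2‖)}.indicator
      (fun p => ENNReal.ofReal (δ ^ N * (δ * ‖p.2‖ / 2) ^ (-(1 + β)) * (δ * (1 + ‖p.2‖) / 2) ^ (-(2 * H + 1))))) (s, ξ)) with hG
  have hset : MeasurableSet {p : ℝ × EuclideanSpace ℝ (Fin N) | δ * ‖p.2‖ / 2 ≤ |p.1| ∧ |p.1| ≤ 2 * (δ * ‖p.2‖)} := by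
    apply MeasurableSet.inter
    · exact measurableSet_le (f := fun p : ℝ × EuclideanSpace ℝ (Fin N) => δ * ‖p.2‖ / 2) (g := fun p => |p.1|)
        (by fun_prop) (by fun_prop)
    · exact measurableSet_le (f := fun p : ℝ × EuclideanSpace ℝ (Fin N) => |p.1|) (g := fun p => 2 * (δ * ‖p.2‖))
        (by fun_prop) (by fun_prop)
  have hGm : Measurable (Function.uncurry G) := by
    have h1 : Measurable (fun p : ℝ × EuclideanSpace ℝ (Fin N) => F p.2) := hF.comp measurable_snd
    exact h1.mul (Measurable.indicator (by fun_prop) hset)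
  have hs0 : ∀ᵐ s : ℝ, s ≠ 0 := by simp [ae_iff]
  calc _ ≤ ∫⁻ s : ℝ, ∫⁻ ξ, G s ξ := by
        refine lintegral_mono_ae ?_
        filter_upwards [hs0] with s hs
        have ha : 0 < |s| := abs_pos.2 hs
        set r := |s| / δ with hr
        have hr0 : 0 < r := by positivity
        set u := |s| ^ ((N:ℝ) - 1 - β) * (1 + |s|) ^ (-(2 * H + 1)) with hu
        have hu0 : 0 ≤ u := by positivity
        rw [← lintegral_indicator hW]
        set K : EuclideanSpace ℝ (Fin N) → ℝ≥0∞ := fun ξ => (W.indicator (fun _ => (1:ℝ≥0∞)) (r⁻¹ • ξ)) * F ξ with hK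
        have hKm : Measurable K := by
          have : Measurable (W.indicator (fun _ => (1:ℝ≥0∞))) := measurable_const.indicator hW
          have h2 : Measurable (fun ξ : EuclideanSpace ℝ (Fin N) => W.indicator (fun _ => (1:ℝ≥0∞)) (r⁻¹ • ξ)) :=
            this.comp (measurable_const_smul r⁻¹)
          exact h2.mul hF
        have e1 : ∀ η, W.indicator (fun η => F (r • η) * ENNReal.ofReal u) η = ENNReal.ofReal u * K (r • η) := by
          intro η
          simp only [hK]
          rw [smul_smul, inv_mul_cancel₀ hr0.ne', one_smul]
          by_cases h : η ∈ W
          · simp [h, mul_comm]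
          · simp [h]
        simp_rw [e1]
        rw [lintegral_const_mul' _ _ ENNReal.ofReal_ne_top]
        have e2 : ∫⁻ η, K (r • η) = ENNReal.ofReal ((r ^ N)⁻¹) * ∫⁻ ξ, K ξ := by
          have hmap := Measure.map_addHaar_smul (volume : Measure (EuclideanSpace ℝ (Fin N))) hr0.ne'
          rw [← lintegral_map hKm (measurable_const_smul r), hmap, lintegral_smul_measure]
          simp [abs_of_pos hr0]
        rw [e2, ← lintegral_const_mul' _ _ ENNReal.ofReal_ne_top, ← lintegral_const_mul' _ _ ENNReal.ofReal_ne_top]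
        refine lintegral_mono fun ξ => ?_
        simp only [hK, hG]
        by_cases h : r⁻¹ • ξ ∈ W
        · have h1 := hWn _ h
          rw [norm_smul, Real.norm_of_nonneg (by positivity), hr, inv_div] at h1
          have a1 : δ * ‖ξ‖ / 2 ≤ |s| := by
            have := h1.2; rw [div_mul_eq_mul_div, div_le_iff₀ ha] at this; linarith
          have a2 : |s| ≤ 2 * (δ * ‖ξ‖) := by
            have := h1.1; rw [div_mul_eq_mul_div, le_div_iff₀ ha] at this; linarith
          have hξ : 0 < ‖ξ‖ := by
            by_contra hcon
            have : ‖ξ‖ = 0 := le_antisymm (not_lt.1 hcon) (norm_nonneg _)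
            rw [this] at a2; simp at a2; exact hs a2
          rw [indicator_of_mem h, indicator_of_mem (by exact ⟨a1, a2⟩), one_mul, mul_comm (ENNReal.ofReal _) (F ξ),
            mul_left_comm, ← ENNReal.ofReal_mul hu0]
          gcongr F ξ * ENNReal.ofReal ?_
          have e3 : u * (r ^ N)⁻¹ = δ ^ N * |s| ^ (-(1 + β)) * (1 + |s|) ^ (-(2 * H + 1)) := by
            rw [hu, hr, div_pow]
            have : |s| ^ ((N:ℝ) - 1 - β) = |s| ^ N * |s| ^ (-(1 + β)) := by
              rw [← Real.rpow_natCast, ← Real.rpow_add ha]; congr 1; ring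
            rw [this]; field_simp
          simp only
          rw [e3]
          gcongr ?_ * ?_ * ?_
          · exact Real.rpow_le_rpow_of_nonpos (by positivity) a1 (by linarith)
          · refine Real.rpow_le_rpow_of_nonpos (by positivity) ?_ (by linarith)
            nlinarith
        · simp [h]
    _ = ∫⁻ ξ, ∫⁻ s : ℝ, G s ξ := lintegral_lintegral_swap hGm.aemeasurable
    _ ≤ ∫⁻ ξ, ENNReal.ofReal (2 ^ (2 * H + 4 + β) * δ ^ (-(2 * alphaExp N H β))) * (F ξ * ENNReal.ofReal (om N H β ξ)) := by
        refine lintegral_mono fun ξ => ?_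
        simp only
        set A := δ ^ N * (δ * ‖ξ‖ / 2) ^ (-(1 + β)) * (δ * (1 + ‖ξ‖) / 2) ^ (-(2 * H + 1)) with hA
        have hA0 : 0 ≤ A := by positivity
        calc ∫⁻ s, G s ξ ≤ ∫⁻ s, (Icc (-(2 * (δ * ‖ξ‖))) (2 * (δ * ‖ξ‖))).indicator (fun _ => F ξ * ENNReal.ofReal A) s := by
              refine lintegral_mono fun s => ?_
              simp only [hG]
              by_cases h : δ * ‖ξ‖ / 2 ≤ |s| ∧ |s| ≤ 2 * (δ * ‖ξ‖)
              · rw [indicator_of_mem (by exact h), indicator_of_mem (by exact abs_le.1 h.2)]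
              · rw [indicator_of_notMem (by exact h)]; simp
          _ = F ξ * ENNReal.ofReal A * ENNReal.ofReal (4 * (δ * ‖ξ‖)) := by
              rw [lintegral_indicator measurableSet_Icc, setLIntegral_const, Real.volume_Icc]; congr 2; ring
          _ = F ξ * ENNReal.ofReal (A * (4 * (δ * ‖ξ‖))) := by rw [ENNReal.ofReal_mul hA0, mul_assoc]
          _ ≤ F ξ * ENNReal.ofReal (2 ^ (2 * H + 4 + β) * δ ^ (-(2 * alphaExp N H β)) * om N H β ξ) := by
              gcongr F ξ * ENNReal.ofReal ?_
              by_cases hξ : ξ = 0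
              · subst hξ; have := om_nonneg N H β 0; rw [norm_zero, mul_zero, mul_zero, mul_zero]; positivity
              have hρ : 0 < ‖ξ‖ := norm_pos_iff.2 hξ
              rw [hA]; unfold om
              rw [Real.div_rpow (by positivity) (by positivity), Real.div_rpow (by positivity) (by positivity),
                Real.mul_rpow (by positivity) (by positivity), Real.mul_rpow (by positivity) (by positivity)]
              have e1 : δ ^ (-(2 * alphaExp N H β)) = δ ^ N * δ ^ (-(1 + β)) * δ ^ (-(2 * H + 1)) * δ := by
                rw [← Real.rpow_natCast, ← Real.rpow_add hδ, ← Real.rpow_add hδ]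
                nth_rewrite 3 [← Real.rpow_one δ]
                rw [← Real.rpow_add hδ]; congr 1; unfold alphaExp; ring
              have e2 : (2:ℝ) ^ (2 * H + 4 + β) = 4 / (2 ^ (-(1 + β)) * 2 ^ (-(2 * H + 1))) := by
                rw [eq_div_iff (by positivity), ← Real.rpow_add (by norm_num), ← Real.rpow_add (by norm_num)]
                ring_nf; norm_num
              have e3 : ‖ξ‖ ^ (-β) = ‖ξ‖ ^ (-(1 + β)) * ‖ξ‖ := by
                nth_rewrite 3 [← Real.rpow_one ‖ξ‖]
                rw [← Real.rpow_add hρ]; congr 1; ring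
              rw [e1, e2, e3]
              apply le_of_eq
              field_simp
          _ = _ := by
              rw [ENNReal.ofReal_mul (by positivity)]; ring
    _ = _ := lintegral_const_mul' _ _ ENNReal.ofReal_ne_top

lemma lnd (N : ℕ) (hN : 1 ≤ N) (H β : ℝ) (hH1 : 1 / 2 ≤ H) (hH2 : H < 1)
    (hβ0 : 0 < β) (hβN : β < N) (hβlow : (N : ℝ) - 2 * H - 1 < β) :
    ∃ κ : ℝ, 0 < κ ∧ ∀ (n : ℕ) (z : Fin n → ℝ × EuclideanSpace ℝ (Fin N)) (c : Fin n → ℝ) (j : Fin n)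
      (δ : ℝ), 0 < δ → δ ≤ 1 → ∀ W : Set (EuclideanSpace ℝ (Fin N)), MeasurableSet W →
      (∀ η ∈ W, (1 / 2 ≤ ‖η‖ ∧ ‖η‖ ≤ 2) ∧ ∀ i, i ≠ j → c i ≠ 0 → δ ≤ |yf η (z i) - yf η (z j)|) →
      ENNReal.ofReal (κ * δ ^ (2 * alphaExp N H β) * c j ^ 2) * volume W ≤ ENNReal.ofReal (Qt N H β z c) := by
  obtain ⟨f, g, hf0, hf1, hgc, ⟨C, hC0, hgC⟩, hgi⟩ := gamma_exists
  have hK := gamma_int N H β hH1 hH2 hβN hβlow g C hC0 hgC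
  have homi := om_integrable N hN H β hH1 hβ0 hβN hβlow
  set u : ℝ → ℝ := fun s => |s| ^ ((N:ℝ) - 1 - β) * (1 + |s|) ^ (-(2 * H + 1)) with hu
  set K := ∫⁻ s : ℝ, ‖g s‖ₑ ^ 2 * ENNReal.ofReal (u s)⁻¹ with hKdef
  set B := (K.toReal + 1) * 2 ^ (2 * H + 4 + β) with hB
  have hB0 : 0 < B := by positivity
  refine ⟨B⁻¹, by positivity, fun n z c j δ hδ hδ1 W hW hWp => ?_⟩
  set α := alphaExp N H β with hα
  have hgint : Integrable g := by
    refine integrable_of_decay hgc (C := C) fun τ => ?_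
    have h1 := hgC τ
    have h2 : (1 + |τ|) ^ 5 = (1 + |τ|) ^ 2 * (1 + |τ|) ^ 3 := by ring
    have h3 : 1 + |τ| ≤ (1 + |τ|) ^ 3 := by
      have : 1 ≤ 1 + |τ| := by linarith [abs_nonneg τ]
      calc 1 + |τ| = (1 + |τ|) ^ 1 := by ring
        _ ≤ _ := pow_le_pow_right₀ this (by norm_num)
    have h4 : 0 ≤ ‖g τ‖ * (1 + |τ|) ^ 2 := by positivity
    have h5 : 0 < 1 + |τ| := by positivity
    by_contra hcon
    push Not at hcon
    have : C * (1 + |τ|) < ‖g τ‖ * (1 + |τ|) ^ 2 * (1 + |τ|) ^ 3 :=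
      calc C * (1 + |τ|) < ‖g τ‖ * (1 + |τ|) ^ 2 * (1 + |τ|) := by gcongr
        _ ≤ _ := by gcongr
    rw [h2] at h1
    nlinarith
  have hpt : ∀ η ∈ W, ENNReal.ofReal (c j ^ 2) ≤
      (∫⁻ s : ℝ, ‖Aw c z ((|s| / δ) • η)‖ₑ ^ 2 * ENNReal.ofReal (u s)) * K := by
    intro η hη
    obtain ⟨-, hsep⟩ := hWp η hη
    set h : ℝ → ℂ := fun s => ∑ i, (c i : ℂ) * Complex.exp (-Complex.I * (((yf η (z i) - yf η (z j)) / δ : ℝ) : ℂ) * s) with hh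
    have hhc : Continuous h := by simp only [hh]; fun_prop
    have e1 : ∫ s, h s * g s = c j := by
      simp only [hh, Finset.sum_mul]
      rw [integral_finsetSum]
      · simp only [mul_assoc (c _ : ℂ)]
        simp_rw [integral_const_mul, hgi]
        rw [Finset.sum_eq_single j]
        · simp [hf0]
        · intro i _ hij
          by_cases hc : c i = 0
          · simp [hc]
          · rw [hf1, mul_zero]
            rw [abs_div, abs_of_pos hδ, le_div_iff₀ hδ, one_mul]
            exact hsep i hij hc
        · simp
      · intro i _
        simp only [mul_assoc (c _ : ℂ)]
        refine Integrable.const_mul ?_ _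
        refine hgint.bdd_mul (c := 1) (by fun_prop) (Filter.Eventually.of_forall fun t => ?_)
        rw [exp_unit']
    have e2 := cs_weight volume h g u hhc.measurable.aemeasurable hgc.measurable.aemeasurable
      (by simp only [hu]; fun_prop) (by
        have hs0 : ∀ᵐ s : ℝ, s ≠ 0 := by simp [ae_iff]
        filter_upwards [hs0] with s hs
        have := abs_pos.2 hs
        simp only [hu]; positivity)
    rw [e1, ← hKdef] at e2
    have e3 : ∀ s, ‖h s‖ₑ = ‖Aw c z ((|s| / δ) • η)‖ₑ := by
      have key : ∀ s : ℝ, 0 ≤ s → ‖h s‖ = ‖Aw c z ((s / δ) • η)‖ := by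
        intro s hs
        have : h s = Complex.exp (Complex.I * (s / δ * yf η (z j) : ℝ)) * Aw c z ((s / δ) • η) := by
          simp only [hh, Aw]
          rw [Finset.mul_sum]
          refine Finset.sum_congr rfl fun i _ => ?_
          rw [mul_left_comm, ← Complex.exp_add, yf_smul _ _ _ (by positivity)]
          congr 2; push_cast; ring
        rw [this, norm_mul, mul_comm Complex.I, Complex.norm_exp_ofReal_mul_I, one_mul]
      have hneg : ∀ s : ℝ, ‖h (-s)‖ = ‖h s‖ := by
        intro s
        have : h (-s) = (starRingEnd ℂ) (h s) := by
          simp only [hh, map_sum, map_mul, Complex.conj_ofReal, ← Complex.exp_conj, map_neg, Complex.conj_I]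
          refine Finset.sum_congr rfl fun i _ => ?_
          push_cast; ring_nf
        rw [this, RCLike.norm_conj]
      intro s
      rw [← ofReal_norm, ← ofReal_norm]
      congr 1
      rcases le_total 0 s with h0 | h0
      · rw [abs_of_nonneg h0]; exact key s h0
      · rw [abs_of_nonpos h0, ← hneg]; exact key (-s) (by linarith)
    simp_rw [e3] at e2
    refine le_trans (le_of_eq ?_) e2
    rw [← ofReal_norm, ← ENNReal.ofReal_pow (norm_nonneg _), Complex.norm_real, Real.norm_eq_abs, sq_abs]
  have hFm : Measurable (fun ξ => ‖Aw c z ξ‖ₑ ^ 2) := by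
    have := (Aw_continuous c z).measurable
    fun_prop
  have hAw := lnd_scale N H β hH1 hβ0 (fun ξ => ‖Aw c z ξ‖ₑ ^ 2) hFm δ hδ hδ1 W hW (fun η hη => (hWp η hη).1)
  have hQt : ∫⁻ ξ, ‖Aw c z ξ‖ₑ ^ 2 * ENNReal.ofReal (om N H β ξ) = ENNReal.ofReal (Qt N H β z c) := by
    unfold Qt
    rw [ofReal_integral_eq_lintegral_ofReal (Qt_integrable homi z c)
      (Filter.Eventually.of_forall fun ξ => by have := om_nonneg N H β ξ; simp only [Pi.zero_apply]; positivity)]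
    refine lintegral_congr fun ξ => ?_
    rw [ENNReal.ofReal_mul (by positivity), ENNReal.ofReal_pow (norm_nonneg _), ofReal_norm]
  rw [hQt] at hAw
  have hmain : ENNReal.ofReal (c j ^ 2) * volume W ≤
      ENNReal.ofReal (B * δ ^ (-(2 * α))) * ENNReal.ofReal (Qt N H β z c) := by
    calc ENNReal.ofReal (c j ^ 2) * volume W = ∫⁻ η in W, ENNReal.ofReal (c j ^ 2) := by
          rw [setLIntegral_const]
      _ ≤ ∫⁻ η in W, (∫⁻ s : ℝ, ‖Aw c z ((|s| / δ) • η)‖ₑ ^ 2 * ENNReal.ofReal (u s)) * K :=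
          setLIntegral_mono' hW hpt
      _ = (∫⁻ η in W, (∫⁻ s : ℝ, ‖Aw c z ((|s| / δ) • η)‖ₑ ^ 2 * ENNReal.ofReal (u s))) * K :=
          lintegral_mul_const' _ _ hK
      _ = (∫⁻ s : ℝ, ∫⁻ η in W, ‖Aw c z ((|s| / δ) • η)‖ₑ ^ 2 * ENNReal.ofReal (u s)) * K := by
          rw [lintegral_lintegral_swap]
          have := (Aw_continuous c z).measurable
          apply Measurable.aemeasurable
          simp only [Function.uncurry_def, hu]
          fun_prop
      _ ≤ (ENNReal.ofReal (2 ^ (2 * H + 4 + β) * δ ^ (-(2 * α))) * ENNReal.ofReal (Qt N H β z c)) *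
          ENNReal.ofReal (K.toReal + 1) := by
          gcongr
          rw [← ENNReal.ofReal_toReal hK]
          apply ENNReal.ofReal_le_ofReal
          rw [ENNReal.toReal_ofReal ENNReal.toReal_nonneg]; linarith
      _ = _ := by
          rw [mul_comm, ← mul_assoc, ← ENNReal.ofReal_mul (by positivity), hB]; congr 2; ring
  calc ENNReal.ofReal (B⁻¹ * δ ^ (2 * α) * c j ^ 2) * volume W
      = ENNReal.ofReal (B⁻¹ * δ ^ (2 * α)) * (ENNReal.ofReal (c j ^ 2) * volume W) := by
        rw [ENNReal.ofReal_mul (by positivity), mul_assoc]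
    _ ≤ ENNReal.ofReal (B⁻¹ * δ ^ (2 * α)) * (ENNReal.ofReal (B * δ ^ (-(2 * α))) * ENNReal.ofReal (Qt N H β z c)) := by
        gcongr
    _ = _ := by
        rw [← mul_assoc, ← ENNReal.ofReal_mul (by positivity), Real.rpow_neg hδ.le]
        have : B⁻¹ * δ ^ (2 * α) * (B * (δ ^ (2 * α))⁻¹) = 1 := by
          have : 0 < δ ^ (2 * α) := by positivity
          field_simp
        rw [this]; simp

lemma gauss_one (b s : ℝ) (hb : 0 < b) :
    ∫⁻ x : ℝ, ENNReal.ofReal (Real.exp (-b * (x + s) ^ 2)) = ENNReal.ofReal (Real.sqrt (Real.pi / b)) := by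
  have h := lintegral_add_right_eq_self (μ := volume) (fun x : ℝ => ENNReal.ofReal (Real.exp (-b * x ^ 2))) s
  rw [h, ← integral_gaussian, ofReal_integral_eq_lintegral_ofReal (integrable_exp_neg_mul_sq hb)
    (Filter.Eventually.of_forall fun x => (Real.exp_pos _).le)]

lemma gauss_multi : ∀ (n : ℕ) (M : Fin n → Fin n → ℝ) (_ : ∀ i j, M i j = M j i) (v : Fin n → ℝ)
    (_ : ∀ j, 0 < v j)
    (_ : ∀ (c : Fin n → ℝ) (j : Fin n), (∀ i, j < i → c i = 0) → v j * c j ^ 2 ≤ ∑ i, ∑ k, M i k * c i * c k),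
    ∫⁻ c : Fin n → ℝ, ENNReal.ofReal (Real.exp (-(1 / 4) * ∑ i, ∑ k, M i k * c i * c k)) ≤
      ∏ j, ENNReal.ofReal (Real.sqrt (4 * Real.pi / v j)) := by
  intro n
  induction n with
  | zero =>
    intro M _ v _ _
    simp [volume_pi]
  | succ n ih =>
    intro M hM v hv h
    have hM0 : v 0 ≤ M 0 0 := by
      have := h (Pi.single 0 1) 0 (by intro i hi; simp [hi.ne'])
      simpa [Pi.single_apply, Fin.sum_univ_succ] using this
    have hM00 : 0 < M 0 0 := (hv 0).trans_le hM0
    set L : (Fin n → ℝ) → ℝ := fun c => ∑ i, M 0 i.succ * c i with hL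
    set M' : Fin n → Fin n → ℝ := fun i k => M i.succ k.succ - M 0 i.succ * M 0 k.succ / M 0 0 with hM'
    have key : ∀ (x : ℝ) (c : Fin n → ℝ), ∑ i, ∑ k, M i k * (Fin.cons x c : Fin (n+1) → ℝ) i * (Fin.cons x c : Fin (n+1) → ℝ) k =
        M 0 0 * (x + L c / M 0 0) ^ 2 + ∑ i, ∑ k, M' i k * c i * c k := by
      intro x c
      have e1 : ∑ i, ∑ k, M' i k * c i * c k = (∑ i, ∑ k : Fin n, M i.succ k.succ * c i * c k) - L c * L c / M 0 0 := by
        simp only [hM', hL, Finset.sum_mul_sum, Finset.sum_div, ← Finset.sum_sub_distrib]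
        refine Finset.sum_congr rfl fun i _ => Finset.sum_congr rfl fun k _ => by ring
      rw [e1]
      simp only [Fin.sum_univ_succ, Fin.cons_zero, Fin.cons_succ, Finset.sum_add_distrib]
      have e2 : ∑ k : Fin n, M 0 k.succ * x * c k = x * L c := by
        simp only [hL, Finset.mul_sum]; exact Finset.sum_congr rfl fun i _ => by ring
      have e3 : ∑ k : Fin n, M k.succ 0 * c k * x = x * L c := by
        simp only [hL, Finset.mul_sum]; exact Finset.sum_congr rfl fun i _ => by rw [hM i.succ 0]; ring
      rw [e2, e3]
      field_simp
      ring
    have hM's : ∀ i j, M' i j = M' j i := by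
      intro i j; simp only [hM']; rw [hM i.succ j.succ]; ring
    have hM'l : ∀ (c : Fin n → ℝ) (j : Fin n), (∀ i, j < i → c i = 0) → v j.succ * c j ^ 2 ≤ ∑ i, ∑ k, M' i k * c i * c k := by
      intro c j hc
      have := h (Fin.cons (-(L c / M 0 0)) c) j.succ (by
        intro i hi
        induction i using Fin.cases with
        | zero => simp at hi
        | succ i => rw [Fin.cons_succ]; exact hc i (by simpa using hi))
      rw [key, Fin.cons_succ] at this
      simpa using this
    have ih' := ih M' hM's (fun j => v j.succ) (fun j => hv _) hM'l
    have hmp := (volume_preserving_piFinSuccAbove (fun _ : Fin (n+1) => ℝ) 0).symm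
    rw [← hmp.lintegral_comp (by
      have : Continuous fun c : Fin (n+1) → ℝ => ENNReal.ofReal (Real.exp (-(1 / 4) * ∑ i, ∑ k, M i k * c i * c k)) :=
        ENNReal.continuous_ofReal.comp (by fun_prop)
      exact this.measurable)]
    have e4 : ∀ p : ℝ × (Fin n → ℝ), (MeasurableEquiv.piFinSuccAbove (fun _ : Fin (n+1) => ℝ) 0).symm p = Fin.cons p.1 p.2 := by
      intro p; simp [MeasurableEquiv.piFinSuccAbove, Fin.insertNthEquiv]
    simp_rw [e4, key]
    have e5 : ∀ p : ℝ × (Fin n → ℝ), ENNReal.ofReal (Real.exp (-(1 / 4) * (M 0 0 * (p.1 + L p.2 / M 0 0) ^ 2 + ∑ i, ∑ k, M' i k * p.2 i * p.2 k)))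
      = ENNReal.ofReal (Real.exp (-(1 / 4) * ∑ i, ∑ k, M' i k * p.2 i * p.2 k)) * ENNReal.ofReal (Real.exp (-(M 0 0 / 4) * (p.1 + L p.2 / M 0 0) ^ 2)) := by
      intro p
      rw [← ENNReal.ofReal_mul (Real.exp_pos _).le, ← Real.exp_add]; congr 2; ring
    simp_rw [e5]
    rw [Measure.volume_eq_prod, lintegral_prod_symm _ (by
      apply Measurable.aemeasurable
      simp only [hL]
      fun_prop)]
    simp only
    have e6 : ∀ y : Fin n → ℝ, ∫⁻ x : ℝ, ENNReal.ofReal (Real.exp (-(1 / 4) * ∑ i, ∑ k, M' i k * y i * y k)) *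
        ENNReal.ofReal (Real.exp (-(M 0 0 / 4) * (x + L y / M 0 0) ^ 2)) =
        ENNReal.ofReal (Real.exp (-(1 / 4) * ∑ i, ∑ k, M' i k * y i * y k)) * ENNReal.ofReal (Real.sqrt (Real.pi / (M 0 0 / 4))) := by
      intro y
      rw [lintegral_const_mul' _ _ ENNReal.ofReal_ne_top, gauss_one _ _ (by positivity)]
    simp_rw [e6]
    rw [lintegral_mul_const' _ _ ENNReal.ofReal_ne_top, Fin.prod_univ_succ, mul_comm]
    refine mul_le_mul' ?_ ih'
    apply ENNReal.ofReal_le_ofReal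
    apply Real.sqrt_le_sqrt
    rw [div_div_eq_mul_div, mul_comm]
    have := hv 0
    gcongr

lemma rpow_exp_bd (x s : ℝ) (hx : 0 ≤ x) (hs : 0 ≤ s) : x ^ s * Real.exp (-(1 / 4) * x) ≤ (4 * s) ^ s := by
  rcases hs.eq_or_lt with h | h
  · subst h; simp; positivity
  have h1 : x / (4 * s) ≤ Real.exp (x / (4 * s)) := by linarith [Real.add_one_le_exp (x / (4 * s))]
  have h2 : x ^ s ≤ (4 * s) ^ s * Real.exp (x / 4) := by
    have h3 : x ≤ 4 * s * Real.exp (x / (4 * s)) := by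
      rw [div_le_iff₀ (by positivity)] at h1; linarith
    calc x ^ s ≤ (4 * s * Real.exp (x / (4 * s))) ^ s := by gcongr
      _ = _ := by
        rw [Real.mul_rpow (by positivity) (by positivity), ← Real.exp_mul]; congr 2; field_simp
  calc x ^ s * Real.exp (-(1 / 4) * x) ≤ (4 * s) ^ s * Real.exp (x / 4) * Real.exp (-(1 / 4) * x) := by gcongr
    _ = _ := by rw [mul_assoc, ← Real.exp_add]; ring_nf; simp

lemma J_bound (n d : ℕ) (hn : 1 ≤ n) (M : Fin n → Fin n → ℝ) (hM : ∀ i j, M i j = M j i) (v V : Fin n → ℝ)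
    (hv : ∀ j, 0 < v j) (hV : ∀ j, 0 < V j)
    (hvl : ∀ (c : Fin n → ℝ) (j : Fin n), (∀ i, j < i → c i = 0) → v j * c j ^ 2 ≤ ∑ i, ∑ k, M i k * c i * c k)
    (hVl : ∀ (c : Fin n → ℝ) (j : Fin n), V j * c j ^ 2 ≤ ∑ i, ∑ k, M i k * c i * c k)
    (Q : (Fin n → ℝ) → ℝ) (hQ : ∀ c, ∑ i, ∑ k, M i k * c i * c k ≤ Q c)
    (q : ℝ) (hq : 0 < q) (qm : Fin n → Fin d → ℝ) (hqm : ∀ j k, 0 ≤ qm j k) (hqs : ∀ j, ∑ k, qm j k = q) :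
    ∏ k : Fin d, ∫⁻ c : Fin n → ℝ, ENNReal.ofReal ((∏ j, |c j| ^ (qm j k)) * Real.exp (-(1 / 2) * Q c)) ≤
      ENNReal.ofReal (((2 * q + 1) * n) ^ (n * q / 2) * ∏ j, (V j) ^ (-(q / 2))) *
        (∏ j, ENNReal.ofReal (Real.sqrt (4 * Real.pi / v j))) ^ d := by
  set R : (Fin n → ℝ) → ℝ := fun c => ∑ i, ∑ k, M i k * c i * c k with hR
  have hR0 : ∀ c, 0 ≤ R c := fun c => by
    have h1 := hVl c ⟨0, hn⟩
    have h2 := hV ⟨0, hn⟩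
    exact le_trans (by positivity) h1
  set s : Fin d → ℝ := fun k => ∑ j, qm j k / 2 with hs
  have hs0 : ∀ k, 0 ≤ s k := fun k => Finset.sum_nonneg fun j _ => by have := hqm j k; positivity
  have hssum : ∑ k, s k = n * q / 2 := by
    simp only [hs]
    rw [Finset.sum_comm]
    simp_rw [← Finset.sum_div, hqs]
    simp;
  have hsle : ∀ k, s k ≤ n * q / 2 := fun k => by
    rw [← hssum]; exact Finset.single_le_sum (fun k _ => hs0 k) (Finset.mem_univ k)
  set A := (2 * q + 1) * n with hA
  have hn' : (1:ℝ) ≤ n := by exact_mod_cast hn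
  have hA1 : 1 ≤ A := by rw [hA]; nlinarith
  have hG := gauss_multi n M hM v hv hvl
  set G := ∏ j, ENNReal.ofReal (Real.sqrt (4 * Real.pi / v j))
  have hk : ∀ k, ∫⁻ c : Fin n → ℝ, ENNReal.ofReal ((∏ j, |c j| ^ (qm j k)) * Real.exp (-(1 / 2) * Q c)) ≤
      ENNReal.ofReal (A ^ (s k) * ∏ j, (V j) ^ (-(qm j k / 2))) * G := by
    intro k
    have hP0 : 0 ≤ ∏ j, (V j) ^ (-(qm j k / 2)) := Finset.prod_nonneg fun j _ => by have := hV j; positivity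
    calc _ ≤ ∫⁻ c : Fin n → ℝ, ENNReal.ofReal (A ^ (s k) * ∏ j, (V j) ^ (-(qm j k / 2))) *
          ENNReal.ofReal (Real.exp (-(1 / 4) * R c)) := by
          refine lintegral_mono fun c => ?_
          rw [← ENNReal.ofReal_mul (by positivity)]
          apply ENNReal.ofReal_le_ofReal
          have h1 : ∏ j, |c j| ^ (qm j k) ≤ R c ^ (s k) * ∏ j, (V j) ^ (-(qm j k / 2)) := by
            rw [hs, Real.rpow_sum_of_nonneg (hR0 c) (fun j _ => by have := hqm j k; positivity), ← Finset.prod_mul_distrib]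
            refine Finset.prod_le_prod (fun j _ => by positivity) fun j _ => ?_
            have hVj := hV j
            have h2 : |c j| ^ 2 ≤ R c * (V j)⁻¹ := by
              rw [sq_abs, ← div_eq_mul_inv, le_div_iff₀ hVj, mul_comm]; exact hVl c j
            calc |c j| ^ (qm j k) = (|c j| ^ 2) ^ (qm j k / 2) := by
                  rw [← Real.rpow_natCast, ← Real.rpow_mul (abs_nonneg _)]; congr 1; push_cast; ring
              _ ≤ (R c * (V j)⁻¹) ^ (qm j k / 2) := by
                  have := hqm j k; gcongr
              _ = _ := by
                  rw [Real.mul_rpow (hR0 c) (by positivity), Real.inv_rpow hVj.le, ← Real.rpow_neg hVj.le]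
          have h2 : Real.exp (-(1 / 2) * Q c) ≤ Real.exp (-(1 / 4) * R c) * Real.exp (-(1 / 4) * R c) := by
            rw [← Real.exp_add]; apply Real.exp_le_exp.2; linarith [hQ c]
          have h3 := rpow_exp_bd (R c) (s k) (hR0 c) (hs0 k)
          have h4 : (4 * s k) ^ (s k) ≤ A ^ (s k) := by
            have := hs0 k
            refine Real.rpow_le_rpow (by positivity) ?_ this
            rw [hA]; nlinarith [hsle k]
          have h5 : 0 ≤ R c ^ (s k) := Real.rpow_nonneg (hR0 c) _
          calc _ ≤ (R c ^ (s k) * ∏ j, (V j) ^ (-(qm j k / 2))) * (Real.exp (-(1 / 4) * R c) * Real.exp (-(1 / 4) * R c)) := by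
                gcongr
            _ = (R c ^ (s k) * Real.exp (-(1 / 4) * R c)) * ((∏ j, (V j) ^ (-(qm j k / 2))) * Real.exp (-(1 / 4) * R c)) := by ring
            _ ≤ A ^ (s k) * ((∏ j, (V j) ^ (-(qm j k / 2))) * Real.exp (-(1 / 4) * R c)) := by
                gcongr; exact h3.trans h4
            _ = _ := by ring
      _ = ENNReal.ofReal (A ^ (s k) * ∏ j, (V j) ^ (-(qm j k / 2))) * ∫⁻ c : Fin n → ℝ, ENNReal.ofReal (Real.exp (-(1 / 4) * R c)) :=
          lintegral_const_mul' _ _ ENNReal.ofReal_ne_top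
      _ ≤ _ := by gcongr
  calc _ ≤ ∏ k : Fin d, (ENNReal.ofReal (A ^ (s k) * ∏ j, (V j) ^ (-(qm j k / 2))) * G) :=
        Finset.prod_le_prod' fun k _ => hk k
    _ = _ := by
      rw [Finset.prod_mul_distrib, Finset.prod_const, Finset.card_univ, Fintype.card_fin,
        ← ENNReal.ofReal_prod_of_nonneg]
      · congr 2
        rw [Finset.prod_mul_distrib, ← Real.rpow_sum_of_pos (by positivity), hssum, Finset.prod_comm]
        congr 1
        refine Finset.prod_congr rfl fun j _ => ?_
        rw [← Real.rpow_sum_of_pos (hV j)]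
        congr 1
        rw [Finset.sum_neg_distrib, ← Finset.sum_div, hqs]
      · intro k _
        have : 0 ≤ ∏ j, (V j) ^ (-(qm j k / 2)) := Finset.prod_nonneg fun j _ => by have := hV j; positivity
        positivity

/-- matrix of the reduced form -/
noncomputable def Mt (N : ℕ) (H β : ℝ) {n : ℕ} (z : Fin n → ℝ × EuclideanSpace ℝ (Fin N)) (i j : Fin n) : ℝ :=
  ∫ ξ, Real.cos (yf ξ (z i) - yf ξ (z j)) * om N H β ξ

lemma Mt_symm (N : ℕ) (H β : ℝ) {n : ℕ} (z : Fin n → ℝ × EuclideanSpace ℝ (Fin N)) (i j : Fin n) :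
    Mt N H β z i j = Mt N H β z j i := by
  unfold Mt
  congr 1; ext ξ
  rw [← Real.cos_neg, neg_sub]

lemma Aw_sq {N n : ℕ} (c : Fin n → ℝ) (z : Fin n → ℝ × EuclideanSpace ℝ (Fin N)) (ξ) :
    ‖Aw c z ξ‖ ^ 2 = ∑ i, ∑ j, Real.cos (yf ξ (z i) - yf ξ (z j)) * c i * c j := by
  rw [← Complex.normSq_eq_norm_sq, Complex.normSq_apply]
  have e : ∀ y : ℝ, -Complex.I * (y:ℂ) = ((-y : ℝ) : ℂ) * Complex.I := by intro y; push_cast; ring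
  have hre : (Aw c z ξ).re = ∑ i, c i * Real.cos (yf ξ (z i)) := by
    simp [Aw, e, Complex.exp_ofReal_mul_I_re, -Complex.ofReal_neg]
  have him : (Aw c z ξ).im = ∑ i, -(c i * Real.sin (yf ξ (z i))) := by
    simp [Aw, e, Complex.exp_ofReal_mul_I_im, -Complex.ofReal_neg]
  rw [hre, him, Finset.sum_mul_sum, Finset.sum_mul_sum, ← Finset.sum_add_distrib]
  refine Finset.sum_congr rfl fun i _ => ?_
  rw [← Finset.sum_add_distrib]
  refine Finset.sum_congr rfl fun j _ => ?_
  rw [Real.cos_sub]; ring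

lemma Qt_quad {N : ℕ} {H β : ℝ} (h : Integrable (om N H β)) {n : ℕ}
    (z : Fin n → ℝ × EuclideanSpace ℝ (Fin N)) (c : Fin n → ℝ) :
    Qt N H β z c = ∑ i, ∑ j, Mt N H β z i j * c i * c j := by
  unfold Qt Mt
  have hi : ∀ i j, Integrable (fun ξ => Real.cos (yf ξ (z i) - yf ξ (z j)) * om N H β ξ) := by
    intro i j
    refine h.bdd_mul (c := 1) ?_ (Filter.Eventually.of_forall fun ξ => ?_)
    · have : Continuous (fun ξ => Real.cos (yf ξ (z i) - yf ξ (z j))) := by unfold yf; fun_prop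
      exact this.aestronglyMeasurable
    · rw [Real.norm_eq_abs]; exact Real.abs_cos_le_one _
  have : ∀ ξ, ‖Aw c z ξ‖ ^ 2 * om N H β ξ = ∑ i, ∑ j, (Real.cos (yf ξ (z i) - yf ξ (z j)) * om N H β ξ) * (c i * c j) := by
    intro ξ
    rw [Aw_sq, Finset.sum_mul]
    refine Finset.sum_congr rfl fun i _ => ?_
    rw [Finset.sum_mul]
    refine Finset.sum_congr rfl fun j _ => by ring
  simp_rw [this]
  rw [integral_finsetSum _ fun i _ => integrable_finsetSum _ fun j _ => (hi i j).mul_const _]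
  refine Finset.sum_congr rfl fun i _ => ?_
  rw [integral_finsetSum _ fun j _ => (hi i j).mul_const _]
  refine Finset.sum_congr rfl fun j _ => ?_
  rw [integral_mul_const]; ring

/-- truncated singular kernel -/
noncomputable def Kn (b : ℝ) (n : ℕ) (r : ℝ) : ℝ≥0∞ :=
  if |r| ≤ 1 / n then (ENNReal.ofReal |r|) ^ (-b) else 0

/-- directional sum of kernels -/
noncomputable def Fn {N : ℕ} (b : ℝ) {n : ℕ} (S : Finset (Fin n))
    (z : Fin n → ℝ × EuclideanSpace ℝ (Fin N)) (x : ℝ × EuclideanSpace ℝ (Fin N))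
    (η : EuclideanSpace ℝ (Fin N)) : ℝ≥0∞ :=
  (n : ℝ≥0∞) ^ b + ∑ i ∈ S, Kn b n (yf η x - yf η (z i))

/-- average of `Fn` -/
noncomputable def Ph {N : ℕ} (b : ℝ) {n : ℕ} (B : Set (EuclideanSpace ℝ (Fin N))) (S : Finset (Fin n))
    (z : Fin n → ℝ × EuclideanSpace ℝ (Fin N)) (x : ℝ × EuclideanSpace ℝ (Fin N)) : ℝ≥0∞ :=
  (volume B)⁻¹ * ∫⁻ η in B, Fn b S z x η

lemma Kn_meas (b : ℝ) (n : ℕ) : Measurable (Kn b n) := by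
  unfold Kn
  refine Measurable.ite (measurableSet_le (by fun_prop) (by fun_prop)) (by fun_prop) (by fun_prop)

lemma yf_cont {N : ℕ} : Continuous (fun p : EuclideanSpace ℝ (Fin N) × (ℝ × EuclideanSpace ℝ (Fin N)) => yf p.1 p.2) := by
  unfold yf; fun_prop

lemma Fn_meas {N : ℕ} (b : ℝ) {n : ℕ} (S : Finset (Fin n)) :
    Measurable (fun p : ((Fin n → ℝ × EuclideanSpace ℝ (Fin N)) × (ℝ × EuclideanSpace ℝ (Fin N))) × EuclideanSpace ℝ (Fin N) =>
      Fn b S p.1.1 p.1.2 p.2) := by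
  unfold Fn
  refine measurable_const.add (Finset.measurable_sum _ fun i _ => ?_)
  refine (Kn_meas b n).comp (Continuous.measurable ?_)
  unfold yf; fun_prop

lemma Ph_meas {N : ℕ} (b : ℝ) {n : ℕ} (B : Set (EuclideanSpace ℝ (Fin N))) (S : Finset (Fin n)) :
    Measurable (fun p : ((Fin n → ℝ × EuclideanSpace ℝ (Fin N)) × (ℝ × EuclideanSpace ℝ (Fin N))) =>
      Ph b B S p.1 p.2) := by
  unfold Ph
  refine measurable_const.mul ?_
  exact (Fn_meas b S).lintegral_prod_right'

lemma Ph_ge {N : ℕ} (b : ℝ) {n : ℕ} (B : Set (EuclideanSpace ℝ (Fin N))) (hB : volume B ≠ 0) (hB' : volume B ≠ ⊤)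
    (S : Finset (Fin n))
    (z : Fin n → ℝ × EuclideanSpace ℝ (Fin N)) (x : ℝ × EuclideanSpace ℝ (Fin N)) :
    (n : ℝ≥0∞) ^ b ≤ Ph b B S z x := by
  unfold Ph
  calc (n : ℝ≥0∞) ^ b = (volume B)⁻¹ * ∫⁻ η in B, (n : ℝ≥0∞) ^ b := by
        rw [setLIntegral_const, mul_left_comm, ENNReal.inv_mul_cancel hB hB', mul_one]
    _ ≤ _ := by
        gcongr with η
        unfold Fn; exact le_self_add

lemma lnd_W {N : ℕ} (b : ℝ) (B : Set (EuclideanSpace ℝ (Fin N))) (hBm : MeasurableSet B) (hB : volume B ≠ 0) (hB' : volume B ≠ ⊤)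
    {n : ℕ} (z : Fin n → ℝ × EuclideanSpace ℝ (Fin N)) (j : Fin n) (S : Finset (Fin n)) (m δ : ℝ) (hmpos : 0 < m)
    (hb : 0 < b)
    (hPh : Ph b B S z (z j) = ENNReal.ofReal m) (hδ0 : 0 < δ) (hδn : δ ≤ 1 / n) (hδb : δ ^ (-b) = 2 * m)
    (W : Set (EuclideanSpace ℝ (Fin N))) (hWm : MeasurableSet W)
    (hW : ∀ η, η ∈ W ↔ η ∈ B ∧ ∀ i ∈ S, δ ≤ |yf η (z i) - yf η (z j)|) :
    volume W ≠ ⊤ ∧ (volume B).toReal / 2 ≤ (volume W).toReal := by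
  have hFnm : Measurable (fun η => Fn b S z (z j) η) :=
    (Fn_meas (N := N) b S).comp (f := fun η => ((z, z j), η)) (by fun_prop)
  have hmark := mul_meas_ge_le_lintegral₀ (μ := volume.restrict B) hFnm.aemeasurable (ENNReal.ofReal (2 * m))
  have hI : ∫⁻ η in B, Fn b S z (z j) η = ENNReal.ofReal m * volume B := by
    rw [← hPh]
    unfold Ph
    rw [mul_comm, ← mul_assoc, ENNReal.mul_inv_cancel hB hB', one_mul]
  rw [hI] at hmark
  have hsub : B \ W ⊆ {η | ENNReal.ofReal (2 * m) ≤ Fn b S z (z j) η} := by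
    intro η hη
    have : ∃ i ∈ S, |yf η (z i) - yf η (z j)| < δ := by
      by_contra hcon; push Not at hcon
      exact hη.2 ((hW η).2 ⟨hη.1, hcon⟩)
    obtain ⟨i, hi, hlt⟩ := this
    rw [abs_sub_comm] at hlt
    show ENNReal.ofReal (2 * m) ≤ Fn b S z (z j) η
    calc ENNReal.ofReal (2 * m) ≤ Kn b n (yf η (z j) - yf η (z i)) := by
          unfold Kn
          rw [if_pos (hlt.le.trans hδn), ← hδb, ← ENNReal.ofReal_rpow_of_pos hδ0, ENNReal.rpow_neg, ENNReal.rpow_neg]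
          gcongr
      _ ≤ ∑ i ∈ S, Kn b n (yf η (z j) - yf η (z i)) :=
          Finset.single_le_sum (f := fun i => Kn b n (yf η (z j) - yf η (z i))) (fun _ _ => zero_le) hi
      _ ≤ _ := by unfold Fn; exact le_add_self
  have hBW : ENNReal.ofReal (2 * m) * volume (B \ W) ≤ ENNReal.ofReal m * volume B := by
    refine le_trans ?_ hmark
    refine mul_le_mul_right ?_ _
    rw [Measure.restrict_apply₀' hBm.nullMeasurableSet]
    exact measure_mono (subset_inter hsub diff_subset)
  have hWB : W ⊆ B := fun η hη => ((hW η).1 hη).1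
  have hWfin : volume W ≠ ⊤ := ((measure_mono hWB).trans_lt hB'.lt_top).ne
  have hsplit : (volume B).toReal = (volume W).toReal + (volume (B \ W)).toReal := by
    have := measure_diff hWB hWm.nullMeasurableSet hWfin
    have h2 := ENNReal.toReal_sub_of_le (measure_mono hWB) hB'
    rw [this, h2]; ring
  have hBWr : 2 * m * (volume (B \ W)).toReal ≤ m * (volume B).toReal := by
    have h2 := ENNReal.toReal_mono (ENNReal.mul_ne_top ENNReal.ofReal_ne_top hB') hBW
    rwa [ENNReal.toReal_mul, ENNReal.toReal_mul, ENNReal.toReal_ofReal (by positivity), ENNReal.toReal_ofReal hmpos.le] at h2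
  refine ⟨hWfin, ?_⟩
  have : 2 * (volume (B \ W)).toReal ≤ (volume B).toReal := by
    refine le_of_mul_le_mul_left ?_ hmpos
    linarith
  linarith

lemma lnd_avg_delta (b : ℝ) (hb : 0 < b) (n : ℕ) (hn : 1 ≤ n) (m : ℝ) (hmge : (n:ℝ) ^ b ≤ m) (α : ℝ) :
    ∃ δ : ℝ, 0 < δ ∧ δ ≤ 1 / n ∧ δ ≤ 1 ∧ δ ^ (-b) = 2 * m ∧
      δ ^ (2 * α) = 2 ^ (-(2 * α / b)) * m ^ (-(2 * α / b)) := by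
  have hnR : (0:ℝ) < n := by exact_mod_cast hn
  have hmpos : 0 < m := lt_of_lt_of_le (by positivity) hmge
  have hδn : (2 * m) ^ (-(1 / b)) ≤ 1 / n := by
    calc (2 * m) ^ (-(1 / b)) ≤ ((n:ℝ) ^ b) ^ (-(1 / b)) :=
          Real.rpow_le_rpow_of_nonpos (by positivity) (by linarith) (by rw [neg_nonpos]; positivity)
      _ = 1 / n := by
          rw [← Real.rpow_mul hnR.le, mul_neg, mul_one_div_cancel hb.ne', Real.rpow_neg_one, one_div]
  refine ⟨(2 * m) ^ (-(1 / b)), by positivity, hδn, hδn.trans (by rw [div_le_one hnR]; exact_mod_cast hn), ?_, ?_⟩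
  · rw [← Real.rpow_mul (by positivity)]
    rw [show -(1 / b) * -b = 1 by field_simp, Real.rpow_one]
  · rw [← Real.rpow_mul (by positivity), Real.mul_rpow (by norm_num) hmpos.le]
    congr 2 <;> ring

lemma lnd_avg (N : ℕ) (hN : 1 ≤ N) (H β : ℝ) (hH1 : 1 / 2 ≤ H) (hH2 : H < 1)
    (hβ0 : 0 < β) (hβN : β < N) (hβlow : (N : ℝ) - 2 * H - 1 < β) (b : ℝ) (hb : 0 < b)
    (B : Set (EuclideanSpace ℝ (Fin N))) (hBm : MeasurableSet B) (hB : volume B ≠ 0) (hB' : volume B ≠ ⊤)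
    (hBn : ∀ η ∈ B, 1 / 2 ≤ ‖η‖ ∧ ‖η‖ ≤ 2) :
    ∃ κ : ℝ, 0 < κ ∧ ∀ (n : ℕ) (z : Fin n → ℝ × EuclideanSpace ℝ (Fin N)) (c : Fin n → ℝ) (j : Fin n)
      (S : Finset (Fin n)), (∀ i, i ≠ j → c i ≠ 0 → i ∈ S) → Ph b B S z (z j) ≠ ⊤ →
      κ * (Ph b B S z (z j)).toReal ^ (-(2 * alphaExp N H β / b)) * c j ^ 2 ≤ Qt N H β z c := by
  obtain ⟨κ, hκ, hl⟩ := lnd N hN H β hH1 hH2 hβ0 hβN hβlow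
  have hVpos : 0 < (volume B).toReal := ENNReal.toReal_pos hB hB'
  refine ⟨κ * 2 ^ (-(2 * alphaExp N H β / b)) * ((volume B).toReal / 2), by positivity, fun n z c j S hS hfin => ?_⟩
  have hn : 1 ≤ n := by have := j.pos; omega
  have hge := Ph_ge b B hB hB' S z (z j)
  obtain ⟨m, hm⟩ : ∃ m, m = (Ph b B S z (z j)).toReal := ⟨_, rfl⟩
  have hPh : Ph b B S z (z j) = ENNReal.ofReal m := by rw [hm, ENNReal.ofReal_toReal hfin]
  have hmge : (n:ℝ) ^ b ≤ m := by
    have h1 := ENNReal.toReal_mono hfin hge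
    rwa [← ENNReal.toReal_rpow, ENNReal.toReal_natCast, ← hm] at h1
  have hmpos : 0 < m := lt_of_lt_of_le (Real.rpow_pos_of_pos (by exact_mod_cast hn) _) hmge
  rw [← hm]
  obtain ⟨δ, hδ0, hδn, hδ1, hδb, h4⟩ := lnd_avg_delta b hb n hn m hmge (alphaExp N H β)
  obtain ⟨W, hW⟩ : ∃ W : Set (EuclideanSpace ℝ (Fin N)), W = B ∩ ⋂ i ∈ S, {η | δ ≤ |yf η (z i) - yf η (z j)|} := ⟨_, rfl⟩
  have hWm : MeasurableSet W := by
    rw [hW]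
    refine hBm.inter (Finset.measurableSet_biInter _ fun i _ => ?_)
    refine measurableSet_le measurable_const (Continuous.measurable ?_)
    unfold yf; fun_prop
  have hWi : ∀ η, η ∈ W ↔ η ∈ B ∧ ∀ i ∈ S, δ ≤ |yf η (z i) - yf η (z j)| := by
    intro η; rw [hW]; simp
  have hWp : ∀ η ∈ W, (1 / 2 ≤ ‖η‖ ∧ ‖η‖ ≤ 2) ∧ ∀ i, i ≠ j → c i ≠ 0 → δ ≤ |yf η (z i) - yf η (z j)| :=
    fun η hη => ⟨hBn η ((hWi η).1 hη).1, fun i hij hc => ((hWi η).1 hη).2 i (hS i hij hc)⟩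
  have h1 := hl n z c j δ hδ0 hδ1 W hWm hWp
  clear hl hge hWp
  obtain ⟨hWfin, hWhalf⟩ := lnd_W b B hBm hB hB' z j S m δ hmpos hb hPh hδ0 hδn hδb W hWm hWi
  have hQ0 : 0 ≤ Qt N H β z c := integral_nonneg fun ξ => mul_nonneg (sq_nonneg _) (om_nonneg N H β ξ)
  generalize Qt N H β z c = Q at *
  generalize alphaExp N H β = α at *
  have h3 : κ * δ ^ (2 * α) * c j ^ 2 * (volume W).toReal ≤ Q := by
    rw [← ENNReal.ofReal_toReal hWfin, ← ENNReal.ofReal_mul (by positivity), ENNReal.ofReal_le_ofReal_iff hQ0] at h1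
    exact h1
  refine le_trans ?_ h3
  rw [h4]
  have h5 : 0 ≤ κ * (2 ^ (-(2 * α / b)) * m ^ (-(2 * α / b))) * c j ^ 2 := by positivity
  have h6 := mul_le_mul_of_nonneg_left hWhalf h5
  refine le_trans (le_of_eq ?_) h6
  ring

/-- matrix of directions -/
noncomputable def Dm {N : ℕ} (η : Fin (N+1) → EuclideanSpace ℝ (Fin N)) : Matrix (Fin (N+1)) (Fin (N+1)) ℝ :=
  fun l => Fin.cons ‖η l‖ (fun i => η l i)

/-- reference directions -/
noncomputable def ctr {N : ℕ} (hN : 1 ≤ N) : Fin (N+1) → EuclideanSpace ℝ (Fin N) :=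
  Fin.cons (-(EuclideanSpace.single (⟨0, hN⟩ : Fin N) (1:ℝ))) (fun i => EuclideanSpace.single i (1:ℝ))

lemma ctr_norm {N : ℕ} (hN : 1 ≤ N) (l) : ‖ctr hN l‖ = 1 := by
  refine Fin.cases ?_ (fun i => ?_) l <;> simp [ctr]

lemma Dm_det {N : ℕ} (hN : 1 ≤ N) : (Dm (ctr hN)).det ≠ 0 := by
  intro h
  obtain ⟨v, hv, hv0⟩ := Matrix.exists_mulVec_eq_zero_iff.mpr h
  apply hv
  have hrow : ∀ l, v 0 + ∑ i, ctr hN l i * v i.succ = 0 := by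
    intro l
    have := congrFun hv0 l
    simp only [Matrix.mulVec, dotProduct, Dm, Fin.sum_univ_succ, Fin.cons_zero, Fin.cons_succ, ctr_norm, one_mul, Pi.zero_apply] at this
    simpa using this
  have h0 := hrow 0
  have hs : ∀ i : Fin N, v 0 + v i.succ = 0 := by
    intro i
    have := hrow i.succ
    simpa [ctr, PiLp.single_apply, Finset.sum_ite_eq] using this
  have h0' : v 0 - v (Fin.succ ⟨0, hN⟩) = 0 := by
    simpa [ctr, PiLp.single_apply, Finset.sum_ite_eq, sub_eq_add_neg] using h0
  have h1 := hs ⟨0, hN⟩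
  have hv00 : v 0 = 0 := by linarith
  funext l
  refine Fin.cases hv00 (fun i => ?_) l
  have := hs i
  simp only [Pi.zero_apply]; linarith

lemma balls_exist {N : ℕ} (hN : 1 ≤ N) : ∃ (B : Fin (N+1) → Set (EuclideanSpace ℝ (Fin N))) (c : ℝ), 0 < c ∧
    (∀ l, MeasurableSet (B l) ∧ volume (B l) ≠ 0 ∧ volume (B l) ≠ ⊤ ∧ ∀ η ∈ B l, 1/2 ≤ ‖η‖ ∧ ‖η‖ ≤ 2) ∧
    ∀ η : Fin (N+1) → EuclideanSpace ℝ (Fin N), (∀ l, η l ∈ B l) → c ≤ |(Dm η).det| := by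
  have hc : Continuous (fun η : Fin (N+1) → EuclideanSpace ℝ (Fin N) => |(Dm η).det|) := by
    refine continuous_abs.comp (Continuous.matrix_det ?_)
    refine continuous_matrix fun l i => ?_
    refine Fin.cases ?_ (fun i => ?_) i
    · simp only [Dm, Fin.cons_zero]; fun_prop
    · simp only [Dm, Fin.cons_succ]; fun_prop
  set c := |(Dm (ctr hN)).det| / 2 with hcdef
  have hpos : 0 < |(Dm (ctr hN)).det| := abs_pos.mpr (Dm_det hN)
  have hn : {η : Fin (N+1) → EuclideanSpace ℝ (Fin N) | c < |(Dm η).det|} ∈ nhds (ctr hN) :=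
    (isOpen_lt continuous_const hc).mem_nhds (by simp only [mem_setOf_eq]; linarith)
  obtain ⟨ε, hε, hball⟩ := Metric.mem_nhds_iff.mp hn
  have hr : 0 < min ε (1/2) := by positivity
  refine ⟨fun l => Metric.ball (ctr hN l) (min ε (1/2)), c, by positivity, fun l => ⟨measurableSet_ball, ?_, ?_, ?_⟩, ?_⟩
  · exact (Metric.measure_ball_pos volume _ hr).ne'
  · exact measure_ball_lt_top.ne
  · intro η hη
    have h1 : ‖η - ctr hN l‖ < 1/2 := by
      rw [← dist_eq_norm]; exact lt_of_lt_of_le hη (min_le_right _ _)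
    have h2 := abs_norm_sub_norm_le η (ctr hN l)
    rw [ctr_norm] at h2
    have := abs_le.mp (h2.trans h1.le)
    constructor <;> linarith
  · intro η hη
    refine le_of_lt (hball ?_)
    rw [Metric.mem_ball, dist_pi_lt_iff hε]
    exact fun l => lt_of_lt_of_le (hη l) (min_le_left _ _)

lemma lint_pi_prod {X : Type*} [MeasurableSpace X] (m : ℕ) (μ : Fin m → Measure X) [∀ l, SigmaFinite (μ l)]
    (f : Fin m → X → ℝ≥0∞) (hf : ∀ l, Measurable (f l)) :
    ∫⁻ y, ∏ l, f l (y l) ∂(Measure.pi μ) = ∏ l, ∫⁻ x, f l x ∂(μ l) := by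
  induction m with
  | zero => simp
  | succ m ih =>
    rw [← (measurePreserving_piFinSuccAbove μ 0).symm.lintegral_comp_emb (MeasurableEquiv.measurableEmbedding _)]
    have : ∀ p : X × (Fin m → X), (MeasurableEquiv.piFinSuccAbove (fun _ : Fin (m+1) => X) 0).symm p = Fin.cons p.1 p.2 := by
      intro p; simp [MeasurableEquiv.piFinSuccAbove, Fin.insertNthEquiv]
    simp only [this, Fin.prod_univ_succ, Fin.cons_zero, Fin.cons_succ]
    have h2 := lintegral_prod_mul (μ := μ 0) (ν := Measure.pi (fun j => μ ((0 : Fin (m+1)).succAbove j))) (f := f 0)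
      (g := fun y : Fin m → X => ∏ l, f l.succ (y l)) (hf 0).aemeasurable
      (Finset.measurable_prod _ fun l _ => (hf l.succ).comp (measurable_pi_apply l)).aemeasurable
    rw [h2]
    congr 1
    exact ih (fun j => μ j.succ) (fun l => f l.succ) (fun l => hf _)

lemma Kn_int (b : ℝ) (hb0 : 0 < b) (hb1 : b < 1) (n : ℕ) (hn : 1 ≤ n) (s : ℝ) :
    ∫⁻ y, Kn b n (y - s) ≤ ENNReal.ofReal (2 / (1 - b) * (n:ℝ) ^ (b - 1)) := by
  rw [lintegral_sub_right_eq_self (fun y => Kn b n y) s]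
  have hnR : (0:ℝ) < n := by exact_mod_cast hn
  have hA : (0:ℝ) < 1 / n := by positivity
  have hpos : ∫⁻ y in Ioi 0, Kn b n y = ENNReal.ofReal (1 / (1 - b) * (n:ℝ) ^ (b - 1)) := by
    have h1 : ∫⁻ y in Ioi 0, Kn b n y = ∫⁻ y in Ioc 0 (1 / (n:ℝ)), ENNReal.ofReal (y ^ (-b)) := by
      rw [← lintegral_indicator measurableSet_Ioi, ← lintegral_indicator measurableSet_Ioc]
      congr 1; funext y
      by_cases hy : 0 < y
      · by_cases hy2 : y ≤ 1 / n
        · rw [indicator_of_mem (show y ∈ Ioi 0 from hy), indicator_of_mem (show y ∈ Ioc 0 (1/(n:ℝ)) from ⟨hy, hy2⟩), Kn, abs_of_pos hy, if_pos hy2,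
            ENNReal.ofReal_rpow_of_pos hy]
        · rw [indicator_of_mem (show y ∈ Ioi 0 from hy), indicator_of_notMem (fun h => hy2 h.2), Kn, abs_of_pos hy, if_neg hy2]
      · rw [indicator_of_notMem (show y ∉ Ioi 0 from hy), indicator_of_notMem (fun h => hy h.1)]
    rw [h1]
    have hIntg : IntervalIntegrable (fun y : ℝ => y ^ (-b)) volume 0 (1 / n) :=
      intervalIntegral.intervalIntegrable_rpow' (by linarith)
    rw [intervalIntegrable_iff_integrableOn_Ioc_of_le hA.le] at hIntg
    rw [← ofReal_integral_eq_lintegral_ofReal hIntg]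
    · rw [← intervalIntegral.integral_of_le hA.le, integral_rpow (Or.inl (by linarith))]
      congr 1
      rw [Real.zero_rpow (by linarith), one_div, Real.inv_rpow hnR.le, ← Real.rpow_neg hnR.le, sub_zero,
        show -(-b+1) = b - 1 by ring, show -b + 1 = 1 - b by ring]
      ring
    · filter_upwards [self_mem_ae_restrict measurableSet_Ioc] with y hy
      have := hy.1
      exact Real.rpow_nonneg this.le _
  have hneg : ∫⁻ y in Iio 0, Kn b n y = ∫⁻ y in Ioi 0, Kn b n y := by
    rw [← lintegral_indicator measurableSet_Ioi, ← lintegral_indicator measurableSet_Iio]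
    rw [← lintegral_neg_eq_self]
    congr 1; funext y
    by_cases hy : 0 < y
    · rw [indicator_of_mem (show y ∈ Ioi 0 from hy), indicator_of_mem (show -y ∈ Iio 0 by simpa using hy)]
      simp [Kn]
    · rw [indicator_of_notMem (show y ∉ Ioi 0 from hy), indicator_of_notMem (show -y ∉ Iio 0 by simpa using hy)]
  have hsplit : ∫⁻ y, Kn b n y = (∫⁻ y in Ioi 0, Kn b n y) + ∫⁻ y in Iio 0, Kn b n y := by
    rw [← lintegral_add_compl _ (measurableSet_Ioi (a := (0:ℝ)))]
    congr 1
    rw [compl_Ioi]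
    exact (setLIntegral_congr Iio_ae_eq_Iic).symm
  rw [hsplit, hneg, hpos, ← ENNReal.ofReal_add]
  · apply le_of_eq; congr 1; ring
  all_goals
    have : 0 < 1 - b := by linarith
    positivity

lemma ff_int (b : ℝ) (hb0 : 0 < b) (hb1 : b < 1) (R : ℝ) (hR : 0 ≤ R) (n : ℕ) (hn : 1 ≤ n) (S : Finset (Fin n)) (y0 : Fin n → ℝ) :
    ∫⁻ y in Icc (-R) R, ((n : ℝ≥0∞) ^ b + ∑ i ∈ S, Kn b n (y - y0 i)) ≤
      ENNReal.ofReal ((2 * R + 2 / (1 - b)) * (n:ℝ) ^ b) := by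
  have hnR : (0:ℝ) < n := by exact_mod_cast hn
  have hb' : 0 < 1 - b := by linarith
  rw [lintegral_add_left measurable_const, lintegral_finsetSum]
  · rw [setLIntegral_const, Real.volume_Icc]
    have h1 : ∑ i ∈ S, ∫⁻ y in Icc (-R) R, Kn b n (y - y0 i) ≤ ∑ i : Fin n, ENNReal.ofReal (2 / (1 - b) * (n:ℝ) ^ (b - 1)) := by
      refine (Finset.sum_le_sum fun i _ => (setLIntegral_le_lintegral _ _).trans (Kn_int b hb0 hb1 n hn _)).trans ?_
      exact Finset.sum_le_sum_of_subset (Finset.subset_univ _)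
    refine (add_le_add_right h1 _).trans ?_
    rw [Finset.sum_const, Finset.card_univ, Fintype.card_fin, nsmul_eq_mul]
    rw [← ENNReal.ofReal_natCast, ENNReal.ofReal_rpow_of_pos hnR, ← ENNReal.ofReal_mul (by positivity),
      ← ENNReal.ofReal_mul (by positivity), ← ENNReal.ofReal_add (by have : 0 ≤ R - -R := by linarith
                                                                     positivity) (by positivity)]
    apply ENNReal.ofReal_le_ofReal
    rw [Real.rpow_sub_one hnR.ne']
    apply le_of_eq
    field_simp
    try ring
  · intro i _
    exact (Kn_meas b n).comp (by fun_prop)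

lemma yf_Dm {N : ℕ} (η : Fin (N+1) → EuclideanSpace ℝ (Fin N)) (x : ℝ × EuclideanSpace ℝ (Fin N)) (l) :
    yf (η l) x = (Matrix.toLin' (Dm η)) (Fin.cons x.1 (fun i => x.2 i)) l := by
  simp only [Matrix.toLin'_apply, Matrix.mulVec, dotProduct, Fin.sum_univ_succ, Dm, Fin.cons_zero, Fin.cons_succ, yf]
  rw [mul_comm]
  congr 1

lemma psi_mp (N : ℕ) : MeasurePreserving (fun x : ℝ × EuclideanSpace ℝ (Fin N) => (Fin.cons x.1 (fun i => x.2 i) : Fin (N+1) → ℝ)) := by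
  have h1 := (volume_preserving_piFinSuccAbove (fun _ : Fin (N+1) => ℝ) 0).symm
  have h2 := (MeasurePreserving.id (volume : Measure ℝ)).prod (PiLp.volume_preserving_ofLp (Fin N))
  have h3 := h1.comp h2
  convert! h3 using 1
  funext x
  simp [MeasurableEquiv.piFinSuccAbove, Fin.insertNthEquiv]

lemma cov (N : ℕ) (η : Fin (N+1) → EuclideanSpace ℝ (Fin N)) (c : ℝ) (hc : 0 < c) (hdet : c ≤ |(Dm η).det|)
    (g : Fin (N+1) → ℝ → ℝ≥0∞) (hg : ∀ l, Measurable (g l)) :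
    ∫⁻ x, ∏ l, g l (yf (η l) x) ≤ ENNReal.ofReal c⁻¹ * ∏ l, ∫⁻ y, g l y := by
  have hd : (Dm η).det ≠ 0 := by
    intro h; rw [h, abs_zero] at hdet; linarith
  have hG : Measurable (fun w : Fin (N+1) → ℝ => ∏ l, g l (w l)) :=
    Finset.measurable_prod _ fun l _ => (hg l).comp (measurable_pi_apply l)
  have hL : Measurable (Matrix.toLin' (Dm η)) := (LinearMap.continuous_of_finiteDimensional _).measurable
  simp only [yf_Dm]
  rw [(psi_mp N).lintegral_comp (f := fun w => ∏ l, g l ((Matrix.toLin' (Dm η)) w l)) (hG.comp hL)]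
  rw [← lintegral_map hG hL, Real.map_matrix_volume_pi_eq_smul_volume_pi hd, lintegral_smul_measure, volume_pi,
    lint_pi_prod _ _ _ hg, smul_eq_mul]
  refine mul_le_mul_left ?_ _
  apply ENNReal.ofReal_le_ofReal
  rw [abs_inv]
  exact inv_anti₀ hc hdet

lemma Ph_prod_int (N : ℕ) (b : ℝ) (hb0 : 0 < b) (hb1 : b < 1) (R : ℝ) (hR : 0 ≤ R) (c : ℝ) (hc : 0 < c)
    (B : Fin (N+1) → Set (EuclideanSpace ℝ (Fin N)))
    (hB : ∀ l, MeasurableSet (B l) ∧ volume (B l) ≠ 0 ∧ volume (B l) ≠ ⊤ ∧ ∀ η ∈ B l, 1/2 ≤ ‖η‖ ∧ ‖η‖ ≤ 2)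
    (hdet : ∀ η : Fin (N+1) → EuclideanSpace ℝ (Fin N), (∀ l, η l ∈ B l) → c ≤ |(Dm η).det|)
    (I : Set (ℝ × EuclideanSpace ℝ (Fin N))) (hIm : MeasurableSet I)
    (hI : ∀ x ∈ I, ∀ l, ∀ η ∈ B l, |yf η x| ≤ R)
    (n : ℕ) (hn : 1 ≤ n) (S : Finset (Fin n)) (z : Fin n → ℝ × EuclideanSpace ℝ (Fin N)) :
    ∫⁻ x in I, ∏ l, Ph b (B l) S z x ≤
      ENNReal.ofReal (c⁻¹ * ((2 * R + 2 / (1 - b)) * (n:ℝ) ^ b) ^ (N+1)) := by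
  have hb' : 0 < 1 - b := by linarith
  have hF : ∀ x, Measurable (fun η => Fn b S z x η) := fun x =>
    (Fn_meas (N := N) b S).comp (f := fun η => ((z, x), η)) (by fun_prop)
  have h1 : ∀ x, ∏ l, Ph b (B l) S z x = (∏ l, (volume (B l))⁻¹) *
      ∫⁻ η in univ.pi B, ∏ l, Fn b S z x (η l) := by
    intro x
    unfold Ph
    rw [Finset.prod_mul_distrib]
    congr 1
    rw [volume_pi, Measure.restrict_pi_pi, lint_pi_prod _ _ _ (fun l => hF x)]
  simp only [h1]
  have hFm : Measurable (fun p : (ℝ × EuclideanSpace ℝ (Fin N)) × (Fin (N+1) → EuclideanSpace ℝ (Fin N)) =>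
      ∏ l, Fn b S z p.1 (p.2 l)) := by
    refine Finset.measurable_prod _ fun l _ => ?_
    exact (Fn_meas (N := N) b S).comp (f := fun p : (ℝ × EuclideanSpace ℝ (Fin N)) × (Fin (N+1) → EuclideanSpace ℝ (Fin N)) => ((z, p.1), p.2 l)) (by fun_prop)
  rw [lintegral_const_mul _ hFm.lintegral_prod_right']
  rw [lintegral_lintegral_swap hFm.aemeasurable]
  have hK : ∀ η ∈ univ.pi B, ∫⁻ x in I, ∏ l, Fn b S z x (η l) ≤
      ENNReal.ofReal (c⁻¹ * ((2 * R + 2 / (1 - b)) * (n:ℝ) ^ b) ^ (N+1)) := by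
    intro η hη
    have hη' : ∀ l, η l ∈ B l := fun l => hη l (mem_univ _)
    set g : Fin (N+1) → ℝ → ℝ≥0∞ := fun l => (Icc (-R) R).indicator
      (fun y => (n : ℝ≥0∞) ^ b + ∑ i ∈ S, Kn b n (y - yf (η l) (z i))) with hgdef
    have hg : ∀ l, Measurable (g l) := fun l => by
      refine Measurable.indicator ?_ measurableSet_Icc
      refine measurable_const.add (Finset.measurable_sum _ fun i _ => ?_)
      exact (Kn_meas b n).comp (by fun_prop)
    calc ∫⁻ x in I, ∏ l, Fn b S z x (η l) = ∫⁻ x in I, ∏ l, g l (yf (η l) x) := by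
          refine setLIntegral_congr_fun hIm fun x hx => ?_
          refine Finset.prod_congr rfl fun l _ => ?_
          rw [hgdef]
          simp only
          rw [indicator_of_mem (show yf (η l) x ∈ Icc (-R) R from abs_le.mp (hI x hx l _ (hη' l)))]
          rfl
      _ ≤ ∫⁻ x, ∏ l, g l (yf (η l) x) := setLIntegral_le_lintegral _ _
      _ ≤ ENNReal.ofReal c⁻¹ * ∏ l, ∫⁻ y, g l y := cov N η c hc (hdet η hη') g hg
      _ ≤ ENNReal.ofReal c⁻¹ * ∏ l : Fin (N+1), ENNReal.ofReal ((2 * R + 2 / (1 - b)) * (n:ℝ) ^ b) := by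
          gcongr with l
          rw [hgdef]
          simp only
          rw [lintegral_indicator measurableSet_Icc]
          exact ff_int b hb0 hb1 R hR n hn S _
      _ = _ := by
          rw [Finset.prod_const, Finset.card_univ, Fintype.card_fin, ← ENNReal.ofReal_pow (by positivity),
            ← ENNReal.ofReal_mul (by positivity)]
  have hpim : MeasurableSet (univ.pi B) := MeasurableSet.univ_pi fun l => (hB l).1
  refine (mul_le_mul_right (setLIntegral_mono' hpim hK) _).trans ?_
  rw [setLIntegral_const, volume_pi, Measure.pi_pi, mul_left_comm, ← Finset.prod_mul_distrib]
  rw [Finset.prod_congr rfl (fun l _ => ENNReal.inv_mul_cancel (hB l).2.1 (hB l).2.2.1)]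
  simp

/-- iterated integration where `f j` depends on `z i`, `i ≤ j` -/
lemma iter_low {X : Type*} [MeasurableSpace X] (μ : Measure X) [SigmaFinite μ] (C : ℝ≥0∞) (n : ℕ)
    (f : Fin n → (Fin n → X) → ℝ≥0∞) (hf : ∀ j, Measurable (f j))
    (hdep : ∀ j z z', (∀ i, i ≤ j → z i = z' i) → f j z = f j z')
    (hC : ∀ j z, ∫⁻ x, f j (Function.update z j x) ∂μ ≤ C) :
    ∫⁻ z, ∏ j, f j z ∂(Measure.pi fun _ => μ) ≤ C ^ n := by
  induction n with
  | zero => simp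
  | succ n ih =>
    by_cases hX : IsEmpty X
    · have : IsEmpty (Fin (n+1) → X) := ⟨fun z => hX.false (z 0)⟩
      simp
    rw [not_isEmpty_iff] at hX
    obtain ⟨x0⟩ := hX
    rw [← (measurePreserving_piFinSuccAbove (fun _ : Fin (n+1) => μ) (Fin.last n)).symm.lintegral_comp_emb (MeasurableEquiv.measurableEmbedding _)]
    have he : ∀ p : X × (Fin n → X), (MeasurableEquiv.piFinSuccAbove (fun _ : Fin (n+1) => X) (Fin.last n)).symm p = Fin.snoc (α := fun _ => X) p.2 p.1 := by
      intro p; simp [MeasurableEquiv.piFinSuccAbove, Fin.insertNthEquiv]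
    have hm : Measurable (fun p : X × (Fin n → X) => (Fin.snoc (α := fun _ => X) p.2 p.1 : Fin (n+1) → X)) := by
      have := (MeasurableEquiv.piFinSuccAbove (fun _ : Fin (n+1) => X) (Fin.last n)).symm.measurable
      convert this using 1
      funext p; exact (he p).symm
    simp only [he, Fin.prod_univ_castSucc]
    set F : Fin n → (Fin n → X) → ℝ≥0∞ := fun j y => f j.castSucc (Fin.snoc (α := fun _ => X) y x0) with hF
    have hFm : ∀ j, Measurable (F j) := fun j => (hf _).comp (hm.comp (f := fun y => (x0, y)) (by fun_prop))
    have hFe : ∀ j y x, f j.castSucc (Fin.snoc (α := fun _ => X) y x) = F j y := by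
      intro j y x
      refine hdep _ _ _ fun i hi => ?_
      have hlt : i < Fin.last n := lt_of_le_of_lt hi (Fin.castSucc_lt_last j)
      obtain ⟨k, rfl⟩ : ∃ k : Fin n, i = k.castSucc := ⟨i.castPred hlt.ne, by simp⟩
      simp
    simp only [hFe]
    have hG : Measurable (fun p : X × (Fin n → X) => (∏ j, F j p.2) * f (Fin.last n) (Fin.snoc (α := fun _ => X) p.2 p.1)) :=
      (Finset.measurable_prod _ fun j _ => (hFm j).comp measurable_snd).mul ((hf _).comp hm)
    have h1 := lintegral_prod_symm' (μ := μ) (ν := Measure.pi (fun _ : Fin n => μ)) _ hG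
    refine (le_of_eq h1).trans ?_
    have h2 : ∀ y : Fin n → X, ∫⁻ x, (∏ j, F j y) * f (Fin.last n) (Fin.snoc (α := fun _ => X) y x) ∂μ ≤ (∏ j, F j y) * C := by
      intro y
      have hmy : Measurable (fun x => f (Fin.last n) (Fin.snoc (α := fun _ => X) y x)) :=
        (hf _).comp (hm.comp (f := fun x => (x, y)) (by fun_prop))
      rw [lintegral_const_mul _ hmy]
      refine mul_le_mul_right ?_ _
      have := hC (Fin.last n) (Fin.snoc (α := fun _ => X) y x0)
      simpa [Fin.update_snoc_last] using this
    refine (lintegral_mono h2).trans ?_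
    rw [lintegral_mul_const _ (Finset.measurable_prod _ fun j _ => hFm j), pow_succ]
    refine mul_le_mul_left ?_ _
    refine ih F hFm ?_ ?_
    · intro j y y' h
      refine hdep _ _ _ fun i hi => ?_
      have hlt : i < Fin.last n := lt_of_le_of_lt hi (Fin.castSucc_lt_last j)
      obtain ⟨k, rfl⟩ : ∃ k : Fin n, i = k.castSucc := ⟨i.castPred hlt.ne, by simp⟩
      simp only [Fin.snoc_castSucc]
      exact h k (by simpa using hi)
    · intro j y
      have := hC j.castSucc (Fin.snoc (α := fun _ => X) y x0)
      simpa [hF, Fin.snoc_update] using this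

/-- iterated integration where `f j` depends on `z i`, `j ≤ i` -/
lemma iter_high {X : Type*} [MeasurableSpace X] (μ : Measure X) [SigmaFinite μ] (C : ℝ≥0∞) (n : ℕ)
    (f : Fin n → (Fin n → X) → ℝ≥0∞) (hf : ∀ j, Measurable (f j))
    (hdep : ∀ j z z', (∀ i, j ≤ i → z i = z' i) → f j z = f j z')
    (hC : ∀ j z, ∫⁻ x, f j (Function.update z j x) ∂μ ≤ C) :
    ∫⁻ z, ∏ j, f j z ∂(Measure.pi fun _ => μ) ≤ C ^ n := by
  have hmp := measurePreserving_piCongrLeft (fun _ : Fin n => μ) (Fin.revPerm (n := n))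
  rw [← hmp.lintegral_comp_emb (MeasurableEquiv.measurableEmbedding _)]
  have he : ∀ y : Fin n → X, MeasurableEquiv.piCongrLeft (fun _ => X) (Fin.revPerm (n := n)) y = fun i => y i.rev := by
    intro y; funext i
    have := MeasurableEquiv.piCongrLeft_apply_apply (β := fun _ => X) (e := Fin.revPerm (n := n)) y i.rev
    simpa using this
  simp only [he]
  have h1 : ∀ y : Fin n → X, ∏ j, f j (fun i => y i.rev) = ∏ j : Fin n, f j.rev (fun i => y i.rev) := fun y =>
    (Equiv.prod_comp (Fin.revPerm (n := n)) (fun j => f j (fun i => y i.rev))).symm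
  simp only [h1]
  refine iter_low μ C n (fun j y => f j.rev (fun i => y i.rev)) (fun j => (hf _).comp (by fun_prop)) ?_ ?_
  · intro j z z' h
    refine hdep _ _ _ fun i hi => h _ (by rw [← Fin.rev_rev j]; exact Fin.rev_le_rev.mpr hi)
  · intro j z
    have := hC j.rev (fun i => z i.rev)
    convert this using 4 with x
    funext i
    by_cases h : i = j.rev
    · subst h; simp
    · rw [Function.update_of_ne h, Function.update_of_ne (fun h' => h (by rw [← h', Fin.rev_rev]))]

/-- product over directions -/
noncomputable def PP {N : ℕ} (b : ℝ) {n : ℕ} (B : Fin (N+1) → Set (EuclideanSpace ℝ (Fin N))) (S : Finset (Fin n))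
    (z : Fin n → ℝ × EuclideanSpace ℝ (Fin N)) (x : ℝ × EuclideanSpace ℝ (Fin N)) : ℝ≥0∞ :=
  ∏ l, Ph b (B l) S z x

lemma prod_comp_le {ι : Type*} [Fintype ι] (f : ι → ℝ≥0∞) (hf : ∀ i, 1 ≤ f i) (i : ι) : f i ≤ ∏ i, f i :=
  Finset.single_le_prod' (fun i _ => hf i) (Finset.mem_univ i)

lemma Ph_one {N : ℕ} (b : ℝ) (hb : 0 < b) {n : ℕ} (hn : 1 ≤ n) (B : Set (EuclideanSpace ℝ (Fin N))) (hB : volume B ≠ 0) (hB' : volume B ≠ ⊤)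
    (S : Finset (Fin n)) (z : Fin n → ℝ × EuclideanSpace ℝ (Fin N)) (x : ℝ × EuclideanSpace ℝ (Fin N)) :
    1 ≤ Ph b B S z x :=
  le_trans (ENNReal.one_le_rpow (by exact_mod_cast hn) hb) (Ph_ge b B hB hB' S z x)

lemma PP_one {N : ℕ} (b : ℝ) (hb : 0 < b) {n : ℕ} (hn : 1 ≤ n) (B : Fin (N+1) → Set (EuclideanSpace ℝ (Fin N)))
    (hB : ∀ l, MeasurableSet (B l) ∧ volume (B l) ≠ 0 ∧ volume (B l) ≠ ⊤ ∧ ∀ η ∈ B l, 1/2 ≤ ‖η‖ ∧ ‖η‖ ≤ 2)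
    (S : Finset (Fin n)) (z : Fin n → ℝ × EuclideanSpace ℝ (Fin N)) (x : ℝ × EuclideanSpace ℝ (Fin N)) :
    1 ≤ PP b B S z x :=
  Finset.one_le_prod' fun l _ => Ph_one b hb hn (B l) (hB l).2.1 (hB l).2.2.1 S z x

lemma lnd_prod (N : ℕ) (hN : 1 ≤ N) (H β : ℝ) (hH1 : 1 / 2 ≤ H) (hH2 : H < 1)
    (hβ0 : 0 < β) (hβN : β < N) (hβlow : (N : ℝ) - 2 * H - 1 < β) (b : ℝ) (hb : 0 < b)
    (B : Fin (N+1) → Set (EuclideanSpace ℝ (Fin N)))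
    (hB : ∀ l, MeasurableSet (B l) ∧ volume (B l) ≠ 0 ∧ volume (B l) ≠ ⊤ ∧ ∀ η ∈ B l, 1/2 ≤ ‖η‖ ∧ ‖η‖ ≤ 2) :
    ∃ κ : ℝ, 0 < κ ∧ ∀ (n : ℕ) (z : Fin n → ℝ × EuclideanSpace ℝ (Fin N)) (c : Fin n → ℝ) (j : Fin n)
      (S : Finset (Fin n)), (∀ i, i ≠ j → c i ≠ 0 → i ∈ S) → PP b B S z (z j) ≠ ⊤ →
      κ * (PP b B S z (z j)).toReal ^ (-(2 * alphaExp N H β / (b * (N + 1)))) * c j ^ 2 ≤ Qt N H β z c := by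
  choose κ hκ hl using fun l => lnd_avg N hN H β hH1 hH2 hβ0 hβN hβlow b hb (B l) (hB l).1 (hB l).2.1 (hB l).2.2.1 (hB l).2.2.2
  have hα : 0 < alphaExp N H β := by unfold alphaExp; linarith
  obtain ⟨l₀, -, hl₀⟩ := Finset.exists_min_image Finset.univ κ ⟨0, Finset.mem_univ _⟩
  refine ⟨κ l₀, hκ l₀, fun n z c j S hS hfin => ?_⟩
  have hn : 1 ≤ n := by have := j.pos; omega
  have h1 : ∀ l, 1 ≤ Ph b (B l) S z (z j) := fun l => Ph_one b hb hn (B l) (hB l).2.1 (hB l).2.2.1 S z (z j)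
  have hfl : ∀ l, Ph b (B l) S z (z j) ≠ ⊤ := fun l h => hfin (top_le_iff.mp (h ▸ prod_comp_le (fun l => Ph b (B l) S z (z j)) h1 l))
  obtain ⟨l, -, hmin⟩ := Finset.exists_min_image Finset.univ (fun l => Ph b (B l) S z (z j)) ⟨0, Finset.mem_univ _⟩
  have h2 := hl l n z c j S hS (hfl l)
  have h3 : (Ph b (B l) S z (z j)) ^ (N+1) ≤ PP b B S z (z j) := by
    unfold PP
    calc _ = ∏ _l' : Fin (N+1), Ph b (B l) S z (z j) := by simp
      _ ≤ _ := Finset.prod_le_prod' fun l' hl' => hmin l' hl'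
  have h4 := ENNReal.toReal_mono hfin h3
  rw [ENNReal.toReal_pow] at h4
  have h5 : 1 ≤ (Ph b (B l) S z (z j)).toReal := by
    have := ENNReal.toReal_mono (hfl l) (h1 l); simpa using this
  refine le_trans ?_ h2
  generalize (Ph b (B l) S z (z j)).toReal = p at *
  generalize (PP b B S z (z j)).toReal = P at *
  have h6 : P ^ (-(2 * alphaExp N H β / (b * (N + 1)))) ≤ p ^ (-(2 * alphaExp N H β / b)) := by
    calc P ^ (-(2 * alphaExp N H β / (b * (N + 1)))) ≤ (p ^ (N+1)) ^ (-(2 * alphaExp N H β / (b * (N + 1)))) :=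
          Real.rpow_le_rpow_of_nonpos (by positivity) h4 (by rw [neg_nonpos]; positivity)
      _ = _ := by
          rw [← Real.rpow_natCast, ← Real.rpow_mul (by positivity)]
          congr 1; push_cast; field_simp
  have h7 : κ l₀ ≤ κ l := hl₀ l (Finset.mem_univ _)
  have h8 := (hκ l₀).le
  have h9 := (hκ l).le
  have h10 : 0 ≤ P := le_trans (by positivity) h4
  gcongr

lemma PP_all {N : ℕ} (b : ℝ) (hb : 0 < b) {n : ℕ} (B : Fin (N+1) → Set (EuclideanSpace ℝ (Fin N)))
    (hB : ∀ l, MeasurableSet (B l) ∧ volume (B l) ≠ 0 ∧ volume (B l) ≠ ⊤ ∧ ∀ η ∈ B l, 1/2 ≤ ‖η‖ ∧ ‖η‖ ≤ 2)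
    (j : Fin n) (z : Fin n → ℝ × EuclideanSpace ℝ (Fin N)) (x : ℝ × EuclideanSpace ℝ (Fin N)) :
    PP b B (Finset.univ.erase j) z x ≤ 2 ^ (N+1) * (PP b B (Finset.Iio j) z x * PP b B (Finset.Ioi j) z x) := by
  have hn : 1 ≤ n := by have := j.pos; omega
  unfold PP
  rw [← Finset.prod_mul_distrib]
  calc _ ≤ ∏ l, 2 * (Ph b (B l) (Finset.Iio j) z x * Ph b (B l) (Finset.Ioi j) z x) := by
        refine Finset.prod_le_prod' fun l _ => ?_
        have hlo := Ph_one b hb hn (B l) (hB l).2.1 (hB l).2.2.1 (Finset.Iio j) z x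
        have hhi := Ph_one b hb hn (B l) (hB l).2.1 (hB l).2.2.1 (Finset.Ioi j) z x
        have hadd : Ph b (B l) (Finset.univ.erase j) z x ≤ Ph b (B l) (Finset.Iio j) z x + Ph b (B l) (Finset.Ioi j) z x := by
          unfold Ph
          have hFm : Measurable (fun η => Fn b (Finset.Iio j) z x η) :=
            (Fn_meas (N := N) b (Finset.Iio j)).comp (f := fun η => ((z, x), η)) (by fun_prop)
          rw [← mul_add, ← lintegral_add_left hFm]
          refine mul_le_mul_right (lintegral_mono fun η => ?_) _
          unfold Fn
          have hS : Finset.univ.erase j = Finset.Iio j ∪ Finset.Ioi j := by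
            ext i; simp
          have hd : Disjoint (Finset.Iio j) (Finset.Ioi j) := by
            rw [Finset.disjoint_left]; intro i h1 h2
            simp at h1 h2; exact absurd h1 (not_lt.mpr h2.le)
          rw [hS, Finset.sum_union hd]
          rw [show ∀ a s t : ℝ≥0∞, a + s + (a + t) = a + (s + t) + a by intro a s t; ring]
          exact le_self_add
        refine hadd.trans ?_
        rw [two_mul]
        exact add_le_add (le_mul_of_one_le_right' hhi) (le_mul_of_one_le_left' hlo)
    _ = _ := by
        rw [Finset.prod_mul_distrib]; simp

lemma XY_bound (X Y s t : ℝ) (hX : 1 ≤ X) (hY : 1 ≤ Y) (hs : 0 ≤ s) (ht : 0 ≤ t) :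
    X ^ s * Y ^ t ≤ X ^ (s + t) + Y ^ (s + t) := by
  have hX0 : 0 < X := by linarith
  have hY0 : 0 < Y := by linarith
  rcases le_total X Y with h | h
  · have : X ^ s ≤ Y ^ s := Real.rpow_le_rpow hX0.le h hs
    rw [Real.rpow_add hY0]
    have h2 : 0 ≤ X ^ (s + t) := by positivity
    have h3 : X ^ s * Y ^ t ≤ Y ^ s * Y ^ t := by gcongr
    linarith
  · have : Y ^ t ≤ X ^ t := Real.rpow_le_rpow hY0.le h ht
    rw [Real.rpow_add hX0]
    have h2 : 0 ≤ Y ^ (s + t) := by positivity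
    have h3 : X ^ s * Y ^ t ≤ X ^ s * X ^ t := by gcongr
    linarith

lemma real_bound (n d : ℕ) (hn : 1 ≤ n) (κ e q D : ℝ) (hκ : 0 < κ) (he : 0 < e) (hq : 0 < q) (hD : 0 < D) (x y w : Fin n → ℝ)
    (hx : ∀ j, 1 ≤ x j) (hy : ∀ j, 1 ≤ y j) (hw : ∀ j, 1 ≤ w j) (hwxy : ∀ j, w j ≤ D * (x j * y j)) :
    ((2 * q + 1) * n) ^ (n * q / 2) * (∏ j, (κ * w j ^ (-e)) ^ (-(q / 2))) * (∏ j, Real.sqrt (4 * Real.pi / (κ * x j ^ (-e)))) ^ d ≤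
      (((2 * q + 1) ^ (q / 2) * (κ ^ (-(q / 2)) * D ^ (e * q / 2)) * (Real.sqrt (4 * Real.pi / κ)) ^ d) ^ n * (n:ℝ) ^ (n * q / 2)) *
        ((∏ j, x j) ^ (e * (d + 2 * q) / 2) + (∏ j, y j) ^ (e * (d + 2 * q) / 2)) := by
  have hx0 : ∀ j, 0 < x j := fun j => lt_of_lt_of_le one_pos (hx j)
  have hy0 : ∀ j, 0 < y j := fun j => lt_of_lt_of_le one_pos (hy j)
  have hw0 : ∀ j, 0 < w j := fun j => lt_of_lt_of_le one_pos (hw j)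
  have h1 : ∀ j, (κ * w j ^ (-e)) ^ (-(q / 2)) ≤ κ ^ (-(q / 2)) * D ^ (e * q / 2) * (x j ^ (e * q / 2) * y j ^ (e * q / 2)) := by
    intro j
    have := hx0 j; have := hy0 j; have := hw0 j
    rw [Real.mul_rpow hκ.le (by positivity), ← Real.rpow_mul (hw0 j).le, mul_assoc, ← Real.mul_rpow (by positivity) (by positivity),
      ← Real.mul_rpow (by positivity) (by positivity)]
    rw [show -e * -(q/2) = e * q / 2 by ring]
    gcongr
    exact hwxy j
  have h2 : ∀ j, Real.sqrt (4 * Real.pi / (κ * x j ^ (-e))) = Real.sqrt (4 * Real.pi / κ) * x j ^ (e / 2) := by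
    intro j
    have := hx0 j
    rw [show 4 * Real.pi / (κ * x j ^ (-e)) = 4 * Real.pi / κ * x j ^ e by
      rw [Real.rpow_neg (hx0 j).le]; field_simp]
    rw [Real.sqrt_mul (by positivity), Real.sqrt_eq_rpow (x j ^ e), ← Real.rpow_mul (hx0 j).le]
    congr 2; ring
  have h3 : ∏ j, (κ * w j ^ (-e)) ^ (-(q / 2)) ≤ (κ ^ (-(q / 2)) * D ^ (e * q / 2)) ^ n * ((∏ j, x j) ^ (e * q / 2) * (∏ j, y j) ^ (e * q / 2)) := by
    refine (Finset.prod_le_prod (fun j _ => ?_) (fun j _ => h1 j)).trans (le_of_eq ?_)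
    · have := hw0 j; positivity
    · simp only [Finset.prod_mul_distrib]
      rw [Real.finsetProd_rpow _ _ (fun j _ => (hx0 j).le),
        Real.finsetProd_rpow _ _ (fun j _ => (hy0 j).le)]
      simp [mul_pow]
  have hX1 : 1 ≤ ∏ j, x j := by
    simpa using Finset.prod_le_prod (s := Finset.univ) (f := fun _ : Fin n => (1:ℝ)) (fun _ _ => zero_le_one) (fun j _ => hx j)
  have hY1 : 1 ≤ ∏ j, y j := by
    simpa using Finset.prod_le_prod (s := Finset.univ) (f := fun _ : Fin n => (1:ℝ)) (fun _ _ => zero_le_one) (fun j _ => hy j)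
  have h4 : (∏ j, Real.sqrt (4 * Real.pi / (κ * x j ^ (-e)))) ^ d = ((Real.sqrt (4 * Real.pi / κ)) ^ d) ^ n * (∏ j, x j) ^ (e * d / 2) := by
    simp only [h2]
    rw [Finset.prod_mul_distrib, mul_pow, Real.finsetProd_rpow _ _ (fun j _ => (hx0 j).le), ← Real.rpow_natCast (((∏ j, x j)) ^ (e / 2)),
      ← Real.rpow_mul (by linarith)]
    simp only [Finset.prod_const, Finset.card_univ, Fintype.card_fin]
    rw [← pow_mul, ← pow_mul, mul_comm n d]
    congr 2; ring
  generalize hXd : ∏ j, x j = X at *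
  generalize hYd : ∏ j, y j = Y at *
  rw [h4]
  have hX0 : 0 < X := by linarith
  have hY0 : 0 < Y := by linarith
  have hn0 : (0:ℝ) < n := by exact_mod_cast hn
  have h5 : ((2 * q + 1) * n) ^ (n * q / 2) = ((2 * q + 1) ^ (q / 2)) ^ n * (n:ℝ) ^ (n * q / 2) := by
    rw [Real.mul_rpow (by positivity) hn0.le, ← Real.rpow_natCast ((2 * q + 1) ^ (q / 2)), ← Real.rpow_mul (by positivity)]
    congr 2; ring
  rw [h5]
  have h6 := XY_bound X Y (e * q / 2 + e * d / 2) (e * q / 2) hX1 hY1 (by positivity) (by positivity)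
  rw [show e * q / 2 + e * d / 2 + e * q / 2 = e * (d + 2 * q) / 2 by ring, Real.rpow_add hX0] at h6
  calc _ ≤ ((2 * q + 1) ^ (q / 2)) ^ n * (n:ℝ) ^ (n * q / 2) * ((κ ^ (-(q / 2)) * D ^ (e * q / 2)) ^ n * (X ^ (e * q / 2) * Y ^ (e * q / 2))) *
        (((Real.sqrt (4 * Real.pi / κ)) ^ d) ^ n * X ^ (e * d / 2)) := by gcongr
    _ = (((2 * q + 1) ^ (q / 2) * (κ ^ (-(q / 2)) * D ^ (e * q / 2)) * (Real.sqrt (4 * Real.pi / κ)) ^ d) ^ n * (n:ℝ) ^ (n * q / 2)) *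
        (X ^ (e * q / 2) * X ^ (e * d / 2) * Y ^ (e * q / 2)) := by
        simp only [mul_pow]; ring
    _ ≤ _ := by gcongr

lemma J_pointwise (N : ℕ) (hN : 1 ≤ N) (H β : ℝ) (hH1 : 1 / 2 ≤ H) (hH2 : H < 1)
    (hβ0 : 0 < β) (hβN : β < N) (hβlow : (N : ℝ) - 2 * H - 1 < β)
    (hfun : EuclideanSpace ℝ (Fin N) → ℝ) (hmeas : Measurable hfun)
    (c₁ c₂ : ℝ) (hc₁ : 0 < c₁) (hc₁₂ : c₁ ≤ c₂)
    (hflow : ∀ ξ : EuclideanSpace ℝ (Fin N), ξ ≠ 0 → c₁ * ‖ξ‖ ^ (-β) ≤ hfun ξ)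
    (hfup : ∀ ξ : EuclideanSpace ℝ (Fin N), ξ ≠ 0 → hfun ξ ≤ c₂ * ‖ξ‖ ^ (-β))
    (d : ℕ) (q : ℝ) (hq : 0 < q) (Ta Tb : ℝ) (hTa : 0 < Ta) (b : ℝ) (hb : 0 < b)
    (B : Fin (N+1) → Set (EuclideanSpace ℝ (Fin N)))
    (hB : ∀ l, MeasurableSet (B l) ∧ volume (B l) ≠ 0 ∧ volume (B l) ≠ ⊤ ∧ ∀ η ∈ B l, 1/2 ≤ ‖η‖ ∧ ‖η‖ ≤ 2) :
    ∃ A : ℝ, 0 < A ∧ ∀ n : ℕ, 1 ≤ n → ∀ qm : Fin n → Fin d → ℝ,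
      (∀ j k, 0 ≤ qm j k) → (∀ j, ∑ k, qm j k = q) →
      ∀ z : Fin n → ℝ × EuclideanSpace ℝ (Fin N), (∀ j, (z j).1 ∈ Icc Ta Tb) →
      ∏ k : Fin d, ∫⁻ c : Fin n → ℝ,
        ENNReal.ofReal ((∏ j, |c j| ^ (qm j k)) * Real.exp (-(1 / 2) * Qvar N H hfun z c)) ≤
      ENNReal.ofReal (A ^ n * (n:ℝ) ^ (n * q / 2)) *
        ((∏ j, PP b B (Finset.Iio j) z (z j)) ^ (alphaExp N H β * (d + 2 * q) / (b * (N + 1))) +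
         (∏ j, PP b B (Finset.Ioi j) z (z j)) ^ (alphaExp N H β * (d + 2 * q) / (b * (N + 1)))) := by
  obtain ⟨κ₁, hκ₁, hQ⟩ := Q_lower N hN H β hH1 hH2 hβ0 hβN hβlow hfun hmeas c₁ c₂ hc₁ hc₁₂ hflow hfup Ta Tb hTa
  obtain ⟨κ₂, hκ₂, hl⟩ := lnd_prod N hN H β hH1 hH2 hβ0 hβN hβlow b hb B hB
  have homi := om_integrable N hN H β hH1 hβ0 hβN hβlow
  have hα : 0 < alphaExp N H β := by unfold alphaExp; linarith
  obtain ⟨e, he⟩ : ∃ e, e = 2 * alphaExp N H β / (b * (N + 1)) := ⟨_, rfl⟩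
  have he0 : 0 < e := by rw [he]; positivity
  obtain ⟨κ, hκd⟩ : ∃ κ, κ = κ₁ * κ₂ := ⟨_, rfl⟩
  have hκ : 0 < κ := by rw [hκd]; positivity
  have hr : alphaExp N H β * (d + 2 * q) / (b * (N + 1)) = e * (d + 2 * q) / 2 := by rw [he]; ring
  rw [← he] at hl
  rw [hr]
  have hr0 : 0 < e * (d + 2 * q) / 2 := by positivity
  refine ⟨(2 * q + 1) ^ (q / 2) * (κ ^ (-(q / 2)) * ((2:ℝ) ^ (N+1)) ^ (e * q / 2)) * (Real.sqrt (4 * Real.pi / κ)) ^ d, ?_, ?_⟩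
  · have := Real.pi_pos
    positivity
  intro n hn qm hqm hqs z hz
  have hAn : 0 < ((2 * q + 1) ^ (q / 2) * (κ ^ (-(q / 2)) * ((2:ℝ) ^ (N+1)) ^ (e * q / 2)) * (Real.sqrt (4 * Real.pi / κ)) ^ d) ^ n * (n:ℝ) ^ (n * q / 2) := by
    have := Real.pi_pos
    have : (0:ℝ) < n := by exact_mod_cast hn
    positivity
  have hP1 : ∀ S j, 1 ≤ PP b B S z (z j) := fun S j => PP_one b hb hn B hB S z (z j)
  by_cases hX : ∏ j, PP b B (Finset.Iio j) z (z j) = ⊤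
  · rw [hX, ENNReal.top_rpow_of_pos hr0, top_add, ENNReal.mul_top (ENNReal.ofReal_pos.mpr hAn).ne']
    exact le_top
  by_cases hY : ∏ j, PP b B (Finset.Ioi j) z (z j) = ⊤
  · rw [hY, ENNReal.top_rpow_of_pos hr0, add_top, ENNReal.mul_top (ENNReal.ofReal_pos.mpr hAn).ne']
    exact le_top
  have hXj : ∀ j, PP b B (Finset.Iio j) z (z j) ≠ ⊤ := fun j h =>
    hX (top_le_iff.mp (h ▸ prod_comp_le (fun j => PP b B (Finset.Iio j) z (z j)) (fun j => hP1 _ j) j))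
  have hYj : ∀ j, PP b B (Finset.Ioi j) z (z j) ≠ ⊤ := fun j h =>
    hY (top_le_iff.mp (h ▸ prod_comp_le (fun j => PP b B (Finset.Ioi j) z (z j)) (fun j => hP1 _ j) j))
  have hWle : ∀ j, PP b B (Finset.univ.erase j) z (z j) ≤ 2 ^ (N+1) * (PP b B (Finset.Iio j) z (z j) * PP b B (Finset.Ioi j) z (z j)) :=
    fun j => PP_all b hb B hB j z (z j)
  have hRHS : ∀ j, 2 ^ (N+1) * (PP b B (Finset.Iio j) z (z j) * PP b B (Finset.Ioi j) z (z j)) ≠ ⊤ := fun j =>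
    ENNReal.mul_ne_top (by simp) (ENNReal.mul_ne_top (hXj j) (hYj j))
  have hWj : ∀ j, PP b B (Finset.univ.erase j) z (z j) ≠ ⊤ := fun j => ne_top_of_le_ne_top (hRHS j) (hWle j)
  have hto : ∀ S j, PP b B S z (z j) ≠ ⊤ → 1 ≤ (PP b B S z (z j)).toReal := fun S j h => by
    have := ENNReal.toReal_mono h (hP1 S j); simpa using this
  have hreal := real_bound n d hn κ e q ((2:ℝ) ^ (N+1)) hκ he0 hq (by positivity)
    (fun j => (PP b B (Finset.Iio j) z (z j)).toReal) (fun j => (PP b B (Finset.Ioi j) z (z j)).toReal)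
    (fun j => (PP b B (Finset.univ.erase j) z (z j)).toReal)
    (fun j => hto _ j (hXj j)) (fun j => hto _ j (hYj j)) (fun j => hto _ j (hWj j)) (fun j => by
      have := ENNReal.toReal_mono (hRHS j) (hWle j)
      simpa [ENNReal.toReal_mul, ENNReal.toReal_pow] using this)
  have hquad : ∀ c : Fin n → ℝ, ∑ i, ∑ k, (κ₁ * Mt N H β z i k) * c i * c k = κ₁ * Qt N H β z c := by
    intro c
    rw [Qt_quad homi, Finset.mul_sum]
    refine Finset.sum_congr rfl fun i _ => ?_
    rw [Finset.mul_sum]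
    refine Finset.sum_congr rfl fun k _ => ?_
    ring
  have hJ := J_bound n d hn (fun i k => κ₁ * Mt N H β z i k) (fun i k => by rw [Mt_symm])
    (fun j => κ * (PP b B (Finset.Iio j) z (z j)).toReal ^ (-e))
    (fun j => κ * (PP b B (Finset.univ.erase j) z (z j)).toReal ^ (-e))
    (fun j => by have := lt_of_lt_of_le one_pos (hto _ j (hXj j)); positivity)
    (fun j => by have := lt_of_lt_of_le one_pos (hto _ j (hWj j)); positivity)
    (fun c j hc => by
      rw [hquad]
      have := hl n z c j (Finset.Iio j) (fun i hij hci => by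
        rw [Finset.mem_Iio]
        by_contra hlt
        exact hci (hc i (lt_of_le_of_ne (not_lt.mp hlt) (Ne.symm hij)))) (hXj j)
      have := mul_le_mul_of_nonneg_left this hκ₁.le
      rw [hκd]; linarith)
    (fun c j => by
      rw [hquad]
      have := hl n z c j (Finset.univ.erase j) (fun i hij hci => by simp [hij]) (hWj j)
      have := mul_le_mul_of_nonneg_left this hκ₁.le
      rw [hκd]; linarith)
    (fun c => Qvar N H hfun z c) (fun c => by rw [hquad]; exact hQ n z hz c) q hq qm hqm hqs
  refine hJ.trans ?_
  rw [← ENNReal.ofReal_prod_of_nonneg (fun j _ => Real.sqrt_nonneg _), ← ENNReal.ofReal_pow (Finset.prod_nonneg fun j _ => Real.sqrt_nonneg _),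
    ← ENNReal.ofReal_mul]
  · refine (ENNReal.ofReal_le_ofReal hreal).trans (le_of_eq ?_)
    rw [ENNReal.ofReal_mul hAn.le]
    congr 1
    have hprod : ∀ f : Fin n → ℝ≥0∞, ∏ j, f j ≠ ⊤ → ENNReal.ofReal ((∏ j, (f j).toReal) ^ (e * (d + 2 * q) / 2)) = (∏ j, f j) ^ (e * (d + 2 * q) / 2) := by
      intro f hf
      rw [← ENNReal.toReal_prod, ← ENNReal.ofReal_rpow_of_nonneg ENNReal.toReal_nonneg hr0.le, ENNReal.ofReal_toReal hf]
    rw [ENNReal.ofReal_add (by positivity) (by positivity), hprod _ hX, hprod _ hY]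
  · refine mul_nonneg (by positivity) (Finset.prod_nonneg fun j _ => by positivity)

lemma PP_congr {N : ℕ} (b : ℝ) {n : ℕ} (B : Fin (N+1) → Set (EuclideanSpace ℝ (Fin N))) (S : Finset (Fin n))
    (z z' : Fin n → ℝ × EuclideanSpace ℝ (Fin N)) (x : ℝ × EuclideanSpace ℝ (Fin N)) (h : ∀ i ∈ S, z i = z' i) :
    PP b B S z x = PP b B S z' x := by
  unfold PP Ph Fn
  have : ∀ η, ∑ i ∈ S, Kn b n (yf η x - yf η (z i)) = ∑ i ∈ S, Kn b n (yf η x - yf η (z' i)) := fun η =>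
    Finset.sum_congr rfl fun i hi => by rw [h i hi]
  simp only [this]

lemma PP_meas {N : ℕ} (b : ℝ) {n : ℕ} (B : Fin (N+1) → Set (EuclideanSpace ℝ (Fin N))) (S : Finset (Fin n)) (j : Fin n) :
    Measurable (fun z : Fin n → ℝ × EuclideanSpace ℝ (Fin N) => PP b B S z (z j)) := by
  unfold PP
  refine Finset.measurable_prod _ fun l _ => ?_
  exact (Ph_meas b (B l) S).comp (f := fun z : Fin n → ℝ × EuclideanSpace ℝ (Fin N) => (z, z j)) (by fun_prop)

lemma XY_int {N : ℕ} (b : ℝ) (B : Fin (N+1) → Set (EuclideanSpace ℝ (Fin N)))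
    (I : Set (ℝ × EuclideanSpace ℝ (Fin N))) (n : ℕ) (K : ℝ≥0∞)
    (hK : ∀ (S : Finset (Fin n)) z, ∫⁻ x in I, PP b B S z x ≤ K) :
    (∫⁻ z in univ.pi (fun _ : Fin n => I), ∏ j, PP b B (Finset.Iio j) z (z j) ≤ K ^ n) ∧
    (∫⁻ z in univ.pi (fun _ : Fin n => I), ∏ j, PP b B (Finset.Ioi j) z (z j) ≤ K ^ n) := by
  rw [volume_pi, Measure.restrict_pi_pi]
  constructor
  · refine iter_low (volume.restrict I) K n (fun j z => PP b B (Finset.Iio j) z (z j)) (fun j => PP_meas b B _ j) ?_ ?_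
    · intro j z z' h
      show PP b B _ z (z j) = PP b B _ z' (z' j)
      rw [h j le_rfl]
      exact PP_congr b B _ _ _ _ fun i hi => h i (Finset.mem_Iio.mp hi).le
    · intro j z
      refine le_trans (le_of_eq ?_) (hK (Finset.Iio j) z)
      refine lintegral_congr fun x => ?_
      simp only [Function.update_self]
      refine PP_congr b B _ _ _ _ fun i hi => Function.update_of_ne (Finset.mem_Iio.mp hi).ne _ _
  · refine iter_high (volume.restrict I) K n (fun j z => PP b B (Finset.Ioi j) z (z j)) (fun j => PP_meas b B _ j) ?_ ?_
    · intro j z z' h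
      show PP b B _ z (z j) = PP b B _ z' (z' j)
      rw [h j le_rfl]
      exact PP_congr b B _ _ _ _ fun i hi => h i (Finset.mem_Ioi.mp hi).le
    · intro j z
      refine le_trans (le_of_eq ?_) (hK (Finset.Ioi j) z)
      refine lintegral_congr fun x => ?_
      simp only [Function.update_self]
      refine PP_congr b B _ _ _ _ fun i hi => Function.update_of_ne (Finset.mem_Ioi.mp hi).ne' _ _

lemma holder_one {X : Type*} [MeasurableSpace X] (μ : Measure X) (f : X → ℝ≥0∞) (hf : Measurable f) (r : ℝ) (hr0 : 0 ≤ r) (hr1 : r ≤ 1) :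
    ∫⁻ x, f x ^ r ∂μ ≤ (∫⁻ x, f x ∂μ) ^ r * (μ univ) ^ (1 - r) := by
  have := ENNReal.lintegral_mul_norm_pow_le (μ := μ) hf.aemeasurable (aemeasurable_const (b := (1:ℝ≥0∞))) hr0
    (by linarith : 0 ≤ 1 - r) (by ring)
  simpa using this

lemma yf_bound {N : ℕ} (Ta Tb : ℝ) (Xa Xb : Fin N → ℝ) : ∃ R : ℝ, 0 ≤ R ∧
    ∀ x ∈ {p : ℝ × EuclideanSpace ℝ (Fin N) | p.1 ∈ Icc Ta Tb ∧ ∀ i, p.2 i ∈ Icc (Xa i) (Xb i)},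
      ∀ η : EuclideanSpace ℝ (Fin N), ‖η‖ ≤ 2 → |yf η x| ≤ R := by
  refine ⟨max |Ta| |Tb| * 2 + (∑ i, max |Xa i| |Xb i|) * 2, by positivity, fun x hx η hη => ?_⟩
  obtain ⟨h1, h2⟩ := hx
  unfold yf
  have h3 : |x.1| ≤ max |Ta| |Tb| := abs_le_max_abs_abs h1.1 h1.2
  have h4 : ‖x.2‖ ≤ ∑ i, max |Xa i| |Xb i| := by
    have h5 : ‖x.2‖ ≤ ∑ i, |x.2 i| := by
      rw [EuclideanSpace.norm_eq, Real.sqrt_le_left (Finset.sum_nonneg fun i _ => abs_nonneg _)]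
      simp only [Real.norm_eq_abs]
      exact Finset.sum_sq_le_sq_sum_of_nonneg fun i _ => abs_nonneg _
    exact h5.trans (Finset.sum_le_sum fun i _ => abs_le_max_abs_abs (h2 i).1 (h2 i).2)
  refine (abs_add_le _ _).trans ?_
  refine add_le_add ?_ ?_
  · rw [abs_mul, abs_of_nonneg (norm_nonneg η)]
    gcongr
  · refine (abs_real_inner_le_norm _ _).trans ?_
    gcongr

lemma box_meas {N : ℕ} (ia ib : ℝ) (ja jb : Fin N → ℝ) :
    MeasurableSet {p : ℝ × EuclideanSpace ℝ (Fin N) | p.1 ∈ Icc ia ib ∧ ∀ i, p.2 i ∈ Icc (ja i) (jb i)} := by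
  have : {p : ℝ × EuclideanSpace ℝ (Fin N) | p.1 ∈ Icc ia ib ∧ ∀ i, p.2 i ∈ Icc (ja i) (jb i)} =
      (fun p : ℝ × EuclideanSpace ℝ (Fin N) => p.1) ⁻¹' Icc ia ib ∩ ⋂ i, (fun p : ℝ × EuclideanSpace ℝ (Fin N) => p.2 i) ⁻¹' Icc (ja i) (jb i) := by
    ext p; simp
  rw [this]
  refine (measurableSet_Icc.preimage (by fun_prop)).inter (MeasurableSet.iInter fun i => measurableSet_Icc.preimage (by fun_prop))

lemma const_final (A G r a q E : ℝ) (n : ℕ) (hn : 1 ≤ n) (hA : 0 < A) (hG : 0 < G) (hp : 0 ≤ q / 2 + E * r) (ha : a = q / 2 + E * r) :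
    A ^ n * (n:ℝ) ^ (n * q / 2) * (2 * ((G * (n:ℝ) ^ E) ^ n) ^ r) ≤
      (2 * A * G ^ r * Real.exp a) ^ n * (n.factorial : ℝ) ^ a := by
  have hn0 : (0:ℝ) < n := by exact_mod_cast hn
  have h1 : ((G * (n:ℝ) ^ E) ^ n) ^ r = (G ^ r) ^ n * (n:ℝ) ^ (n * (E * r)) := by
    rw [mul_pow, Real.mul_rpow (by positivity) (by positivity), ← Real.rpow_natCast, ← Real.rpow_natCast, ← Real.rpow_natCast,
      ← Real.rpow_mul hG.le, ← Real.rpow_mul hG.le, ← Real.rpow_mul hn0.le, ← Real.rpow_mul hn0.le]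
    congr 2 <;> ring
  have h2 : (n:ℝ) ^ (n * q / 2) * (n:ℝ) ^ (n * (E * r)) ≤ (Real.exp a) ^ n * (n.factorial : ℝ) ^ a := by
    rw [← Real.rpow_add hn0, show n * q / 2 + n * (E * r) = n * a by rw [ha]; ring, Real.rpow_mul hn0.le, Real.rpow_natCast]
    have h3 : (n:ℝ) ^ n ≤ Real.exp n * n.factorial := by
      have := Real.pow_div_factorial_le_exp (n:ℝ) hn0.le n
      rwa [div_le_iff₀ (by positivity)] at this
    calc ((n:ℝ) ^ n) ^ a ≤ (Real.exp n * n.factorial) ^ a := Real.rpow_le_rpow (by positivity) h3 (ha ▸ hp)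
      _ = _ := by
        rw [Real.mul_rpow (Real.exp_pos _).le (by positivity), ← Real.exp_mul, ← Real.exp_nat_mul]
  have h4 : (2:ℝ) ≤ 2 ^ n := by
    calc (2:ℝ) = 2 ^ 1 := by norm_num
      _ ≤ 2 ^ n := pow_le_pow_right₀ (by norm_num) hn
  rw [h1]
  calc _ = 2 * (A ^ n * (G ^ r) ^ n) * ((n:ℝ) ^ (n * q / 2) * (n:ℝ) ^ (n * (E * r))) := by ring
    _ ≤ 2 ^ n * (A ^ n * (G ^ r) ^ n) * ((Real.exp a) ^ n * (n.factorial : ℝ) ^ a) := by gcongr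
    _ = _ := by simp only [mul_pow]; ring

theorem moment_main
    (N : ℕ) (hN : 1 ≤ N) (H β : ℝ) (hH1 : 1 / 2 ≤ H) (hH2 : H < 1)
    (hβ0 : 0 < β) (hβN : β < N)
    (hβlow : (N : ℝ) - 2 * H - 1 < β)
    (hfun : EuclideanSpace ℝ (Fin N) → ℝ) (hmeas : Measurable hfun)
    (c₁ c₂ : ℝ) (hc₁ : 0 < c₁) (hc₁₂ : c₁ ≤ c₂)
    (hflow : ∀ ξ : EuclideanSpace ℝ (Fin N), ξ ≠ 0 → c₁ * ‖ξ‖ ^ (-β) ≤ hfun ξ)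
    (hfup : ∀ ξ : EuclideanSpace ℝ (Fin N), ξ ≠ 0 → hfun ξ ≤ c₂ * ‖ξ‖ ^ (-β))
    (d : ℕ) (hd : 1 ≤ d) (q : ℝ) (hq : 0 < q)
    (hαq : alphaExp N H β * (d + 2 * q) < 1 + N)
    (Ta Tb : ℝ) (hTa : 0 < Ta) (Xa Xb : Fin N → ℝ) :
    ∃ C : ℝ, 0 < C ∧
      ∀ n : ℕ, 1 ≤ n →
        ∀ qm : Fin n → Fin d → ℝ,
          (∀ j k, 0 ≤ qm j k) → (∀ j, ∑ k, qm j k = q) →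
          ∀ I : Set (ℝ × EuclideanSpace ℝ (Fin N)), MeasurableSet I →
            I ⊆ {p : ℝ × EuclideanSpace ℝ (Fin N) | p.1 ∈ Icc Ta Tb ∧ ∀ i, p.2 i ∈ Icc (Xa i) (Xb i)} →
            (∫⁻ z in Set.univ.pi (fun _ : Fin n => I),
              ∏ k : Fin d, ∫⁻ c : Fin n → ℝ,
                ENNReal.ofReal ((∏ j, |c j| ^ (qm j k)) *
                  Real.exp (-(1 / 2) * Qvar N H hfun z c))) ≤
              ENNReal.ofReal (C ^ n *
                  (n.factorial : ℝ) ^ (alphaExp N H β * d + (1 / 2 + 2 * alphaExp N H β) * q)) *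
                (volume I) ^
                  ((n : ℝ) * (1 - alphaExp N H β * (d + 2 * q) / (1 + N)) *
                    (d / (d + 2 * q))) := by
  have hα : 0 < alphaExp N H β := by unfold alphaExp; linarith
  obtain ⟨α, hαd⟩ : ∃ α, α = alphaExp N H β := ⟨_, rfl⟩
  have hd0 : (0:ℝ) < d := by exact_mod_cast hd
  have hN0 : (0:ℝ) < 1 + N := by positivity
  obtain ⟨b₀, hb₀⟩ : ∃ b₀, b₀ = α * (d + 2 * q) / (1 + N) := ⟨_, rfl⟩
  rw [← hαd] at hα hαq
  have hb₀0 : 0 < b₀ := by rw [hb₀]; positivity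
  have hb₀1 : b₀ < 1 := by rw [hb₀, div_lt_one hN0]; exact hαq
  obtain ⟨θ, hθ⟩ : ∃ θ, θ = (1 - b₀) * (d / (d + 2 * q)) := ⟨_, rfl⟩
  have hfrac : (d:ℝ) / (d + 2 * q) < 1 := by rw [div_lt_one (by positivity)]; linarith
  have hθ0 : 0 ≤ θ := by
    rw [hθ]; have : 0 < 1 - b₀ := by linarith
    positivity
  have hθ1 : θ < 1 - b₀ := by rw [hθ]; exact mul_lt_of_lt_one_right (by linarith) hfrac
  obtain ⟨r, hr⟩ : ∃ r, r = 1 - θ := ⟨_, rfl⟩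
  have hr0 : 0 < r := by linarith
  have hr1 : r ≤ 1 := by linarith
  obtain ⟨b, hbd⟩ : ∃ b, b = b₀ / r := ⟨_, rfl⟩
  have hb0 : 0 < b := by rw [hbd]; positivity
  have hb1 : b < 1 := by rw [hbd, div_lt_one hr0]; linarith
  have hb' : 0 < 1 - b := by linarith
  have hrexp : α * (d + 2 * q) / (b * (N + 1)) = r := by
    rw [hbd, hb₀]; field_simp
    try ring
  obtain ⟨B, c, hc, hB, hdet⟩ := balls_exist hN
  obtain ⟨R, hR, hyf⟩ := yf_bound Ta Tb Xa Xb
  obtain ⟨A, hA, hJ⟩ := J_pointwise N hN H β hH1 hH2 hβ0 hβN hβlow hfun hmeas c₁ c₂ hc₁ hc₁₂ hflow hfup d q hq Ta Tb hTa b hb0 B hB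
  obtain ⟨G, hGd⟩ : ∃ G, G = c⁻¹ * (2 * R + 2 / (1 - b)) ^ (N+1) := ⟨_, rfl⟩
  have hG : 0 < G := by rw [hGd]; positivity
  have haeq : α * d + (1 / 2 + 2 * α) * q = q / 2 + (b * (N + 1)) * r := by
    have : b * (N + 1) * r = α * (d + 2 * q) := by
      rw [← hrexp]; field_simp
    rw [this]; ring
  rw [← hαd, hrexp] at hJ
  rw [← hαd]
  refine ⟨2 * A * G ^ r * Real.exp (α * d + (1 / 2 + 2 * α) * q), by positivity, ?_⟩
  intro n hn qm hqm hqs I hIm hIT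
  have hn0 : (0:ℝ) < n := by exact_mod_cast hn
  obtain ⟨K, hKd⟩ : ∃ K, K = ENNReal.ofReal (G * (n:ℝ) ^ (b * (N + 1))) := ⟨_, rfl⟩
  have hK : ∀ (S : Finset (Fin n)) z, ∫⁻ x in I, PP b B S z x ≤ K := by
    intro S z
    refine (Ph_prod_int N b hb0 hb1 R hR c hc B hB hdet I hIm (fun x hx l η hη => hyf x (hIT hx) η ((hB l).2.2.2 η hη).2) n hn S z).trans (le_of_eq ?_)
    rw [hKd, hGd, mul_pow, mul_assoc]
    congr 3
    rw [← Real.rpow_natCast, ← Real.rpow_mul hn0.le]; push_cast; rfl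
  obtain ⟨hX, hY⟩ := XY_int b B I n K hK
  have hpm : MeasurableSet (univ.pi (fun _ : Fin n => I)) := MeasurableSet.univ_pi fun _ => hIm
  have hvol : volume (univ.pi (fun _ : Fin n => I)) = (volume I) ^ n := by
    rw [volume_pi, Measure.pi_pi]; simp
  have hXm : Measurable (fun z : Fin n → ℝ × EuclideanSpace ℝ (Fin N) => ∏ j, PP b B (Finset.Iio j) z (z j)) :=
    Finset.measurable_prod _ fun j _ => PP_meas b B _ j
  have hYm : Measurable (fun z : Fin n → ℝ × EuclideanSpace ℝ (Fin N) => ∏ j, PP b B (Finset.Ioi j) z (z j)) :=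
    Finset.measurable_prod _ fun j _ => PP_meas b B _ j
  have hhold : ∀ f : (Fin n → ℝ × EuclideanSpace ℝ (Fin N)) → ℝ≥0∞, Measurable f →
      ∫⁻ z in univ.pi (fun _ : Fin n => I), f z ≤ K ^ n →
      ∫⁻ z in univ.pi (fun _ : Fin n => I), f z ^ r ≤ (K ^ n) ^ r * ((volume I) ^ n) ^ θ := by
    intro f hf hle
    have h1 := holder_one (volume.restrict (univ.pi (fun _ : Fin n => I))) f hf r hr0.le hr1
    rw [Measure.restrict_apply_univ, hvol, show 1 - r = θ by rw [hr]; ring] at h1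
    refine h1.trans ?_
    gcongr
  have hvexp : ((volume I) ^ n) ^ θ = (volume I) ^ ((n : ℝ) * (1 - α * (d + 2 * q) / (1 + N)) * (d / (d + 2 * q))) := by
    rw [← ENNReal.rpow_natCast, ← ENNReal.rpow_mul, hθ, hb₀, mul_assoc]
  calc _ ≤ ∫⁻ z in univ.pi (fun _ : Fin n => I), ENNReal.ofReal (A ^ n * (n:ℝ) ^ (n * q / 2)) *
        ((∏ j, PP b B (Finset.Iio j) z (z j)) ^ r + (∏ j, PP b B (Finset.Ioi j) z (z j)) ^ r) :=
        setLIntegral_mono' hpm fun z hz => hJ n hn qm hqm hqs z fun j => (hIT (hz j (mem_univ _))).1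
    _ = ENNReal.ofReal (A ^ n * (n:ℝ) ^ (n * q / 2)) *
        ((∫⁻ z in univ.pi (fun _ : Fin n => I), (∏ j, PP b B (Finset.Iio j) z (z j)) ^ r) +
          ∫⁻ z in univ.pi (fun _ : Fin n => I), (∏ j, PP b B (Finset.Ioi j) z (z j)) ^ r) := by
        have hsm : Measurable (fun z : Fin n → ℝ × EuclideanSpace ℝ (Fin N) =>
            (∏ j, PP b B (Finset.Iio j) z (z j)) ^ r + (∏ j, PP b B (Finset.Ioi j) z (z j)) ^ r) :=
          (hXm.pow_const r).add (hYm.pow_const r)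
        rw [lintegral_const_mul _ hsm, lintegral_add_left (hXm.pow_const r)]
    _ ≤ ENNReal.ofReal (A ^ n * (n:ℝ) ^ (n * q / 2)) *
        ((K ^ n) ^ r * ((volume I) ^ n) ^ θ + (K ^ n) ^ r * ((volume I) ^ n) ^ θ) :=
        mul_le_mul_right (add_le_add (hhold _ hXm hX) (hhold _ hYm hY)) _
    _ = ENNReal.ofReal (A ^ n * (n:ℝ) ^ (n * q / 2) * (2 * ((G * (n:ℝ) ^ (b * (N + 1))) ^ n) ^ r)) * ((volume I) ^ n) ^ θ := by
        rw [hKd, ← two_mul, ← ENNReal.ofReal_pow (by positivity), ENNReal.ofReal_rpow_of_nonneg (by positivity) hr0.le,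
          ENNReal.ofReal_mul (by positivity : (0:ℝ) ≤ A ^ n * (n:ℝ) ^ (n * q / 2)), ENNReal.ofReal_mul (by norm_num : (0:ℝ) ≤ 2)]
        rw [show ENNReal.ofReal 2 = 2 by simp]
        ring
    _ ≤ _ := by
        rw [hvexp]
        refine mul_le_mul_left (ENNReal.ofReal_le_ofReal ?_) _
        exact const_final A G r _ q (b * (N + 1)) n hn hA hG (by positivity) haeq

/-- Lemma 4.8(i): the moment bound
`∫_{Iⁿ} J(z̄) dz̄ ≤ Cⁿ (n!)^{αd + (1/2 + 2α)q} λ_{1+N}(I)^{n(1 − α(d+2q)/(1+N))·d/(d+2q)}`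
for subintervals `I ⊆ T` with side lengths at most `r₀`, where `J(z̄)` is written via the
Gaussian integrals `∫_{ℝⁿ} (∏_j |c_j|^{q_{j,k}}) exp(−(1/2) Q(c; z̄)) dc`. -/
theorem moment_estimate_J_i
    (N : ℕ) (hN : 1 ≤ N) (H β : ℝ) (hH1 : 1 / 2 ≤ H) (hH2 : H < 1)
    (hβ0 : 0 < β) (hβN : β < N)
    (hβlow : (N : ℝ) - 2 * H - 1 < β) (hβup : β < (N : ℝ) - 2 * H + 1)
    (hfun : EuclideanSpace ℝ (Fin N) → ℝ) (hmeas : Measurable hfun)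
    (c₁ c₂ : ℝ) (hc₁ : 0 < c₁) (hc₁₂ : c₁ ≤ c₂)
    (hflow : ∀ ξ : EuclideanSpace ℝ (Fin N), ξ ≠ 0 → c₁ * ‖ξ‖ ^ (-β) ≤ hfun ξ)
    (hfup : ∀ ξ : EuclideanSpace ℝ (Fin N), ξ ≠ 0 → hfun ξ ≤ c₂ * ‖ξ‖ ^ (-β))
    (d : ℕ) (hd : 1 ≤ d) (q : ℝ) (hq : 0 < q)
    (hαq : alphaExp N H β * (d + 2 * q) < 1 + N)
    (Ta Tb : ℝ) (hTa : 0 < Ta) (Xa Xb : Fin N → ℝ) :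
    ∃ C r₀ : ℝ, 0 < C ∧ 0 < r₀ ∧
      ∀ n : ℕ, 2 ≤ n →
        ∀ qm : Fin n → Fin d → ℝ,
          (∀ j k, 0 ≤ qm j k) → (∀ j, ∑ k, qm j k = q) →
          ∀ (ia ib : ℝ) (ja jb : Fin N → ℝ),
            {p : ℝ × EuclideanSpace ℝ (Fin N) |
                p.1 ∈ Icc ia ib ∧ ∀ i, p.2 i ∈ Icc (ja i) (jb i)} ⊆
              {p : ℝ × EuclideanSpace ℝ (Fin N) |
                p.1 ∈ Icc Ta Tb ∧ ∀ i, p.2 i ∈ Icc (Xa i) (Xb i)} →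
            ib - ia ≤ r₀ → (∀ i, jb i - ja i ≤ r₀) →
            (∫⁻ z in Set.univ.pi (fun _ : Fin n =>
                {p : ℝ × EuclideanSpace ℝ (Fin N) |
                  p.1 ∈ Icc ia ib ∧ ∀ i, p.2 i ∈ Icc (ja i) (jb i)}),
              ∏ k : Fin d, ∫⁻ c : Fin n → ℝ,
                ENNReal.ofReal ((∏ j, |c j| ^ (qm j k)) *
                  Real.exp (-(1 / 2) * Qvar N H hfun z c))) ≤
              ENNReal.ofReal (C ^ n *
                  (n.factorial : ℝ) ^ (alphaExp N H β * d + (1 / 2 + 2 * alphaExp N H β) * q)) *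
                (volume {p : ℝ × EuclideanSpace ℝ (Fin N) |
                    p.1 ∈ Icc ia ib ∧ ∀ i, p.2 i ∈ Icc (ja i) (jb i)}) ^
                  ((n : ℝ) * (1 - alphaExp N H β * (d + 2 * q) / (1 + N)) *
                    (d / (d + 2 * q))) := by
  obtain ⟨C, hC, h⟩ := moment_main N hN H β hH1 hH2 hβ0 hβN hβlow hfun hmeas c₁ c₂ hc₁ hc₁₂
    hflow hfup d hd q hq hαq Ta Tb hTa Xa Xb
  exact ⟨C, 1, hC, one_pos, fun n hn qm hqm hqs ia ib ja jb hsub _ _ =>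
    h n (by omega) qm hqm hqs _ (box_meas ia ib ja jb) hsub⟩
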